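/- For every ε > 0 there exists a constant C > 0 such that for all real H ≥ 2, the number of quadruples (a,b,c,d) of integers with |a|,|b|,|c|,|d| ≤ H such that f(X) = X⁴ + aX³ + bX² + cX + d is irreducible over ℚ and the Galois group of its splitting field over ℚ is not isomorphic to the symmetric group S₄ is at most C·H^{5/2 + 1/√6 + ε}. -/

import Mathlib

open Polynomial

theorem card_congr_interval_le (T : Finset ℤ) (m : ℕ) (hm : 0 < m) (lo hi : ℝ) (hlh : lo ≤ hi)
    (hT : ∀ t ∈ T, lo ≤ t ∧ (t : ℝ) ≤ hi) (hmod : ∀ s ∈ T, ∀ t ∈ T, (m : ℤ) ∣ s - t) :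
    (T.card : ℝ) ≤ 1 + (hi - lo) / m := by
  have hm' : (0 : ℝ) < m := by exact_mod_cast hm
  rcases T.eq_empty_or_nonempty with rfl | hne
  · simp only [Finset.card_empty, Nat.cast_zero]
    have : 0 ≤ (hi - lo) / m := div_nonneg (by linarith) hm'.le
    linarith
  obtain ⟨s, hs, hmin⟩ := T.exists_min_image id hne
  simp only [id] at hmin
  have hk : ∀ t ∈ T, ∃ k : ℕ, t = s + m * k := by
    intro t ht
    obtain ⟨k, hk⟩ := hmod t ht s hs
    have h0 : 0 ≤ k := by
      have := hmin t ht
      by_contra h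
      have : (m : ℤ) * k < 0 := mul_neg_of_pos_of_neg (by exact_mod_cast hm) (by omega)
      omega
    exact ⟨k.toNat, by rw [Int.toNat_of_nonneg h0]; linarith⟩
  choose! k hk using hk
  have hcard : T.card ≤ (Finset.range (⌊(hi - lo) / m⌋₊ + 1)).card := by
    refine Finset.card_le_card_of_injOn k ?_ ?_
    · intro t ht
      simp only [Finset.coe_range, Set.mem_Iio, Nat.lt_succ_iff]
      refine Nat.le_floor ?_
      rw [le_div_iff₀ hm']
      have h1 := hk t ht
      have h2 : (t : ℝ) = s + m * k t := by exact_mod_cast h1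
      have := (hT t ht).2
      have := (hT s hs).1
      linarith
    · intro t ht t' ht' h
      rw [hk t ht, hk t' ht', h]
  rw [Finset.card_range] at hcard
  calc (T.card : ℝ) ≤ ((⌊(hi - lo) / m⌋₊ + 1 : ℕ) : ℝ) := by exact_mod_cast hcard
    _ ≤ _ := by
      push_cast
      have := Nat.floor_le (div_nonneg (by linarith : 0 ≤ hi - lo) hm'.le)
      linarith

/-- Integral points on a line segment. -/
theorem card_linear_le (p q r : ℤ) (hp : p ≠ 0) (Y : ℝ) (hY : 0 ≤ Y) (S : Finset (ℤ × ℤ))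
    (hS : ∀ s ∈ S, p * s.1 + q * s.2 = r ∧ |(s.2 : ℝ)| ≤ Y) :
    (S.card : ℝ) ≤ 1 + 2 * Y * Int.gcd p q / |(p : ℝ)| := by
  have hinj : Set.InjOn Prod.snd (S : Set (ℤ × ℤ)) := by
    intro s hs t ht h
    have h1 := (hS s hs).1
    have h2 := (hS t ht).1
    rw [h] at h1
    have : p * s.1 = p * t.1 := by linarith
    exact Prod.ext (mul_left_cancel₀ hp this) h
  rw [← Finset.card_image_of_injOn hinj]
  have hg : 0 < Int.gcd p q := Int.gcd_pos_of_ne_zero_left _ hp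
  obtain ⟨p', hp'⟩ := Int.gcd_dvd_left p q
  obtain ⟨q', hq'⟩ := Int.gcd_dvd_right p q
  have hcop : IsCoprime p' q' := by
    have := Int.gcd_div_gcd_div_gcd hg
    rw [Int.isCoprime_iff_gcd_eq_one]
    have h0 : ((Int.gcd p q : ℕ) : ℤ) ≠ 0 := by exact_mod_cast hg.ne'
    have e1 : p / (Int.gcd p q : ℕ) = p' := by
      nth_rewrite 1 [hp']; exact Int.mul_ediv_cancel_left _ h0
    have e2 : q / (Int.gcd p q : ℕ) = q' := by
      nth_rewrite 1 [hq']; exact Int.mul_ediv_cancel_left _ h0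
    rwa [e1, e2] at this
  have hp0 : p' ≠ 0 := by rintro rfl; exact hp (by rw [hp', mul_zero])
  have := card_congr_interval_le (S.image Prod.snd) p'.natAbs (Int.natAbs_pos.2 hp0) (-Y) Y
    (by linarith) (by
      intro t ht
      obtain ⟨s, hs, rfl⟩ := Finset.mem_image.1 ht
      exact abs_le.1 (hS s hs).2) (by
      intro t ht t' ht'
      obtain ⟨s, hs, rfl⟩ := Finset.mem_image.1 ht
      obtain ⟨s', hs', rfl⟩ := Finset.mem_image.1 ht'
      rw [Int.natAbs_dvd]
      refine hcop.dvd_of_dvd_mul_left ?_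
      have h0 : ((Int.gcd p q : ℕ) : ℤ) ≠ 0 := by exact_mod_cast hg.ne'
      refine ⟨s'.1 - s.1, mul_left_cancel₀ h0 ?_⟩
      have h1 := (hS s hs).1
      have h2 := (hS s' hs').1
      rw [← mul_assoc, ← mul_assoc, ← hp', ← hq']
      linarith)
  refine this.trans (le_of_eq ?_)
  have h1 : |(p : ℝ)| = Int.gcd p q * (p'.natAbs : ℝ) := by
    nth_rewrite 1 [hp']
    rw [Nat.cast_natAbs]
    push_cast
    rw [abs_mul, Nat.abs_cast]
  have : (0 : ℝ) < p'.natAbs := by exact_mod_cast Int.natAbs_pos.2 hp0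
  have : (0 : ℝ) < Int.gcd p q := by exact_mod_cast hg
  rw [h1]
  field_simp
  ring

theorem sum_gcd_div_le {m : ℕ} (hm : m ≠ 0) (N : ℕ) :
    ∑ n ∈ Finset.Icc 1 N, ((Nat.gcd m n : ℝ) / n) ≤
      m.divisors.card * ∑ n ∈ Finset.Icc 1 N, (1 / n : ℝ) := by
  have hmaps : ∀ n ∈ Finset.Icc 1 N, Nat.gcd m n ∈ m.divisors := fun n _ =>
    Nat.mem_divisors.2 ⟨Nat.gcd_dvd_left _ _, hm⟩
  rw [← Finset.sum_fiberwise_of_maps_to hmaps, ← nsmul_eq_mul]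
  refine Finset.sum_le_card_nsmul _ _ _ fun g hg => ?_
  have hg0 : g ≠ 0 := by rintro rfl; simp at hg
  have hg0' : (0 : ℝ) < g := by positivity
  have key : ∀ n ∈ (Finset.Icc 1 N).filter (fun n => Nat.gcd m n = g),
      1 ≤ n ∧ n ≤ N ∧ n = g * (n / g) ∧ Nat.gcd m n = g := by
    intro n hn
    simp only [Finset.mem_filter, Finset.mem_Icc] at hn
    have : g ∣ n := hn.2 ▸ Nat.gcd_dvd_right _ _
    exact ⟨hn.1.1, hn.1.2, (Nat.mul_div_cancel' this).symm, hn.2⟩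
  have hinj : Set.InjOn (fun n => n / g) ((Finset.Icc 1 N).filter (fun n => Nat.gcd m n = g)) := by
    intro n hn n' hn' h
    rw [(key n hn).2.2.1, (key n' hn').2.2.1]
    exact congrArg (g * ·) h
  calc _ = ∑ n ∈ (Finset.Icc 1 N).filter (fun n => Nat.gcd m n = g), (1 / ((n / g : ℕ) : ℝ)) := by
        refine Finset.sum_congr rfl fun n hn => ?_
        obtain ⟨h1, h2, h3, h4⟩ := key n hn
        rw [h4]
        have h5 : (n : ℝ) = g * ((n / g : ℕ) : ℝ) := by exact_mod_cast h3
        have h6 : (0 : ℝ) < n := by exact_mod_cast h1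
        rw [h5] at h6 ⊢
        have : (0 : ℝ) < ((n / g : ℕ) : ℝ) := pos_of_mul_pos_right h6 hg0'.le
        rw [mul_comm, div_mul_cancel_right₀ hg0'.ne', one_div]
    _ = ∑ k ∈ ((Finset.Icc 1 N).filter (fun n => Nat.gcd m n = g)).image (fun n => n / g),
          (1 / (k : ℝ)) := (Finset.sum_image (f := fun k : ℕ => 1 / (k : ℝ)) hinj).symm
    _ ≤ _ := by
        refine Finset.sum_le_sum_of_subset_of_nonneg ?_ (fun _ _ _ => by positivity)
        intro k hk
        obtain ⟨n, hn, rfl⟩ := Finset.mem_image.1 hk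
        obtain ⟨h1, h2, h3, h4⟩ := key n hn
        refine Finset.mem_Icc.2 ⟨Nat.one_le_iff_ne_zero.2 fun h => ?_,
          (Nat.div_le_self _ _).trans h2⟩
        have h' : n / g = 0 := h
        rw [h', mul_zero] at h3
        omega

theorem sum_int_eq_two_mul (f : ℕ → ℝ) (N : ℕ) :
    ∑ n ∈ (Finset.Icc (-(N : ℤ)) N).erase 0, f n.natAbs = 2 * ∑ n ∈ Finset.Icc 1 N, f n := by
  have : (Finset.Icc (-(N : ℤ)) N).erase 0 =
      (Finset.Icc 1 N).image (fun n : ℕ => (n : ℤ)) ∪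
        (Finset.Icc 1 N).image (fun n : ℕ => -(n : ℤ)) := by
    ext x
    simp only [Finset.mem_erase, Finset.mem_Icc, Finset.mem_union, Finset.mem_image]
    constructor
    · rintro ⟨h0, h1, h2⟩
      rcases lt_or_gt_of_ne h0 with h | h
      · exact Or.inr ⟨x.natAbs, by omega, by omega⟩
      · exact Or.inl ⟨x.natAbs, by omega, by omega⟩
    · rintro (⟨n, hn, rfl⟩ | ⟨n, hn, rfl⟩) <;> omega
  rw [this, Finset.sum_union, Finset.sum_image, Finset.sum_image, two_mul]
  · congr 1
    exact Finset.sum_congr rfl fun n _ => by simp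
  · intro a _ b _ h; simpa using h
  · intro a _ b _ h; simpa using h
  · rw [Finset.disjoint_left]
    intro x hx hx'
    simp only [Finset.mem_image, Finset.mem_Icc] at hx hx'
    obtain ⟨n, hn, rfl⟩ := hx
    obtain ⟨k, hk, h⟩ := hx'
    omega

theorem sum_int_gcd_div_le {m : ℤ} (hm : m ≠ 0) (N : ℕ) :
    ∑ n ∈ (Finset.Icc (-(N : ℤ)) N).erase 0, ((Int.gcd m n : ℝ) / |(n : ℝ)|) ≤
      2 * (m.natAbs.divisors.card * ∑ n ∈ Finset.Icc 1 N, (1 / n : ℝ)) := by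
  have h := sum_int_eq_two_mul (fun n => (Nat.gcd m.natAbs n : ℝ) / n) N
  calc _ = _ := Finset.sum_congr rfl fun n _ => by
        rw [Int.gcd_eq_natAbs_gcd_natAbs, Nat.cast_natAbs, Int.cast_abs]
    _ = _ := h
    _ ≤ _ := by
      have := sum_gcd_div_le (Int.natAbs_ne_zero.2 hm) N
      linarith

/-- The divisor function is bounded by every positive power. -/
theorem exists_card_divisors_le_rpow {η : ℝ} (hη : 0 < η) :
    ∃ K : ℝ, 1 ≤ K ∧ ∀ n : ℕ, n ≠ 0 → (n.divisors.card : ℝ) ≤ K * (n : ℝ) ^ η := by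
  have hl : 0 < Real.log 2 := Real.log_pos one_lt_two
  set M : ℝ := max 1 (1 / (η * Real.log 2)) with hM
  have hM1 : 1 ≤ M := le_max_left _ _
  have hM0 : 0 < M := by linarith
  set P : ℕ := ⌈(2 : ℝ) ^ (1 / η)⌉₊ with hP
  have small : ∀ (p k : ℕ), 2 ≤ p → ((k : ℝ) + 1) ≤ M * ((p : ℝ) ^ k) ^ η := by
    intro p k hp
    have h2 : ((2 : ℝ) ^ k) ^ η ≤ ((p : ℝ) ^ k) ^ η := by
      have : (2 : ℝ) ≤ p := by exact_mod_cast hp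
      gcongr
    have h3 : 1 + η * Real.log 2 * k ≤ ((2 : ℝ) ^ k) ^ η := by
      rw [← Real.rpow_natCast, ← Real.rpow_mul (by norm_num), Real.rpow_def_of_pos (by norm_num)]
      have := Real.add_one_le_exp (Real.log 2 * (k * η))
      linarith
    have h4 : 1 ≤ M * (η * Real.log 2) := by
      have : 1 / (η * Real.log 2) ≤ M := le_max_right _ _
      rwa [div_le_iff₀ (by positivity)] at this
    have h5 : (k : ℝ) ≤ M * (η * Real.log 2) * k := le_mul_of_one_le_left (by positivity) h4
    calc (k : ℝ) + 1 ≤ M * (1 + η * Real.log 2 * k) := by nlinarith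
      _ ≤ _ := by gcongr; linarith
  have large : ∀ (p k : ℕ), P ≤ p → ((k : ℝ) + 1) ≤ ((p : ℝ) ^ k) ^ η := by
    intro p k hp
    have h1 : (2 : ℝ) ^ (1 / η) ≤ p := (Nat.le_ceil _).trans (by exact_mod_cast hp)
    have h2 : (2 : ℝ) ≤ (p : ℝ) ^ η := by
      have := Real.rpow_le_rpow (by positivity) h1 hη.le
      rwa [← Real.rpow_mul (by norm_num), one_div, inv_mul_cancel₀ hη.ne', Real.rpow_one] at this
    have h3 : ((k : ℝ) + 1) ≤ 2 ^ k := by exact_mod_cast Nat.lt_two_pow_self (n := k)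
    calc ((k : ℝ) + 1) ≤ 2 ^ k := h3
      _ ≤ ((p : ℝ) ^ η) ^ k := by gcongr
      _ = _ := by
        rw [← Real.rpow_natCast, ← Real.rpow_natCast, ← Real.rpow_mul (by positivity),
          ← Real.rpow_mul (by positivity), mul_comm]
  refine ⟨M ^ P, one_le_pow₀ hM1, fun n hn => ?_⟩
  rw [Nat.card_divisors hn]
  push_cast
  have hprod : (n : ℝ) ^ η = ∏ p ∈ n.primeFactors, ((p : ℝ) ^ n.factorization p) ^ η := by
    conv_lhs => rw [← Nat.prod_factorization_pow_eq_self hn]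
    rw [Finsupp.prod, Nat.support_factorization]
    push_cast
    exact (Real.finsetProd_rpow _ _ (fun i _ => by positivity) _).symm
  have hc : ∏ p ∈ n.primeFactors, (if p < P then M else 1) ≤ M ^ P := by
    rw [← Finset.prod_filter, Finset.prod_const]
    refine pow_le_pow_right₀ hM1 ?_
    calc _ ≤ (Finset.range P).card := Finset.card_le_card (by intro; simp)
      _ = P := Finset.card_range P
  calc ∏ p ∈ n.primeFactors, ((n.factorization p : ℝ) + 1)
      ≤ ∏ p ∈ n.primeFactors, ((if p < P then M else 1) * ((p : ℝ) ^ n.factorization p) ^ η) := by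
        refine Finset.prod_le_prod (fun _ _ => by positivity) fun p hp => ?_
        split_ifs with h
        · exact small p _ (Nat.prime_of_mem_primeFactors hp).two_le
        · rw [one_mul]; exact large p _ (not_lt.mp h)
    _ ≤ M ^ P * (n : ℝ) ^ η := by
        rw [Finset.prod_mul_distrib, ← hprod]
        gcongr

theorem dvd_six_mul_sub_of_sq_add {n : ℕ} (hn : n ≠ 0) {s t t' : ℤ}
    (hs : (n : ℤ) ∣ s ^ 2 + 27) (ht : (n : ℤ) ∣ t ^ 2 + 27) (ht' : (n : ℤ) ∣ t' ^ 2 + 27)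
    (h : Int.gcd (t - s) n = Int.gcd (t' - s) n) : (n : ℤ) ∣ 6 * (t - t') := by
  have key : ∀ r : ℤ, (n : ℤ) ∣ r ^ 2 + 27 →
      ((n : ℤ) / Int.gcd (r - s) n) ∣ r + s := by
    intro r hr
    have h1 : (n : ℤ) ∣ (r - s) * (r + s) := by
      have := dvd_sub hr hs
      rwa [show r ^ 2 + 27 - (s ^ 2 + 27) = (r - s) * (r + s) by ring] at this
    have h0 : 0 < Int.gcd (r - s) n := Int.gcd_pos_of_ne_zero_right _ (by exact_mod_cast hn)
    have h2 : IsCoprime ((n : ℤ) / Int.gcd (r - s) n) ((r - s) / Int.gcd (r - s) n) := by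
      rw [Int.isCoprime_iff_gcd_eq_one, Int.gcd_comm]
      exact Int.gcd_div_gcd_div_gcd h0
    refine h2.dvd_of_dvd_mul_left ?_
    obtain ⟨a, ha⟩ := Int.gcd_dvd_left (r - s) n
    obtain ⟨b, hb⟩ := Int.gcd_dvd_right (r - s) n
    have h0' : ((Int.gcd (r - s) n : ℕ) : ℤ) ≠ 0 := by exact_mod_cast h0.ne'
    generalize ((Int.gcd (r - s) n : ℕ) : ℤ) = g at *
    rw [ha, hb, Int.mul_ediv_cancel_left _ h0', Int.mul_ediv_cancel_left _ h0']
    rw [ha, hb, mul_assoc] at h1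
    exact Int.dvd_of_mul_dvd_mul_left h0' h1
  have k1 := key t ht
  have k2 := key t' ht'
  rw [← h] at k2
  have e1 : ((Int.gcd (t - s) n : ℕ) : ℤ) ∣ t - s := Int.gcd_dvd_left _ _
  have e2 : ((Int.gcd (t - s) n : ℕ) : ℤ) ∣ t' - s := h ▸ Int.gcd_dvd_left _ _
  have en : ((Int.gcd (t - s) n : ℕ) : ℤ) ∣ n := Int.gcd_dvd_right _ _
  set e : ℤ := ((Int.gcd (t - s) n : ℕ) : ℤ)
  obtain ⟨f, hf⟩ := en
  have he0 : e ≠ 0 := by rintro h0; rw [h0, zero_mul] at hf; exact hn (by exact_mod_cast hf)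
  rw [hf, Int.mul_ediv_cancel_left _ he0] at k1 k2
  have d1 : e ∣ t - t' := by have := dvd_sub e1 e2; rwa [sub_sub_sub_cancel_right] at this
  have d2 : f ∣ t - t' := by have := dvd_sub k1 k2; rwa [add_sub_add_right_eq_sub] at this
  set g : ℤ := ((Int.gcd e f : ℕ) : ℤ) with hg
  have g1 : g ∣ e := Int.gcd_dvd_left _ _
  have g2 : g ∣ f := Int.gcd_dvd_right _ _
  have g3 : g ^ 2 ∣ 108 := by
    have a1 : g ∣ 2 * s := by
      have := dvd_sub (g2.trans k1) (g1.trans e1)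
      rwa [show t + s - (t - s) = 2 * s by ring] at this
    have a2 : g ^ 2 ∣ 4 * s ^ 2 := by
      have := pow_dvd_pow_of_dvd a1 2
      rwa [show (2 * s) ^ 2 = 4 * s ^ 2 by ring] at this
    have a3 : g ^ 2 ∣ s ^ 2 + 27 := by
      have : g ^ 2 ∣ (n : ℤ) := by rw [hf, sq]; exact mul_dvd_mul g1 g2
      exact this.trans hs
    have := dvd_sub (a3.mul_left 4) a2
    rwa [show 4 * (s ^ 2 + 27) - 4 * s ^ 2 = 108 by ring] at this
  have g4 : g ∣ 6 := by
    have hle : g ^ 2 ≤ 108 := Int.le_of_dvd (by norm_num) g3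
    have hge : 0 ≤ g := by positivity
    have hlt : g ≤ 10 := by nlinarith
    interval_cases g <;> revert g3 <;> decide
  have g5 : e * f ∣ g * (t - t') := by
    obtain ⟨x, y, hxy⟩ : ∃ x y, g = e * x + f * y := ⟨_, _, Int.gcd_eq_gcd_ab e f⟩
    rw [hxy, add_mul]
    refine dvd_add ?_ ?_
    · rw [mul_assoc]; exact mul_dvd_mul_left _ (d2.mul_left _)
    · rw [mul_comm e f, mul_assoc]; exact mul_dvd_mul_left _ (d1.mul_left _)
  rw [hf]
  exact g5.trans (mul_dvd_mul_right g4 _)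

/-- Square roots of `-27` modulo `n`. -/
theorem card_roots_le {n : ℕ} (hn : n ≠ 0) (T : Finset ℤ)
    (hT : ∀ t ∈ T, 0 ≤ t ∧ t < n ∧ (n : ℤ) ∣ t ^ 2 + 27) : T.card ≤ 6 * n.divisors.card := by
  rcases T.eq_empty_or_nonempty with rfl | ⟨s, hs⟩
  · simp
  have hn' : (0 : ℤ) < n := by positivity
  have : T.card ≤ (Finset.Ico (0 : ℤ) 6 ×ˢ n.divisors).card := by
    refine Finset.card_le_card_of_injOn (fun t => (6 * t / n, Int.gcd (t - s) n)) ?_ ?_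
    · intro t ht
      obtain ⟨h0, h1, -⟩ := hT t ht
      simp only [Finset.coe_product, Set.mem_prod, Finset.mem_coe, Finset.mem_Ico,
        Nat.mem_divisors]
      refine ⟨⟨by positivity, Int.ediv_lt_of_lt_mul hn' (by linarith)⟩, ?_, hn⟩
      exact_mod_cast Int.gcd_dvd_right (t - s) n
    · intro t ht t' ht' h
      simp only [Prod.mk.injEq] at h
      have hd := dvd_six_mul_sub_of_sq_add hn (hT s hs).2.2 (hT t ht).2.2 (hT t' ht').2.2 h.2
      have e1 := Int.emod_add_mul_ediv (6 * t) n
      have e2 := Int.emod_add_mul_ediv (6 * t') n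
      rw [h.1] at e1
      have := Int.emod_nonneg (6 * t) hn'.ne'
      have := Int.emod_nonneg (6 * t') hn'.ne'
      have := Int.emod_lt_of_pos (6 * t) hn'
      have := Int.emod_lt_of_pos (6 * t') hn'
      have hz : 6 * (t - t') = 0 := by
        refine Int.eq_zero_of_abs_lt_dvd hd ?_
        rw [abs_lt]; constructor <;> linarith
      linarith
  simpa [Finset.card_product] using this

theorem card_primitive_rep_le {n : ℕ} (hn : n ≠ 0) (S : Finset (ℤ × ℤ))
    (hS : ∀ p ∈ S, p.1 ^ 2 + 27 * p.2 ^ 2 = n ∧ IsCoprime p.1 p.2) :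
    S.card ≤ 24 * n.divisors.card := by
  have hn' : (0 : ℤ) < n := by positivity
  have ex : ∀ p ∈ S, ∃ t : ℤ, 0 ≤ t ∧ t < n ∧ (n : ℤ) ∣ p.1 - t * p.2 := by
    intro p hp
    obtain ⟨h1, h2⟩ := hS p hp
    have h3 : IsCoprime p.2 (n : ℤ) := by
      rw [← h1, sq p.2, ← mul_assoc, IsCoprime.add_mul_right_right_iff]
      exact h2.symm.pow_right
    obtain ⟨u, v, huv⟩ := h3
    refine ⟨(p.1 * u) % n, Int.emod_nonneg _ hn'.ne', Int.emod_lt_of_pos _ hn', ?_⟩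
    have := Int.emod_add_mul_ediv (p.1 * u) n
    refine ⟨p.1 * v + p.2 * (p.1 * u / n), ?_⟩
    linear_combination p.1 * (-huv) - p.2 * this
  choose! t h0 h1 h2 using ex
  have hroot : ∀ p ∈ S, (n : ℤ) ∣ (t p) ^ 2 + 27 := by
    intro p hp
    obtain ⟨h3, h4⟩ := hS p hp
    have h5 : IsCoprime (n : ℤ) (p.2 ^ 2) := by
      rw [← h3, sq p.2, ← mul_assoc]
      refine IsCoprime.symm (IsCoprime.mul_left ?_ ?_) <;>
        exact (IsCoprime.add_mul_right_right_iff).2 h4.symm.pow_right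
    refine h5.dvd_of_dvd_mul_right ?_
    obtain ⟨k, hk⟩ := h2 p hp
    refine ⟨1 - k * (p.1 + t p * p.2), ?_⟩
    linear_combination h3 - (p.1 + t p * p.2) * hk
  have hT := card_roots_le hn (S.image t) (by
    simp only [Finset.mem_image]
    rintro _ ⟨p, hp, rfl⟩
    exact ⟨h0 p hp, h1 p hp, hroot p hp⟩)
  have : S.card ≤ (S.image t ×ˢ (Finset.univ : Finset (Bool × Bool))).card := by
    refine Finset.card_le_card_of_injOn
      (fun p => (t p, (decide (0 ≤ p.1), decide (0 ≤ p.2)))) ?_ ?_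
    · intro p hp
      simp only [Finset.coe_product, Set.mem_prod, Finset.mem_coe, Finset.mem_univ, and_true]
      exact Finset.mem_image_of_mem _ hp
    · intro p hp q hq h
      simp only [Prod.mk.injEq, decide_eq_decide] at h
      obtain ⟨ht, hs1, hs2⟩ := h
      obtain ⟨hp1, -⟩ := hS p hp
      obtain ⟨hq1, -⟩ := hS q hq
      obtain ⟨k, hk⟩ := h2 p hp
      obtain ⟨l, hl⟩ := h2 q hq
      rw [← ht] at hl
      have hz : p.1 * q.2 - q.1 * p.2 = n * (k * q.2 - l * p.2) := by
        linear_combination q.2 * hk - p.2 * hl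
      have hid : (p.1 * q.1 + 27 * (p.2 * q.2)) ^ 2 + 27 * (p.1 * q.2 - q.1 * p.2) ^ 2
          = (n : ℤ) ^ 2 := by
        rw [show (n : ℤ) ^ 2 = n * n by ring]
        nth_rewrite 1 [← hp1]
        rw [← hq1]; ring
      have hz0 : k * q.2 - l * p.2 = 0 := by
        rw [hz] at hid
        by_contra hne
        have : 1 ≤ (k * q.2 - l * p.2) ^ 2 := by
          have := sq_nonneg (k * q.2 - l * p.2)
          have h' : (k * q.2 - l * p.2) ^ 2 ≠ 0 := pow_ne_zero _ hne
          omega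
        nlinarith [sq_nonneg (p.1 * q.1 + 27 * (p.2 * q.2)), mul_pos hn' hn']
      rw [hz0, mul_zero] at hz
      have hy : p.2 ^ 2 = q.2 ^ 2 := by
        have : (n : ℤ) * (p.2 ^ 2 - q.2 ^ 2) = 0 := by
          linear_combination (-(p.1 * q.2 + q.1 * p.2)) * hz + (q.2 ^ 2) * hp1 - p.2 ^ 2 * hq1
        rcases mul_eq_zero.1 this with h | h
        · exact absurd h hn'.ne'
        · linarith
      have hx : p.1 ^ 2 = q.1 ^ 2 := by linarith
      have aux : ∀ a b : ℤ, a ^ 2 = b ^ 2 → (0 ≤ a ↔ 0 ≤ b) → a = b := by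
        intro a b hab hs
        rcases sq_eq_sq_iff_eq_or_eq_neg.1 hab with h | h
        · exact h
        · subst h
          by_cases hb : 0 ≤ b
          · have := hs.2 hb; omega
          · have : ¬ 0 ≤ -b := fun h => hb (hs.1 h)
            omega
      exact Prod.ext (aux _ _ hx hs1) (aux _ _ hy hs2)
  rw [Finset.card_product] at this
  simp only [Finset.card_univ, Fintype.card_prod, Fintype.card_bool] at this
  omega

theorem card_rep_le {n : ℕ} (hn : n ≠ 0) (S : Finset (ℤ × ℤ))
    (hS : ∀ p ∈ S, p.1 ^ 2 + 27 * p.2 ^ 2 = n) :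
    S.card ≤ 24 * n.divisors.card ^ 2 := by
  have hdvd : ∀ p ∈ S, (Int.gcd p.1 p.2) ^ 2 ∣ n := by
    intro p hp
    have : ((Int.gcd p.1 p.2 : ℕ) : ℤ) ^ 2 ∣ (n : ℤ) := by
      rw [← hS p hp]
      exact dvd_add (pow_dvd_pow_of_dvd (Int.gcd_dvd_left _ _) 2)
        ((pow_dvd_pow_of_dvd (Int.gcd_dvd_right _ _) 2).mul_left _)
    exact_mod_cast this
  have hmaps : ∀ p ∈ S, Int.gcd p.1 p.2 ∈ n.divisors := fun p hp =>
    Nat.mem_divisors.2 ⟨(Dvd.intro_left _ (by rw [sq] : _ = _)).trans (hdvd p hp), hn⟩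
  have := Finset.card_le_mul_card_image_of_maps_to hmaps (24 * n.divisors.card) (fun g hg => by
    rcases (S.filter fun p => Int.gcd p.1 p.2 = g).eq_empty_or_nonempty with h | ⟨p0, hp0⟩
    · rw [h]; simp
    rw [Finset.mem_filter] at hp0
    have hg2 : g ^ 2 ∣ n := hp0.2 ▸ hdvd p0 hp0.1
    have hg0 : g ≠ 0 := by rintro rfl; simp at hg
    obtain ⟨m, hm⟩ := hg2
    have hm0 : m ≠ 0 := by rintro rfl; simp at hm; exact hn hm
    have hgz : (g : ℤ) ≠ 0 := by exact_mod_cast hg0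
    have key : ∀ p : ℤ × ℤ, Int.gcd p.1 p.2 = g → ∃ a b, p.1 = g * a ∧ p.2 = g * b := by
      intro p hp
      obtain ⟨a, ha⟩ := Int.gcd_dvd_left p.1 p.2
      obtain ⟨b, hb⟩ := Int.gcd_dvd_right p.1 p.2
      rw [hp] at ha hb
      exact ⟨a, b, ha, hb⟩
    have inj : Set.InjOn (fun p : ℤ × ℤ => (p.1 / (g : ℤ), p.2 / (g : ℤ)))
        (S.filter fun p => Int.gcd p.1 p.2 = g) := by
      intro p hp q hq h
      rw [Finset.mem_coe, Finset.mem_filter] at hp hq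
      obtain ⟨a, b, ha, hb⟩ := key p hp.2
      obtain ⟨c, d, hc, hd⟩ := key q hq.2
      simp only [Prod.mk.injEq] at h
      rw [ha, hb, hc, hd] at h
      simp only [Int.mul_ediv_cancel_left _ hgz] at h
      exact Prod.ext (by rw [ha, hc, h.1]) (by rw [hb, hd, h.2])
    rw [← Finset.card_image_of_injOn inj]
    refine (card_primitive_rep_le hm0 _ ?_).trans ?_
    · simp only [Finset.mem_image, Finset.mem_filter]
      rintro _ ⟨p, ⟨hp, hpg⟩, rfl⟩
      have hcop : IsCoprime (p.1 / (g : ℤ)) (p.2 / (g : ℤ)) := by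
        rw [Int.isCoprime_iff_gcd_eq_one, ← hpg]
        exact Int.gcd_div_gcd_div_gcd (by omega)
      refine ⟨?_, hcop⟩
      obtain ⟨a, b, ha, hb⟩ := key p hpg
      have := hS p hp
      rw [hm] at this
      rw [ha, hb] at this ⊢
      simp only [Int.mul_ediv_cancel_left _ hgz]
      push_cast at this
      have h2 : (g : ℤ) ^ 2 * (a ^ 2 + 27 * b ^ 2) = g ^ 2 * m := by linarith
      exact mul_left_cancel₀ (pow_ne_zero 2 hgz) h2
    · gcongr 24 * ?_
      exact Finset.card_le_card (Nat.divisors_subset_of_dvd hn ⟨_, by rw [hm, mul_comm]⟩))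
  calc S.card ≤ _ := this
    _ = _ := by ring

/-- The number of pairs of invariants for which the discriminant is a square. -/
theorem card_invariants_le (B M : ℕ)
    (hM : ∀ n : ℕ, n ≠ 0 → n ≤ 4 * B ^ 3 → n.divisors.card ≤ M) (T : Finset (ℤ × ℤ))
    (hT : ∀ p ∈ T, |p.1| ≤ B ∧ ∃ y : ℤ, 4 * p.1 ^ 3 = p.2 ^ 2 + 27 * y ^ 2) :
    T.card ≤ 1 + B * (24 * M ^ 2) := by
  have hmaps : ∀ p ∈ T, p.1.toNat ∈ Finset.range (B + 1) := fun p hp => by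
    have := (abs_le.1 (hT p hp).1).2
    simp only [Finset.mem_range]; omega
  rw [Finset.card_eq_sum_card_fiberwise hmaps, Finset.sum_range_succ', add_comm]
  have hnonneg : ∀ p ∈ T, 0 ≤ p.1 := by
    intro p hp
    obtain ⟨-, y, hy⟩ := hT p hp
    by_contra h
    have : p.1 ^ 3 < 0 := Odd.pow_neg (by decide) (by omega)
    nlinarith [sq_nonneg p.2, sq_nonneg y]
  gcongr
  · rw [Finset.card_le_one]
    have : ∀ p ∈ T.filter (fun p => p.1.toNat = 0), p = (0, 0) := by
      intro p hp
      rw [Finset.mem_filter] at hp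
      obtain ⟨-, y, hy⟩ := hT p hp.1
      have h0 : p.1 = 0 := by have := hnonneg p hp.1; omega
      rw [h0] at hy
      have : p.2 ^ 2 = 0 := by nlinarith [sq_nonneg p.2, sq_nonneg y]
      exact Prod.ext h0 (by simpa using this)
    intro p hp q hq
    rw [this p hp, this q hq]
  · calc _ ≤ ∑ k ∈ Finset.range B, 24 * M ^ 2 := ?_
      _ = _ := by simp
    refine Finset.sum_le_sum fun k hk => ?_
    have hk := Finset.mem_range.1 hk
    have hn : 4 * (k + 1) ^ 3 ≠ 0 := by positivity
    have hmem : ∀ p ∈ T.filter (fun p => p.1.toNat = k + 1), p ∈ T ∧ p.1 = (k : ℤ) + 1 := by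
      intro p hp
      rw [Finset.mem_filter] at hp
      exact ⟨hp.1, by omega⟩
    choose! y hy using fun p (hp : p ∈ T) => (hT p hp).2
    rw [← Finset.card_image_of_injOn (f := fun p : ℤ × ℤ => (p.2, y p))]
    · refine (card_rep_le hn _ ?_).trans ?_
      · simp only [Finset.mem_image]
        rintro _ ⟨p, hp, rfl⟩
        obtain ⟨hp1, hp2⟩ := hmem p hp
        have := hy p hp1
        rw [hp2] at this
        push_cast
        linarith
      · gcongr
        refine hM _ hn ?_
        gcongr
        omega
    · intro p hp q hq h
      simp only [Prod.mk.injEq] at h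
      exact Prod.ext ((hmem p hp).2.trans (hmem q hq).2.symm) h.1

theorem quartic_coeff_ext {R : Type*} [CommRing R] {a b c d a' b' c' d' : R}
    (h : X ^ 4 + C a * X ^ 3 + C b * X ^ 2 + C c * X + C d =
      X ^ 4 + C a' * X ^ 3 + C b' * X ^ 2 + C c' * X + C d') :
    a = a' ∧ b = b' ∧ c = c' ∧ d = d' := by
  refine ⟨?_, ?_, ?_, ?_⟩
  · simpa [coeff_X, coeff_C] using congrArg (coeff · 3) h
  · simpa [coeff_X, coeff_C] using congrArg (coeff · 2) h
  · simpa [coeff_X, coeff_C] using congrArg (coeff · 1) h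
  · simpa [coeff_X, coeff_C] using congrArg (coeff · 0) h

/-- A quartic without full symmetric Galois group has either a square discriminant or
a resolvent cubic with a root. -/
theorem square_disc_or_resolvent_root {F : Type*} [Field F] [CharZero F] (a b c d : F) (p : F[X])
    (hp : p = X ^ 4 + C a * X ^ 3 + C b * X ^ 2 + C c * X + C d)
    (hirr : Irreducible p) (hG : ¬ Nonempty (p.Gal ≃* Equiv.Perm (Fin 4))) :
    (∃ y : F, 4 * (12 * d - 3 * a * c + b ^ 2) ^ 3 =
      (72 * b * d + 9 * a * b * c - 27 * c ^ 2 - 27 * a ^ 2 * d - 2 * b ^ 3) ^ 2 + 27 * y ^ 2) ∨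
    ∃ x : F, x ^ 3 - b * x ^ 2 + (a * c - 4 * d) * x - (a ^ 2 * d - 4 * b * d + c ^ 2) = 0 := by
  classical
  have hdeg : p.natDegree = 4 := by rw [hp]; compute_degree!
  have hmon : p.Monic := by rw [hp]; monicity!
  have hsep : p.Separable := hirr.separable
  have hspl := SplittingField.splits p
  have : IsGalois F p.SplittingField := IsGalois.of_separable_splitting_field hsep
  have hcard : Fintype.card (p.rootSet p.SplittingField) = 4 := by
    rw [card_rootSet_eq_natDegree hsep hspl, hdeg]
  let e : Fin 4 ≃ p.rootSet p.SplittingField := (Fintype.equivFinOfCardEq hcard).symm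
  let r : Fin 4 → p.SplittingField := fun i => e i
  have hfac : p.map (algebraMap F p.SplittingField) =
      (X - C (r 0)) * (X - C (r 1)) * (X - C (r 2)) * (X - C (r 3)) := by
    have h1 := hspl.eq_prod_roots_of_monic (hmon.map _)
    have hnd : (p.map (algebraMap F p.SplittingField)).roots.Nodup :=
      nodup_roots hsep.map
    rw [h1]
    have h2 : ∏ i : Fin 4, (X - C (r i)) =
        ∏ x : p.rootSet p.SplittingField, (X - C (x : p.SplittingField)) :=
      Fintype.prod_equiv e _ _ (fun _ => rfl)
    rw [Fin.prod_univ_four] at h2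
    rw [h2]
    have h3 : ∏ x : p.rootSet p.SplittingField, (X - C (x : p.SplittingField)) =
        ∏ x ∈ (p.aroots p.SplittingField).toFinset, (X - C x) := by
      exact Finset.prod_coe_sort (p.aroots p.SplittingField).toFinset
        (fun x => (X - C x : p.SplittingField[X]))
    rw [h3, Finset.prod, Multiset.toFinset_val, Multiset.dedup_eq_self.2 hnd]
  have hfac' : X ^ 4 + C (algebraMap F p.SplittingField a) * X ^ 3
      + C (algebraMap F p.SplittingField b) * X ^ 2 + C (algebraMap F p.SplittingField c) * X
      + C (algebraMap F p.SplittingField d) =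
      X ^ 4 + C (-(r 0 + r 1 + r 2 + r 3)) * X ^ 3 + C (r 0 * r 1 + r 0 * r 2 + r 0 * r 3
        + r 1 * r 2 + r 1 * r 3 + r 2 * r 3) * X ^ 2
      + C (-(r 0 * r 1 * r 2 + r 0 * r 1 * r 3 + r 0 * r 2 * r 3 + r 1 * r 2 * r 3)) * X
      + C (r 0 * r 1 * r 2 * r 3) := by
    have h1 : p.map (algebraMap F p.SplittingField) =
      X ^ 4 + C (algebraMap F p.SplittingField a) * X ^ 3
      + C (algebraMap F p.SplittingField b) * X ^ 2 + C (algebraMap F p.SplittingField c) * X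
      + C (algebraMap F p.SplittingField d) := by
      exact (congrArg (Polynomial.map (algebraMap F p.SplittingField)) hp).trans (by simp)
    rw [← h1, hfac]
    simp only [map_add, map_mul, map_neg]
    ring
  obtain ⟨va, vb, vc, vd⟩ := quartic_coeff_ext hfac'
  let ρ : p.Gal →* Equiv.Perm (Fin 4) :=
    (e.permCongrHom.symm : _ →* _).comp (MulAction.toPermHom p.Gal (p.rootSet p.SplittingField))
  have hρ : ∀ (σ : p.Gal) (i : Fin 4), r (ρ σ i) = σ (r i) := by
    intro σ i
    have h : e (ρ σ i) = σ • e i := by simp [ρ]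
    exact congrArg Subtype.val h
  have hρinj : Function.Injective ρ := by
    intro σ τ h
    refine Gal.ext p fun x hx => ?_
    have h1 := hρ σ (e.symm ⟨x, hx⟩)
    have h2 := hρ τ (e.symm ⟨x, hx⟩)
    rw [h, h2] at h1
    simpa [r] using h1.symm
  have hGcard : Nat.card p.Gal = Module.finrank F p.SplittingField := Gal.card_of_separable hsep
  have hdvd24 : Nat.card p.Gal ∣ 24 := by
    have := Subgroup.card_dvd_of_injective ρ hρinj
    rwa [Nat.card_perm, Nat.card_fin] at this
  have h4 : 4 ∣ Nat.card p.Gal := by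
    have hroot : aeval (r 0) p = 0 := by
      rw [aeval_def, ← eval_map, hfac]
      simp
    have h := minpoly.degree_dvd (Algebra.IsIntegral.isIntegral (R := F) (r 0))
    rwa [← minpoly.eq_of_irreducible_of_monic hirr hroot hmon, hdeg, ← hGcard] at h
  have hne24 : Nat.card p.Gal ≠ 24 := by
    intro h
    refine hG ⟨MulEquiv.ofBijective ρ ?_⟩
    rw [Nat.bijective_iff_injective_and_card, h, Nat.card_perm, Nat.card_fin]
    exact ⟨hρinj, rfl⟩
  by_cases h3 : 3 ∣ Nat.card p.Gal
  · left
    have h12 : Nat.card p.Gal = 12 := by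
      have := Nat.le_of_dvd (by norm_num) hdvd24
      generalize Nat.card p.Gal = n at *
      interval_cases n <;> omega
    have hidx : ρ.range.index = 2 := by
      have h1 := ρ.range.card_mul_index
      rw [← Nat.card_congr (MonoidHom.ofInjective hρinj).toEquiv, h12, Nat.card_perm,
        Nat.card_fin] at h1
      have : Nat.factorial 4 = 24 := rfl
      omega
    have halt := Equiv.Perm.eq_alternatingGroup_of_index_eq_two hidx
    obtain ⟨y, hy⟩ : ∃ y : F, algebraMap F p.SplittingField y = (Matrix.vandermonde r).det := by
      refine (IsGalois.mem_range_algebraMap_iff_fixed _).2 fun σ => ?_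
      have hmem : ρ σ ∈ alternatingGroup (Fin 4) := halt ▸ ⟨σ, rfl⟩
      have h1 : σ (Matrix.vandermonde r).det = ((Matrix.vandermonde r).submatrix (ρ σ) id).det := by
        change (σ : p.SplittingField →+* p.SplittingField) _ = _
        rw [RingHom.map_det]
        congr 1
        ext i j
        simp only [Matrix.vandermonde_apply, RingHom.mapMatrix_apply, Matrix.map_apply,
          Matrix.submatrix_apply, id, map_pow]
        exact congrArg (· ^ (j : ℕ)) (hρ σ i).symm
      refine h1.trans ?_
      rw [Matrix.det_permute, Equiv.Perm.mem_alternatingGroup.1 hmem]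
      simp
    refine ⟨y, (algebraMap F p.SplittingField).injective ?_⟩
    simp only [map_mul, map_add, map_sub, map_pow, map_ofNat, va, vb, vc, vd, hy,
      Matrix.det_vandermonde]
    simp [Fin.prod_univ_succ]
    ring
  · right
    set g : F[X] := X ^ 3 - C b * X ^ 2 + C (a * c - 4 * d) * X - C (a ^ 2 * d - 4 * b * d + c ^ 2)
      with hg
    have hgdeg : g.natDegree = 3 := by rw [hg]; compute_degree!
    have hgmon : g.Monic := by rw [hg]; monicity!
    have hred : ¬ Irreducible g := by
      intro hgi
      refine h3 ?_
      have hroot : aeval (r 0 * r 1 + r 2 * r 3) g = 0 := by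
        simp only [hg, map_add, map_sub, map_mul, map_pow, aeval_X, aeval_C, map_ofNat, va, vb, vc,
          vd]
        ring
      rw [hGcard, ← hgdeg, minpoly.eq_of_irreducible_of_monic hgi hroot hgmon]
      exact minpoly.degree_dvd (Algebra.IsIntegral.isIntegral _)
    rw [hgmon.irreducible_iff_roots_eq_zero_of_degree_le_three (by omega) (by omega)] at hred
    obtain ⟨x, hx⟩ := Multiset.exists_mem_of_ne_zero hred
    refine ⟨x, ?_⟩
    have := (mem_roots'.1 hx).2
    simpa [hg] using this

theorem exists_int_of_sq_eq (y : ℚ) (m : ℤ) (h : y ^ 2 = m) : ∃ z : ℤ, (z : ℚ) = y := by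
  have : IsIntegral ℤ y := by
    refine IsIntegral.of_pow (n := 2) (by norm_num) ?_
    rw [h]
    exact isIntegral_algebraMap (R := ℤ) (A := ℚ) (x := m)
  exact IsIntegrallyClosed.isIntegral_iff.1 this

theorem exists_int_of_cubic_root (x : ℚ) (b c d : ℤ) (h : x ^ 3 + b * x ^ 2 + c * x + d = 0) :
    ∃ z : ℤ, (z : ℚ) = x := by
  have : IsIntegral ℤ x := by
    refine ⟨X ^ 3 + C b * X ^ 2 + C c * X + C d, by monicity!, ?_⟩
    simpa only [eval₂_add, eval₂_mul, eval₂_pow, eval₂_X, eval₂_C, algebraMap_int_eq,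
      Int.coe_castRingHom] using h
  exact IsIntegrallyClosed.isIntegral_iff.1 this

/-- An integral quartic without full symmetric Galois group has either a square discriminant or
an integral root of its resolvent cubic. -/
theorem square_disc_or_resolvent_root_int (a b c d : ℤ) (p : ℚ[X])
    (hp : p = X ^ 4 + C (a : ℚ) * X ^ 3 + C (b : ℚ) * X ^ 2 + C (c : ℚ) * X + C (d : ℚ))
    (hirr : Irreducible p) (hG : ¬ Nonempty (p.Gal ≃* Equiv.Perm (Fin 4))) :
    (∃ y : ℤ, 4 * (12 * d - 3 * a * c + b ^ 2) ^ 3 =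
      (72 * b * d + 9 * a * b * c - 27 * c ^ 2 - 27 * a ^ 2 * d - 2 * b ^ 3) ^ 2 + 27 * y ^ 2) ∨
    ∃ x : ℤ, (x ^ 2 - 4 * d) * (a ^ 2 - 4 * b + 4 * x) = (a * x - 2 * c) ^ 2 := by
  rcases square_disc_or_resolvent_root (a : ℚ) b c d p hp hirr hG with ⟨y, hy⟩ | ⟨x, hx⟩
  · left
    obtain ⟨z, hz⟩ := exists_int_of_sq_eq y
      (256 * d ^ 3 - 192 * a * c * d ^ 2 - 128 * b ^ 2 * d ^ 2 + 144 * b * c ^ 2 * d - 27 * c ^ 4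
        + 144 * a ^ 2 * b * d ^ 2 - 6 * a ^ 2 * c ^ 2 * d - 80 * a * b ^ 2 * c * d
        + 18 * a * b * c ^ 3 + 16 * b ^ 4 * d - 4 * b ^ 3 * c ^ 2 - 27 * a ^ 4 * d ^ 2
        + 18 * a ^ 3 * b * c * d - 4 * a ^ 3 * c ^ 3 - 4 * a ^ 2 * b ^ 3 * d
        + a ^ 2 * b ^ 2 * c ^ 2) (by push_cast; linear_combination -hy / 27)
    refine ⟨z, ?_⟩
    rw [← hz] at hy
    exact_mod_cast hy
  · right
    obtain ⟨z, hz⟩ := exists_int_of_cubic_root x (-b) (a * c - 4 * d)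
      (-(a ^ 2 * d - 4 * b * d + c ^ 2)) (by push_cast; linear_combination hx)
    refine ⟨z, ?_⟩
    have : ((z : ℚ) ^ 2 - 4 * d) * (a ^ 2 - 4 * b + 4 * z) = (a * z - 2 * c) ^ 2 := by
      rw [hz]; linear_combination 4 * hx
    exact_mod_cast this

theorem card_nonneg_sq_near_le (K : ℤ) (hK : K ≠ 0) (R : ℝ) (hR : 0 ≤ R) (T : Finset ℤ)
    (hT : ∀ x ∈ T, 0 ≤ x ∧ |(x : ℝ) ^ 2 - K| ≤ R) :
    (T.card : ℝ) ≤ 1 + 2 * R / Real.sqrt |(K : ℝ)| := by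
  have hKpos : 0 < |(K : ℝ)| := abs_pos.2 (by exact_mod_cast hK)
  have hs : 0 < Real.sqrt |(K : ℝ)| := Real.sqrt_pos.2 hKpos
  rcases T.eq_empty_or_nonempty with rfl | hne
  · simp only [Finset.card_empty, Nat.cast_zero]
    positivity
  obtain ⟨s, hsT, hmin⟩ := T.exists_min_image id hne
  obtain ⟨t, htT, hmax⟩ := T.exists_max_image id hne
  simp only [id] at hmin hmax
  have hst : (s : ℝ) ≤ t := by exact_mod_cast hmin t htT
  obtain ⟨s0, hs1⟩ := hT s hsT
  obtain ⟨t0, ht1⟩ := hT t htT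
  have s0' : (0 : ℝ) ≤ s := by exact_mod_cast s0
  rw [abs_le] at hs1 ht1
  have hd : ((t : ℝ) - s) * (t + s) ≤ 2 * R := by nlinarith
  have hsq : ((t : ℝ) - s) ^ 2 * |(K : ℝ)| ≤ (2 * R) ^ 2 := by
    rcases le_or_gt |(K : ℝ)| (2 * R) with h | h
    · have h1 : ((t : ℝ) - s) ^ 2 ≤ 2 * R := by nlinarith
      calc _ ≤ 2 * R * (2 * R) := mul_le_mul h1 h hKpos.le (by linarith)
        _ = _ := by ring
    · have hKp : (0 : ℝ) < K := by
        by_contra hneg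
        rw [abs_of_nonpos (not_lt.1 hneg)] at h
        nlinarith [sq_nonneg (s : ℝ)]
      rw [abs_of_pos hKp] at h ⊢
      have h1 : (K : ℝ) ≤ (t + s) ^ 2 := by nlinarith
      calc ((t : ℝ) - s) ^ 2 * K ≤ ((t : ℝ) - s) ^ 2 * (t + s) ^ 2 := by gcongr
        _ = (((t : ℝ) - s) * (t + s)) ^ 2 := by ring
        _ ≤ _ := by
          have : 0 ≤ ((t : ℝ) - s) * (t + s) := mul_nonneg (by linarith) (by linarith)
          gcongr
  have hle : ((t : ℝ) - s) ≤ 2 * R / Real.sqrt |(K : ℝ)| := by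
    rw [le_div_iff₀ hs]
    refine abs_le_of_sq_le_sq' ?_ (by linarith) |>.2
    rw [mul_pow, Real.sq_sqrt hKpos.le]
    exact hsq
  have := card_congr_interval_le T 1 one_pos s t hst
    (fun x hx => ⟨by exact_mod_cast hmin x hx, by exact_mod_cast hmax x hx⟩)
    (fun _ _ _ _ => by simp)
  simp only [Nat.cast_one, div_one] at this
  linarith

theorem card_sq_near_le (K : ℤ) (hK : K ≠ 0) (R : ℝ) (hR : 0 ≤ R) (T : Finset ℤ)
    (hT : ∀ x ∈ T, |(x : ℝ) ^ 2 - K| ≤ R) :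
    (T.card : ℝ) ≤ 2 + 4 * R / Real.sqrt |(K : ℝ)| := by
  have h1 := card_nonneg_sq_near_le K hK R hR (T.filter (0 ≤ ·)) (fun x hx => by
    rw [Finset.mem_filter] at hx
    exact ⟨hx.2, hT x hx.1⟩)
  have h2 := card_nonneg_sq_near_le K hK R hR ((T.filter (¬ 0 ≤ ·)).image (- ·)) (fun x hx => by
    obtain ⟨y, hy, rfl⟩ := Finset.mem_image.1 hx
    rw [Finset.mem_filter] at hy
    refine ⟨by omega, ?_⟩
    push_cast
    rw [neg_sq]
    exact hT y hy.1)
  rw [Finset.card_image_of_injective _ neg_injective] at h2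
  have h3 := T.card_filter_add_card_filter_not (0 ≤ ·)
  have h4 : (T.card : ℝ) = ((T.filter (0 ≤ ·)).card : ℝ) + ((T.filter (¬ 0 ≤ ·)).card : ℝ) := by
    exact_mod_cast h3.symm
  rw [h4]
  calc _ ≤ _ := add_le_add h1 h2
    _ = _ := by ring

/-- Pairs `(m, x)` for which `x ^ 2` is close to `g * m ^ 2`. -/
noncomputable def nearSquarePairs (N : ℕ) (g : ℤ) : Finset (ℤ × ℤ) :=
  (Finset.Icc (1 : ℤ) (6 * N) ×ˢ Finset.Icc (-(4 * N : ℤ)) (4 * N)).filter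
    fun p => |p.2 ^ 2 - g * p.1 ^ 2| ≤ 20 * N

theorem sum_Icc_int_eq (f : ℤ → ℝ) (N : ℕ) :
    ∑ n ∈ Finset.Icc (1 : ℤ) N, f n = ∑ n ∈ Finset.Icc 1 N, f (n : ℤ) := by
  refine (Finset.sum_bij (fun (n : ℕ) _ => (n : ℤ)) ?_ ?_ ?_ ?_).symm
  · intro n hn; rw [Finset.mem_Icc] at *; omega
  · intro a _ b _ h; exact_mod_cast h
  · intro b hb
    rw [Finset.mem_Icc] at hb
    exact ⟨b.toNat, by rw [Finset.mem_Icc]; omega, by omega⟩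
  · intro _ _; rfl

theorem card_nearSquarePairs_le (N : ℕ) (hN : 1 ≤ N) (g : ℤ) (hg : g ≠ 0) (M : ℝ)
    (hM : ∑ n ∈ Finset.Icc 1 (6 * N), (1 / n : ℝ) ≤ M) :
    ((nearSquarePairs N g).card : ℝ) ≤ 92 * N * M / Real.sqrt |(g : ℝ)| := by
  have hN' : (1 : ℝ) ≤ N := by exact_mod_cast hN
  have hgpos : 0 < |(g : ℝ)| := abs_pos.2 (by exact_mod_cast hg)
  have hs : 0 < Real.sqrt |(g : ℝ)| := Real.sqrt_pos.2 hgpos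
  have hmaps : ∀ p ∈ nearSquarePairs N g, p.1 ∈ Finset.Icc (1 : ℤ) ((6 * N : ℕ) : ℤ) := by
    intro p hp
    simp only [nearSquarePairs, Finset.mem_filter, Finset.mem_product] at hp
    push_cast
    exact hp.1.1
  rw [Finset.card_eq_sum_card_fiberwise hmaps]
  push_cast
  calc _ ≤ ∑ m ∈ Finset.Icc (1 : ℤ) ((6 * N : ℕ) : ℤ),
        (92 * N / Real.sqrt |(g : ℝ)|) * (1 / (m : ℝ)) := ?_
    _ = (92 * N / Real.sqrt |(g : ℝ)|) * ∑ n ∈ Finset.Icc 1 (6 * N), (1 / n : ℝ) := by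
        rw [← Finset.mul_sum]
        congr 1
        rw [sum_Icc_int_eq (fun m => 1 / (m : ℝ))]
        simp
    _ ≤ (92 * N / Real.sqrt |(g : ℝ)|) * M := by gcongr
    _ = _ := by ring
  refine Finset.sum_le_sum fun m hm => ?_
  rw [Finset.mem_Icc] at hm
  have hm1 : (1 : ℝ) ≤ m := by exact_mod_cast hm.1
  have hm0 : (0 : ℝ) < m := by linarith
  set F := (nearSquarePairs N g).filter (fun p => p.1 = m) with hF
  have hFmem : ∀ p ∈ F, p.1 = m ∧ |p.2| ≤ 4 * N ∧ |p.2 ^ 2 - g * m ^ 2| ≤ 20 * N := by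
    intro p hp
    simp only [hF, nearSquarePairs, Finset.mem_filter, Finset.mem_product, Finset.mem_Icc] at hp
    obtain ⟨⟨⟨-, h2⟩, h3⟩, h4⟩ := hp
    exact ⟨h4, abs_le.2 h2, h4 ▸ h3⟩
  rcases F.eq_empty_or_nonempty with h | ⟨p0, hp0⟩
  · rw [h]; simp; positivity
  have hbound : Real.sqrt |(g : ℝ)| * m ≤ 6 * N := by
    obtain ⟨-, h2, h3⟩ := hFmem p0 hp0
    have h2' : |(p0.2 : ℝ)| ≤ 4 * N := by exact_mod_cast h2
    have h3' : |(p0.2 : ℝ) ^ 2 - g * m ^ 2| ≤ 20 * N := by exact_mod_cast h3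
    refine abs_le_of_sq_le_sq' ?_ (by positivity) |>.2
    rw [mul_pow, Real.sq_sqrt hgpos.le]
    have h4 : |(g : ℝ)| * m ^ 2 = |(g : ℝ) * m ^ 2| := by
      rw [abs_mul, abs_of_nonneg (sq_nonneg (m : ℝ))]
    have h5 : |(g : ℝ) * m ^ 2| ≤ |(p0.2 : ℝ) ^ 2| + |(p0.2 : ℝ) ^ 2 - g * m ^ 2| := by
      have := abs_sub ((p0.2 : ℝ) ^ 2) ((p0.2 : ℝ) ^ 2 - g * m ^ 2)
      simpa using this
    have h6 : |(p0.2 : ℝ) ^ 2| ≤ (4 * N) ^ 2 := by rw [abs_pow]; gcongr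
    nlinarith
  have hcard := card_sq_near_le (g * m ^ 2) (mul_ne_zero hg (pow_ne_zero 2 (by omega))) (20 * N)
    (by positivity) (F.image Prod.snd) (fun x hx => by
      obtain ⟨p, hp, rfl⟩ := Finset.mem_image.1 hx
      exact_mod_cast (hFmem p hp).2.2)
  rw [Finset.card_image_of_injOn (fun p hp q hq h =>
    Prod.ext ((hFmem p hp).1.trans (hFmem q hq).1.symm) h)] at hcard
  have hsq : Real.sqrt |((g * m ^ 2 : ℤ) : ℝ)| = Real.sqrt |(g : ℝ)| * m := by
    push_cast
    rw [abs_mul, Real.sqrt_mul (abs_nonneg _), abs_of_nonneg (sq_nonneg (m : ℝ)),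
      Real.sqrt_sq hm0.le]
  rw [hsq] at hcard
  refine hcard.trans ?_
  have : (2 : ℝ) ≤ 12 * N / (Real.sqrt |(g : ℝ)| * m) := by
    rw [le_div_iff₀ (by positivity)]; linarith
  calc _ ≤ 12 * N / (Real.sqrt |(g : ℝ)| * m) + 4 * (20 * N) / (Real.sqrt |(g : ℝ)| * m) := by
        linarith
    _ = _ := by field_simp; ring

theorem exists_common_squareclass {u v w : ℤ} (hw : w ≠ 0) (h : u * v = w ^ 2) :
    ∃ g m n : ℤ, g ≠ 0 ∧ 1 ≤ m ∧ 1 ≤ n ∧ u = g * m ^ 2 ∧ v = g * n ^ 2 := by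
  have huv : u * v ≠ 0 := h ▸ pow_ne_zero 2 hw
  have hu := left_ne_zero_of_mul huv
  have hg : 0 < Int.gcd u v := Int.gcd_pos_of_ne_zero_left _ hu
  have h0 : ((Int.gcd u v : ℕ) : ℤ) ≠ 0 := by exact_mod_cast hg.ne'
  have hcop := Int.gcd_div_gcd_div_gcd hg
  obtain ⟨u', hu'⟩ := Int.gcd_dvd_left u v
  obtain ⟨v', hv'⟩ := Int.gcd_dvd_right u v
  have e1 : u / (Int.gcd u v : ℕ) = u' := by
    nth_rewrite 1 [hu']; exact Int.mul_ediv_cancel_left _ h0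
  have e2 : v / (Int.gcd u v : ℕ) = v' := by
    nth_rewrite 1 [hv']; exact Int.mul_ediv_cancel_left _ h0
  rw [e1, e2] at hcop
  generalize ((Int.gcd u v : ℕ) : ℤ) = k at *
  subst hu' hv'
  have hk : k ∣ w := by
    rw [← Int.pow_dvd_pow_iff two_ne_zero, ← h]
    exact ⟨u' * v', by ring⟩
  obtain ⟨w', rfl⟩ := hk
  have hw' : u' * v' = w' ^ 2 := mul_left_cancel₀ (pow_ne_zero 2 h0) (by linarith)
  have hw0 : w' ≠ 0 := right_ne_zero_of_mul hw
  have hpos : 0 < u' * v' := by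
    rw [hw']; exact by positivity
  have key : ∀ {x y : ℤ}, 0 < x → 0 < y → Int.gcd x y = 1 → x * y = w' ^ 2 →
      ∃ m : ℤ, 1 ≤ m ∧ x = m ^ 2 := by
    intro x y hx hy hxy hsq
    obtain ⟨m, hm | hm⟩ := Int.sq_of_gcd_eq_one hxy hsq
    · refine ⟨|m|, Int.one_le_abs ?_, by rw [sq_abs, hm]⟩
      rintro rfl
      simp [hm] at hx
    · nlinarith [sq_nonneg m]
  rcases pos_and_pos_or_neg_and_neg_of_mul_pos hpos with ⟨h1, h2⟩ | ⟨h1, h2⟩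
  · obtain ⟨m, hm, rfl⟩ := key h1 h2 hcop hw'
    obtain ⟨n, hn, rfl⟩ := key h2 h1 (by rwa [Int.gcd_comm]) (by rw [mul_comm, hw'])
    exact ⟨k, m, n, h0, hm, hn, rfl, rfl⟩
  · obtain ⟨m, hm, hm'⟩ := key (x := -u') (y := -v') (by omega) (by omega)
      (by simpa using hcop) (by rw [neg_mul_neg, hw'])
    obtain ⟨n, hn, hn'⟩ := key (x := -v') (y := -u') (by omega) (by omega)
      (by simpa [Int.gcd_comm] using hcop) (by rw [neg_mul_neg, mul_comm, hw'])
    exact ⟨-k, m, n, by omega, hm, hn, by linear_combination -k * hm', by linear_combination -k * hn'⟩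

theorem abs_resolvent_root_le {a b c d x : ℤ} {N : ℕ} (ha : |a| ≤ N) (hb : |b| ≤ N)
    (hc : |c| ≤ N) (hd : |d| ≤ N)
    (h : (x ^ 2 - 4 * d) * (a ^ 2 - 4 * b + 4 * x) = (a * x - 2 * c) ^ 2) : |x| ≤ 4 * N := by
  have h1 : x ^ 3 = b * x ^ 2 - a * c * x + 4 * d * x + a * a * d - 4 * b * d + c * c := by
    linarith
  have h2 : |x| ^ 3 ≤ N * |x| ^ 2 + N * N * |x| + 4 * N * |x| + N * N * N + 4 * N * N + N * N := by
    rw [← abs_pow, h1]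
    have e1 : |b * x ^ 2| ≤ N * |x| ^ 2 := by rw [abs_mul, abs_pow]; gcongr
    have e2 : |a * c * x| ≤ N * N * |x| := by rw [abs_mul, abs_mul]; gcongr
    have e3 : |4 * d * x| ≤ 4 * N * |x| := by rw [abs_mul, abs_mul]; gcongr; norm_num
    have e4 : |a * a * d| ≤ N * N * N := by rw [abs_mul, abs_mul]; gcongr
    have e5 : |4 * b * d| ≤ 4 * N * N := by rw [abs_mul, abs_mul]; gcongr; norm_num
    have e6 : |c * c| ≤ N * N := by rw [abs_mul]; gcongr
    rw [abs_le] at *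
    constructor <;> linarith [e1.1, e1.2, e2.1, e2.2, e3.1, e3.2]
  by_contra hlt
  obtain ⟨k, hk⟩ : ∃ k : ℕ, |x| = 4 * N + 1 + k := ⟨(|x| - 4 * N - 1).toNat, by omega⟩
  rw [hk] at h2
  have : (0 : ℤ) < 43 * N ^ 3 + 18 * N ^ 2 + 7 * N + 1 + (39 * N ^ 2 + 18 * N + 3) * k
    + (11 * N + 3) * k ^ 2 + k ^ 3 := by positivity
  nlinarith

/-- Pairs `(a, x)` with small product. -/
noncomputable def smallProductPairs (N : ℕ) : Finset (ℤ × ℤ) :=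
  (Finset.Icc (-(N : ℤ)) N ×ˢ Finset.Icc (-(4 * N : ℤ)) (4 * N)).filter
    fun p => |p.1 * p.2| ≤ 2 * N

theorem card_smallProductPairs_le (N : ℕ) (M : ℝ)
    (hM : ∑ n ∈ Finset.Icc (1 : ℕ) N, (1 / n : ℝ) ≤ M) :
    ((smallProductPairs N).card : ℝ) ≤ 1 + 10 * N + 8 * N * M := by
  have hmaps : ∀ p ∈ smallProductPairs N, p.1 ∈ Finset.Icc (-(N : ℤ)) N := by
    intro p hp
    simp only [smallProductPairs, Finset.mem_filter, Finset.mem_product] at hp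
    exact hp.1.1
  rw [Finset.card_eq_sum_card_fiberwise hmaps]
  have h0 : (0 : ℤ) ∈ Finset.Icc (-(N : ℤ)) N := by simp
  rw [← Finset.add_sum_erase _ _ h0]
  push_cast
  have hz : (((smallProductPairs N).filter (fun p => p.1 = 0)).card : ℝ) ≤ 8 * N + 1 := by
    have : ((smallProductPairs N).filter (fun p => p.1 = 0)).card ≤
        (Finset.Icc (-(4 * N : ℤ)) (4 * N)).card := by
      refine Finset.card_le_card_of_injOn Prod.snd ?_ ?_
      · intro p hp
        simp only [smallProductPairs, Finset.coe_filter, Finset.mem_filter, Finset.mem_product]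
          at hp
        exact hp.1.1.2
      · intro p hp q hq h
        exact Prod.ext ((Finset.mem_filter.1 hp).2.trans (Finset.mem_filter.1 hq).2.symm) h
    rw [Int.card_Icc] at this
    have h3 : (4 * N + 1 - -(4 * N) : ℤ).toNat = 8 * N + 1 := by omega
    rw [h3] at this
    exact_mod_cast this
  have hnz : ∑ a ∈ (Finset.Icc (-(N : ℤ)) N).erase 0,
      (((smallProductPairs N).filter (fun p => p.1 = a)).card : ℝ) ≤
      ∑ a ∈ (Finset.Icc (-(N : ℤ)) N).erase 0, (1 + 4 * N * (1 / (a.natAbs : ℝ))) := by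
    refine Finset.sum_le_sum fun a ha => ?_
    have ha0 : a ≠ 0 := (Finset.mem_erase.1 ha).1
    have hapos : (0 : ℝ) < |(a : ℝ)| := abs_pos.2 (by exact_mod_cast ha0)
    have hinj : Set.InjOn Prod.snd
        (((smallProductPairs N).filter (fun p => p.1 = a) : Finset _) : Set (ℤ × ℤ)) := by
      intro p hp q hq h
      exact Prod.ext ((Finset.mem_filter.1 hp).2.trans (Finset.mem_filter.1 hq).2.symm) h
    rw [← Finset.card_image_of_injOn hinj, Nat.cast_natAbs, Int.cast_abs]
    have := card_congr_interval_le (((smallProductPairs N).filter (fun p => p.1 = a)).image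
      Prod.snd) 1 one_pos (-(2 * N / |(a : ℝ)|)) (2 * N / |(a : ℝ)|)
      (neg_le_self (by positivity)) (by
        intro x hx
        obtain ⟨p, hp, rfl⟩ := Finset.mem_image.1 hx
        simp only [smallProductPairs, Finset.mem_filter] at hp
        obtain ⟨⟨-, h1⟩, h2⟩ := hp
        rw [← abs_le, le_div_iff₀ hapos, mul_comm, ← abs_mul, ← h2]
        exact_mod_cast h1) (by simp)
    calc _ ≤ _ := this
      _ = _ := by push_cast; ring
  have hsum := sum_int_eq_two_mul (fun n => (1 + 4 * N * (1 / (n : ℝ)))) N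
  rw [hsum, Finset.sum_add_distrib, ← Finset.mul_sum] at hnz
  simp only [Finset.sum_const, Nat.card_Icc, Nat.add_sub_cancel, nsmul_eq_mul, mul_one] at hnz
  have : 4 * (N : ℝ) * ∑ n ∈ Finset.Icc (1 : ℕ) N, (1 / n : ℝ) ≤ 4 * N * M := by gcongr
  linarith

/-- Quartics `X ^ 4 + a X ^ 3 + b X ^ 2 + c X + d` of height at most `N` together with an integral
root `x` of the resolvent cubic. -/
def IsResolventRoot (N : ℕ) (t : ℤ × ℤ × ℤ × ℤ × ℤ) : Prop :=
  |t.1| ≤ N ∧ |t.2.1| ≤ N ∧ |t.2.2.1| ≤ N ∧ |t.2.2.2.1| ≤ N ∧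
    (t.2.2.2.2 ^ 2 - 4 * t.2.2.2.1) * (t.1 ^ 2 - 4 * t.2.1 + 4 * t.2.2.2.2) =
      (t.1 * t.2.2.2.2 - 2 * t.2.2.1) ^ 2

theorem card_resolventRoot_nondegenerate_le (N : ℕ) (hN : 1 ≤ N) (M : ℝ)
    (hM : ∑ n ∈ Finset.Icc (1 : ℕ) (36 * N ^ 2), (1 / n : ℝ) ≤ M) (T : Finset (ℤ × ℤ × ℤ × ℤ × ℤ))
    (hT : ∀ t ∈ T, IsResolventRoot N t ∧ t.1 * t.2.2.2.2 - 2 * t.2.2.1 ≠ 0) :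
    (T.card : ℝ) ≤ 33856 * N ^ 2 * M ^ 3 := by
  have hN' : (1 : ℤ) ≤ N := by exact_mod_cast hN
  have hM6 : ∑ n ∈ Finset.Icc 1 (6 * N), (1 / n : ℝ) ≤ M :=
    le_trans (Finset.sum_le_sum_of_subset_of_nonneg
      (Finset.Icc_subset_Icc_right (by nlinarith)) (fun _ _ _ => by positivity)) hM
  have hM0 : 0 ≤ M := le_trans (Finset.sum_nonneg fun _ _ => by positivity) hM
  have hex : ∀ t ∈ T, ∃ g m n : ℤ, g ≠ 0 ∧ 1 ≤ m ∧ 1 ≤ n ∧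
      t.2.2.2.2 ^ 2 - 4 * t.2.2.2.1 = g * m ^ 2 ∧
      t.1 ^ 2 - 4 * t.2.1 + 4 * t.2.2.2.2 = g * n ^ 2 := fun t ht =>
    exists_common_squareclass (hT t ht).2 (hT t ht).1.2.2.2.2
  choose! g m n hg hm hn hu hv using hex
  have hx : ∀ t ∈ T, |t.2.2.2.2| ≤ 4 * N := fun t ht =>
    abs_resolvent_root_le (hT t ht).1.1 (hT t ht).1.2.1 (hT t ht).1.2.2.1 (hT t ht).1.2.2.2.1
      (hT t ht).1.2.2.2.2
  have hu36 : ∀ t ∈ T, |g t| * m t ^ 2 ≤ 36 * N ^ 2 := by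
    intro t ht
    have h1 := hx t ht
    obtain ⟨ha, hb, hc, hd, -⟩ := (hT t ht).1
    have h2 : t.2.2.2.2 ^ 2 ≤ (4 * N) ^ 2 := by rw [← sq_abs]; gcongr
    have h3 : |g t| * m t ^ 2 = |g t * m t ^ 2| := by rw [abs_mul, abs_sq]
    rw [h3, ← hu t ht, abs_le]
    rw [abs_le] at hd
    constructor <;> nlinarith [sq_nonneg t.2.2.2.2]
  have hv36 : ∀ t ∈ T, |g t| * n t ^ 2 ≤ 36 * N ^ 2 := by
    intro t ht
    have h1 := hx t ht
    obtain ⟨ha, hb, hc, hd, -⟩ := (hT t ht).1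
    have h2 : t.1 ^ 2 ≤ (N : ℤ) ^ 2 := by rw [← sq_abs]; gcongr
    have h3 : |g t| * n t ^ 2 = |g t * n t ^ 2| := by rw [abs_mul, abs_sq]
    rw [h3, ← hv t ht, abs_le]
    rw [abs_le] at hb h1
    constructor <;> nlinarith [sq_nonneg t.1]
  have hle6 : ∀ k l : ℤ, k ≠ 0 → |k| * l ^ 2 ≤ 36 * N ^ 2 → l ≤ 6 * N := by
    intro k l hk hl
    have : 1 ≤ |k| := Int.one_le_abs hk
    refine (abs_le_of_sq_le_sq' ?_ (by positivity)).2
    nlinarith [sq_nonneg l]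
  have hmaps : ∀ t ∈ T, g t ∈ (Finset.Icc (-((36 * N ^ 2 : ℕ) : ℤ)) ((36 * N ^ 2 : ℕ) : ℤ)).erase 0 := by
    intro t ht
    rw [Finset.mem_erase, Finset.mem_Icc, ← abs_le]
    refine ⟨hg t ht, ?_⟩
    push_cast
    have h1 := hu36 t ht
    have h2 : 1 ≤ m t ^ 2 := one_le_pow₀ (hm t ht)
    nlinarith [abs_nonneg (g t)]
  rw [Finset.card_eq_sum_card_fiberwise hmaps]
  push_cast
  calc _ ≤ ∑ k ∈ (Finset.Icc (-((36 * N ^ 2 : ℕ) : ℤ)) ((36 * N ^ 2 : ℕ) : ℤ)).erase 0,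
        (16928 * N ^ 2 * M ^ 2 * (1 / (k.natAbs : ℝ))) := ?_
    _ ≤ 16928 * N ^ 2 * M ^ 2 * (2 * M) := by
        rw [← Finset.mul_sum, sum_int_eq_two_mul (fun n => 1 / (n : ℝ))]
        gcongr
    _ = _ := by ring
  push_cast
  refine Finset.sum_le_sum fun k hk => ?_
  have hk0 : k ≠ 0 := (Finset.mem_erase.1 hk).1
  have hkpos : (0 : ℝ) < |(k : ℝ)| := abs_pos.2 (by exact_mod_cast hk0)
  have hcard : (T.filter (fun t => g t = k)).card ≤
      ((nearSquarePairs N k ×ˢ nearSquarePairs N k) ×ˢ (Finset.univ : Finset Bool)).card := by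
    refine Finset.card_le_card_of_injOn (fun t => (((m t, t.2.2.2.2), (n t, t.1)),
      decide (0 ≤ t.1 * t.2.2.2.2 - 2 * t.2.2.1))) ?_ ?_
    · intro t ht
      obtain ⟨ht, hgk⟩ := Finset.mem_filter.1 ht
      have h1 := hx t ht
      have h2 := hle6 _ _ (hg t ht) (hu36 t ht)
      have h3 := hle6 _ _ (hg t ht) (hv36 t ht)
      have h4 := hu t ht
      have h5 := hv t ht
      rw [hgk] at h4 h5
      have hm1 := hm t ht
      have hn1 := hn t ht
      obtain ⟨ha, hb, hc, hd, -⟩ := (hT t ht).1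
      simp only [Finset.coe_product, Set.mem_prod, Finset.mem_coe, nearSquarePairs,
        Finset.mem_filter, Finset.mem_product, Finset.mem_Icc, Finset.mem_univ, and_true]
      rw [← h4, ← h5]
      rw [abs_le] at *
      refine ⟨⟨⟨⟨hm1, h2⟩, h1⟩, ?_⟩, ⟨⟨hn1, h3⟩, by omega, by omega⟩, ?_⟩
      · constructor <;> linarith
      · rw [abs_le]
        constructor <;> linarith
    · intro t ht s hs hts
      obtain ⟨ht, hgt⟩ := Finset.mem_filter.1 ht
      obtain ⟨hs, hgs⟩ := Finset.mem_filter.1 hs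
      simp only [Prod.mk.injEq, decide_eq_decide] at hts
      obtain ⟨⟨⟨e1, e2⟩, e3, e4⟩, e5⟩ := hts
      have a1 := hu t ht
      have a2 := hv t ht
      have a3 := hu s hs
      have a4 := hv s hs
      have a5 := (hT t ht).1.2.2.2.2
      have a6 := (hT s hs).1.2.2.2.2
      have a7 := (hT s hs).2
      rw [a1, a2, hgt, e1, e3] at a5
      rw [a3, a4, hgs] at a6
      rw [e2, e4, hgt, e3] at a2
      rw [e2, hgt, e1] at a1
      rw [hgs] at a3 a4
      have h6 := sq_eq_sq_iff_eq_or_eq_neg.1 (a5.symm.trans a6)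
      have h7 : t.1 * t.2.2.2.2 - 2 * t.2.2.1 = s.1 * s.2.2.2.2 - 2 * s.2.2.1 := by
        rcases h6 with h6 | h6 <;> omega
      rw [e2, e4] at h7
      ext1
      · exact e4
      ext1
      · linarith
      ext1
      · linarith
      ext1
      · linarith
      · exact e2
  have hns := card_nearSquarePairs_le N hN k hk0 M hM6
  rw [Finset.card_product, Finset.card_product] at hcard
  have hcard' : ((T.filter (fun t => g t = k)).card : ℝ) ≤
      (nearSquarePairs N k).card * (nearSquarePairs N k).card * 2 := by exact_mod_cast hcard
  refine hcard'.trans ?_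
  calc _ ≤ (92 * N * M / Real.sqrt |(k : ℝ)|) * (92 * N * M / Real.sqrt |(k : ℝ)|) * 2 := by gcongr
    _ = 16928 * N ^ 2 * M ^ 2 / (Real.sqrt |(k : ℝ)|) ^ 2 := by field_simp; ring
    _ = _ := by
      rw [Real.sq_sqrt hkpos.le, Nat.cast_natAbs, Int.cast_abs]; ring

theorem card_resolventRoot_degenerate_le (N : ℕ) (M : ℝ)
    (hM : ∑ n ∈ Finset.Icc (1 : ℕ) N, (1 / n : ℝ) ≤ M) (T : Finset (ℤ × ℤ × ℤ × ℤ × ℤ))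
    (hT : ∀ t ∈ T, IsResolventRoot N t ∧ t.1 * t.2.2.2.2 - 2 * t.2.2.1 = 0) :
    (T.card : ℝ) ≤ 2 * (1 + 10 * N + 8 * N * M) * (2 * N + 1) := by
  have hcard : T.card ≤ ((smallProductPairs N ×ˢ Finset.Icc (-(N : ℤ)) N) ×ˢ
      (Finset.univ : Finset Bool)).card := by
    refine Finset.card_le_card_of_injOn (fun t => (((t.1, t.2.2.2.2),
      if t.2.2.2.2 ^ 2 = 4 * t.2.2.2.1 then t.2.1 else t.2.2.2.1),
      decide (t.2.2.2.2 ^ 2 = 4 * t.2.2.2.1))) ?_ ?_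
    · intro t ht
      obtain ⟨⟨ha, hb, hc, hd, h⟩, h0⟩ := hT t ht
      have hx := abs_resolvent_root_le ha hb hc hd h
      have h1 : t.1 * t.2.2.2.2 = 2 * t.2.2.1 := by linarith
      simp only [Finset.coe_product, Set.mem_prod, Finset.mem_coe, smallProductPairs,
        Finset.mem_filter, Finset.mem_product, Finset.mem_Icc, Finset.mem_univ, and_true]
      rw [← abs_le, ← abs_le, ← abs_le, h1, abs_mul, abs_two]
      refine ⟨⟨⟨ha, hx⟩, by linarith⟩, ?_⟩
      split_ifs <;> assumption
    · intro t ht s hs hts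
      obtain ⟨⟨-, -, -, -, h⟩, h0⟩ := hT t ht
      obtain ⟨⟨-, -, -, -, h'⟩, h0'⟩ := hT s hs
      simp only [Prod.mk.injEq, decide_eq_decide] at hts
      obtain ⟨⟨⟨e1, e2⟩, e3⟩, e4⟩ := hts
      rw [h0, zero_pow two_ne_zero, mul_eq_zero, sub_eq_zero] at h
      rw [h0', zero_pow two_ne_zero, mul_eq_zero, sub_eq_zero] at h'
      have e5 : t.2.2.1 = s.2.2.1 := by
        rw [e1, e2] at h0; linarith
      by_cases hq : t.2.2.2.2 ^ 2 = 4 * t.2.2.2.1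
      · have hq' := e4.1 hq
        rw [if_pos hq, if_pos hq'] at e3
        rw [e2] at hq
        have e6 : t.2.2.2.1 = s.2.2.2.1 := by linarith
        exact Prod.ext e1 (Prod.ext e3 (Prod.ext e5 (Prod.ext e6 e2)))
      · have hq' := fun h => hq (e4.2 h)
        rw [if_neg hq, if_neg hq'] at e3
        have h1 := h.resolve_left hq
        have h2 := h'.resolve_left hq'
        rw [e1, e2] at h1
        have e6 : t.2.1 = s.2.1 := by linarith
        exact Prod.ext e1 (Prod.ext e6 (Prod.ext e5 (Prod.ext e3 e2)))
  rw [Finset.card_product, Finset.card_product, Int.card_Icc] at hcard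
  have h3 : (N + 1 - -(N : ℤ)).toNat = 2 * N + 1 := by omega
  rw [h3] at hcard
  have hcard' : (T.card : ℝ) ≤ (smallProductPairs N).card * (2 * N + 1) * 2 := by
    exact_mod_cast hcard
  have := card_smallProductPairs_le N M hM
  calc _ ≤ _ := hcard'
    _ ≤ (1 + 10 * N + 8 * N * M) * (2 * N + 1) * 2 := by gcongr
    _ = _ := by ring

/-- Few quartics have a resolvent cubic with an integral root. -/
theorem card_resolventRoot_le (N : ℕ) (hN : 1 ≤ N) (M : ℝ)
    (hM : ∑ n ∈ Finset.Icc (1 : ℕ) (36 * N ^ 2), (1 / n : ℝ) ≤ M) (T : Finset (ℤ × ℤ × ℤ × ℤ × ℤ))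
    (hT : ∀ t ∈ T, IsResolventRoot N t) :
    (T.card : ℝ) ≤ 34000 * N ^ 2 * M ^ 3 := by
  have hN' : (1 : ℝ) ≤ N := by exact_mod_cast hN
  have hMN : ∑ n ∈ Finset.Icc (1 : ℕ) N, (1 / n : ℝ) ≤ M :=
    le_trans (Finset.sum_le_sum_of_subset_of_nonneg
      (Finset.Icc_subset_Icc_right (by nlinarith)) (fun _ _ _ => by positivity)) hM
  have hM1 : 1 ≤ M := by
    refine le_trans ?_ hMN
    calc (1 : ℝ) = ∑ n ∈ Finset.Icc (1 : ℕ) 1, (1 / n : ℝ) := by simp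
      _ ≤ _ := Finset.sum_le_sum_of_subset_of_nonneg
        (Finset.Icc_subset_Icc_right hN) (fun _ _ _ => by positivity)
  have h1 := card_resolventRoot_nondegenerate_le N hN M hM
    (T.filter fun t => ¬ t.1 * t.2.2.2.2 - 2 * t.2.2.1 = 0)
    (fun t ht => ⟨hT t (Finset.mem_filter.1 ht).1, (Finset.mem_filter.1 ht).2⟩)
  have h2 := card_resolventRoot_degenerate_le N M hMN
    (T.filter fun t => t.1 * t.2.2.2.2 - 2 * t.2.2.1 = 0)
    (fun t ht => ⟨hT t (Finset.mem_filter.1 ht).1, (Finset.mem_filter.1 ht).2⟩)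
  have h3 := T.card_filter_add_card_filter_not (fun t => t.1 * t.2.2.2.2 - 2 * t.2.2.1 = 0)
  rw [← h3]
  push_cast
  have h4 : 2 * (1 + 10 * N + 8 * N * M) * (2 * N + 1) ≤ 114 * N ^ 2 * M ^ 3 := by
    have e1 : 1 + 10 * N + 8 * N * M ≤ 19 * N * M := by nlinarith
    have e2 : (2 * N + 1 : ℝ) ≤ 3 * N := by linarith
    have e3 : M ≤ M ^ 3 := le_self_pow₀ hM1 (by norm_num)
    calc _ ≤ 2 * (19 * N * M) * (3 * N) := by gcongr
      _ = 114 * N ^ 2 * M := by ring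
      _ ≤ _ := by gcongr
  have h5 : 0 ≤ (N : ℝ) ^ 2 * M ^ 3 := by positivity
  linarith

theorem card_le_sum_of_fibers {α β : Type*} [DecidableEq β] (S : Finset α) (f : α → β)
    (X : Finset β) (h : ∀ s ∈ S, f s ∈ X) (b : β → ℝ)
    (hb : ∀ x ∈ X, ((S.filter (fun s => f s = x)).card : ℝ) ≤ b x) :
    (S.card : ℝ) ≤ ∑ x ∈ X, b x := by
  rw [Finset.card_eq_sum_card_fiberwise h]
  push_cast
  exact Finset.sum_le_sum hb

theorem card_le_mul_of_fibers {α β : Type*} [DecidableEq β] (S : Finset α) (f : α → β)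
    (k l : ℝ) (hl : 0 ≤ l) (hk : ((S.image f).card : ℝ) ≤ k)
    (hb : ∀ x ∈ S.image f, ((S.filter (fun s => f s = x)).card : ℝ) ≤ l) :
    (S.card : ℝ) ≤ k * l := by
  refine (card_le_sum_of_fibers S f (S.image f) (fun s hs => Finset.mem_image_of_mem f hs)
    (fun _ => l) hb).trans ?_
  rw [Finset.sum_const, nsmul_eq_mul]
  gcongr

theorem card_le_card_image_add_card_pairs {α β : Type*} [DecidableEq α] [DecidableEq β]
    (S : Finset α) (f : α → β) :
    S.card ≤ (S.image f).card +
      ((S ×ˢ S).filter fun p => p.1 ≠ p.2 ∧ f p.1 = f p.2).card := by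
  rcases S.eq_empty_or_nonempty with rfl | ⟨s0, hs0⟩
  · simp
  have : Nonempty α := ⟨s0⟩
  have hex : ∀ y ∈ S.image f, ∃ s ∈ S, f s = y := fun y hy => Finset.mem_image.1 hy
  choose! g hg hfg using hex
  have h1 : (S.filter fun s => g (f s) = s).card ≤ (S.image f).card :=
    Finset.card_le_card_of_injOn f
      (fun s hs => Finset.mem_image_of_mem f (Finset.mem_filter.1 hs).1)
      (fun s hs t ht h => by
        rw [← (Finset.mem_filter.1 hs).2, ← (Finset.mem_filter.1 ht).2, h])
  have h2 : (S.filter fun s => ¬ g (f s) = s).card ≤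
      ((S ×ˢ S).filter fun p => p.1 ≠ p.2 ∧ f p.1 = f p.2).card :=
    Finset.card_le_card_of_injOn (fun s => (g (f s), s))
      (fun s hs => by
        obtain ⟨hs, hne⟩ := Finset.mem_filter.1 hs
        have := Finset.mem_image_of_mem f hs
        simp only [Finset.coe_filter, Set.mem_ofPred_eq, Finset.mem_product]
        exact ⟨⟨hg _ this, hs⟩, hne, hfg _ this⟩)
      (fun s _ t _ h => (Prod.ext_iff.1 h).2)
  have h3 := S.card_filter_add_card_filter_not (fun s => g (f s) = s)
  omega

theorem gcd_mul_le (x y : ℤ) (k : ℕ) (hk : 0 < k) (h : 0 < Int.gcd x y) :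
    Int.gcd x (k * y) ≤ k * Int.gcd x y := by
  refine Nat.le_of_dvd (Nat.mul_pos hk h) ?_
  have h1 : Int.gcd (k * x) (k * y) = k * Int.gcd x y := by
    rw [Int.gcd_mul_left, Int.natAbs_natCast]
  rw [← h1]
  exact Int.dvd_gcd ((Int.gcd_dvd_left _ _).mul_left _) (Int.gcd_dvd_right _ _)

/-- The quadratic invariant of `X ^ 4 + a X ^ 3 + b X ^ 2 + c X + d`. -/
def quarticI (a b c d : ℤ) : ℤ := 12 * d - 3 * a * c + b ^ 2

/-- The cubic invariant of `X ^ 4 + a X ^ 3 + b X ^ 2 + c X + d`. -/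
def quarticJ (a b c d : ℤ) : ℤ :=
  72 * b * d + 9 * a * b * c - 27 * c ^ 2 - 27 * a ^ 2 * d - 2 * b ^ 3

theorem card_samePairs_le (N : ℕ) (hN : 1 ≤ N) (a : ℤ) (ha : |a| ≤ N) (M : ℝ)
    (hM : ∑ n ∈ Finset.Icc (1 : ℕ) (14 * N ^ 2), (1 / n : ℝ) ≤ M)
    (hd : ∀ n : ℕ, n ≠ 0 → n ≤ 2 * N → (n.divisors.card : ℝ) ≤ M)
    (P : Finset ((ℤ × ℤ × ℤ) × (ℤ × ℤ × ℤ)))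
    (hP1 : ∀ p ∈ P, |p.1.1| ≤ N ∧ |p.1.2.1| ≤ N ∧ |p.1.2.2| ≤ N)
    (hP2 : ∀ p ∈ P, |p.2.1| ≤ N ∧ |p.2.2.1| ≤ N ∧ |p.2.2.2| ≤ N)
    (hb : ∀ p ∈ P, p.1.1 ≠ p.2.1)
    (hI : ∀ p ∈ P, quarticI a p.1.1 p.1.2.1 p.1.2.2 = quarticI a p.2.1 p.2.2.1 p.2.2.2)
    (hJ : ∀ p ∈ P, quarticJ a p.1.1 p.1.2.1 p.1.2.2 = quarticJ a p.2.1 p.2.2.1 p.2.2.2) :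
    (P.card : ℝ) ≤ 7400 * N ^ 2 * M ^ 3 := by
  have hN' : (1 : ℝ) ≤ N := by exact_mod_cast hN
  have hM1 : 1 ≤ M := by
    have := hd 1 one_ne_zero (by omega)
    simpa using this
  have hmono : ∀ k : ℕ, k ≤ 14 * N ^ 2 → ∑ n ∈ Finset.Icc (1 : ℕ) k, (1 / n : ℝ) ≤ M := fun k hk =>
    le_trans (Finset.sum_le_sum_of_subset_of_nonneg (Finset.Icc_subset_Icc_right hk)
      (fun _ _ _ => by positivity)) hM
  set R := Finset.Icc (-((2 * N : ℕ) : ℤ)) ((2 * N : ℕ) : ℤ) with hR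
  -- the number of solutions with given differences of the first two coefficients
  set F : ℤ → ℤ → ℝ := fun β γ => if a * β - 6 * γ = 0 then 1 + 4 * N else
    1 + 32 * N * ((Int.gcd β (a * β - 6 * γ) : ℝ) / |((a * β - 6 * γ : ℤ) : ℝ)|) with hF
  have hF0 : ∀ β γ, 0 ≤ F β γ := by
    intro β γ
    simp only [hF]
    split_ifs <;> positivity
  have hfib : ∀ β ∈ R.erase 0, ∀ γ ∈ R, ((P.filter fun p =>
      (p.2.1 - p.1.1, p.2.2.1 - p.1.2.1) = (β, γ)).card : ℝ) ≤
      50 * N * (1 / (β.natAbs : ℝ)) * F β γ := by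
    intro β hβ γ hγ
    rw [Finset.mem_erase, hR, Finset.mem_Icc, ← abs_le] at hβ
    obtain ⟨hβ0, hβ⟩ := hβ
    have hβpos : (0 : ℝ) < |(β : ℝ)| := abs_pos.2 (by exact_mod_cast hβ0)
    have hβle : |(β : ℝ)| ≤ 2 * N := by exact_mod_cast hβ
    refine card_le_mul_of_fibers _ (fun p => (p.1.1 + p.2.1, p.2.2.2 - p.1.2.2)) _ _ (hF0 _ _) ?_ ?_
    · have := card_linear_le β 12 (3 * a * γ) hβ0 (2 * N) (by positivity)
        ((P.filter fun p => (p.2.1 - p.1.1, p.2.2.1 - p.1.2.1) = (β, γ)).image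
          fun p => (p.1.1 + p.2.1, p.2.2.2 - p.1.2.2)) (by
          intro s hs
          obtain ⟨p, hp, rfl⟩ := Finset.mem_image.1 hs
          obtain ⟨hp, he⟩ := Finset.mem_filter.1 hp
          obtain ⟨e1, e2⟩ := Prod.ext_iff.1 he
          simp only at e1 e2 ⊢
          have h1 := hI p hp
          obtain ⟨-, -, h2⟩ := hP1 p hp
          obtain ⟨-, -, h3⟩ := hP2 p hp
          unfold quarticI at h1
          constructor
          · rw [← e1, ← e2]; linear_combination -h1
          · have : |p.2.2.2 - p.1.2.2| ≤ 2 * N := by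
              rw [abs_le] at *; omega
            exact_mod_cast this)
      refine this.trans ?_
      have hg : (Int.gcd β 12 : ℝ) ≤ 12 := by
        exact_mod_cast Nat.le_of_dvd (by norm_num)
          (Int.natCast_dvd_natCast.1 (by exact_mod_cast Int.gcd_dvd_right β 12))
      rw [Nat.cast_natAbs, Int.cast_abs]
      calc _ ≤ 2 * N / |(β : ℝ)| + 2 * (2 * N) * 12 / |(β : ℝ)| := by
            gcongr
            rwa [one_le_div hβpos]
        _ = _ := by ring
    · intro x hx
      rw [Finset.filter_filter]
      set Q := P.filter fun p => (p.2.1 - p.1.1, p.2.2.1 - p.1.2.1) = (β, γ) ∧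
        (p.1.1 + p.2.1, p.2.2.2 - p.1.2.2) = x with hQ
      have hQm : ∀ p ∈ Q, p ∈ P ∧ p.2.1 - p.1.1 = β ∧ p.2.2.1 - p.1.2.1 = γ ∧
          p.1.1 + p.2.1 = x.1 ∧ p.2.2.2 - p.1.2.2 = x.2 := by
        intro p hp
        obtain ⟨hp, he, hf⟩ := Finset.mem_filter.1 hp
        obtain ⟨e1, e2⟩ := Prod.ext_iff.1 he
        obtain ⟨e3, e4⟩ := Prod.ext_iff.1 hf
        exact ⟨hp, e1, e2, e3, e4⟩
      rcases Q.eq_empty_or_nonempty with he | ⟨p0, hp0⟩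
      · rw [he]; simpa using hF0 _ _
      have hline : ∃ r, ∀ p ∈ Q, 8 * β * (p.1.2.2 + p.2.2.2) +
          (a * β - 6 * γ) * (p.1.2.1 + p.2.2.1) = r := by
        refine ⟨8 * β * (p0.1.2.2 + p0.2.2.2) + (a * β - 6 * γ) * (p0.1.2.1 + p0.2.2.1), ?_⟩
        intro p hp
        have key : ∀ p ∈ Q, 9 * (8 * β * (p.1.2.2 + p.2.2.2) +
            (a * β - 6 * γ) * (p.1.2.1 + p.2.2.1)) = β * (3 * x.1 ^ 2 + β ^ 2) -
              72 * x.2 * x.1 - 9 * a * γ * x.1 + 54 * a ^ 2 * x.2 := by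
          intro p hp
          obtain ⟨hp, e1, e2, e3, e4⟩ := hQm p hp
          have h1 := hJ p hp
          unfold quarticJ at h1
          rw [← e1, ← e2, ← e3, ← e4]
          linear_combination -2 * h1
        have h1 := key p hp
        have h2 := key p0 hp0
        linarith
      obtain ⟨r, hr⟩ := hline
      have hC : ∀ p ∈ Q, |((p.1.2.1 + p.2.2.1 : ℤ) : ℝ)| ≤ 2 * N ∧
          |((p.1.2.2 + p.2.2.2 : ℤ) : ℝ)| ≤ 2 * N := by
        intro p hp
        obtain ⟨hp, -⟩ := hQm p hp
        obtain ⟨-, h1, h2⟩ := hP1 p hp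
        obtain ⟨-, h3, h4⟩ := hP2 p hp
        have h5 : |p.1.2.1 + p.2.2.1| ≤ 2 * N := by rw [abs_le] at *; omega
        have h6 : |p.1.2.2 + p.2.2.2| ≤ 2 * N := by rw [abs_le] at *; omega
        exact ⟨by exact_mod_cast h5, by exact_mod_cast h6⟩
      have hinj : ∀ p ∈ Q, ∀ q ∈ Q, p.1.2.1 + p.2.2.1 = q.1.2.1 + q.2.2.1 →
          p.1.2.2 + p.2.2.2 = q.1.2.2 + q.2.2.2 → p = q := by
        intro p hp q hq h1 h2
        obtain ⟨-, e1, e2, e3, e4⟩ := hQm p hp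
        obtain ⟨-, f1, f2, f3, f4⟩ := hQm q hq
        have g1 : p.1.1 = q.1.1 := by omega
        have g2 : p.2.1 = q.2.1 := by omega
        have g3 : p.1.2.1 = q.1.2.1 := by omega
        have g4 : p.2.2.1 = q.2.2.1 := by omega
        have g5 : p.1.2.2 = q.1.2.2 := by omega
        have g6 : p.2.2.2 = q.2.2.2 := by omega
        exact Prod.ext (Prod.ext g1 (Prod.ext g3 g5)) (Prod.ext g2 (Prod.ext g4 g6))
      simp only [hF]
      split_ifs with ht
      · have hcard := card_linear_le (8 * β) 0 r (by omega) (2 * N) (by positivity)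
          (Q.image fun p => (p.1.2.2 + p.2.2.2, p.1.2.1 + p.2.2.1)) (by
            intro s hs
            obtain ⟨p, hp, rfl⟩ := Finset.mem_image.1 hs
            refine ⟨?_, (hC p hp).1⟩
            have := hr p hp
            rw [ht] at this
            exact this)
        rw [Finset.card_image_of_injOn (fun p hp q hq h =>
          hinj p hp q hq (Prod.ext_iff.1 h).2 (Prod.ext_iff.1 h).1)] at hcard
        refine hcard.trans (le_of_eq ?_)
        rw [Int.gcd_zero_right, Nat.cast_natAbs, Int.cast_abs, mul_div_assoc,
          div_self (abs_ne_zero.2 (by exact_mod_cast mul_ne_zero (by norm_num) hβ0))]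
        ring
      · have hcard := card_linear_le (a * β - 6 * γ) (8 * β) r ht (2 * N) (by positivity)
          (Q.image fun p => (p.1.2.1 + p.2.2.1, p.1.2.2 + p.2.2.2)) (by
            intro s hs
            obtain ⟨p, hp, rfl⟩ := Finset.mem_image.1 hs
            refine ⟨?_, (hC p hp).2⟩
            linarith [hr p hp])
        rw [Finset.card_image_of_injOn (fun p hp q hq h =>
          hinj p hp q hq (Prod.ext_iff.1 h).1 (Prod.ext_iff.1 h).2)] at hcard
        refine hcard.trans ?_
        have hg : (Int.gcd (a * β - 6 * γ) (8 * β) : ℝ) ≤ 8 * Int.gcd β (a * β - 6 * γ) := by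
          have hpos : 0 < Int.gcd β (a * β - 6 * γ) := Int.gcd_pos_of_ne_zero_left _ hβ0
          rw [Int.gcd_comm β] at hpos ⊢
          exact_mod_cast gcd_mul_le _ _ 8 (by norm_num) hpos
        calc _ ≤ 1 + 2 * (2 * N) * (8 * Int.gcd β (a * β - 6 * γ)) /
              |((a * β - 6 * γ : ℤ) : ℝ)| := by gcongr
          _ = _ := by ring
  have hsumF : ∀ β ∈ R.erase 0, ∑ γ ∈ R, F β γ ≤ 74 * N * M ^ 2 := by
    intro β hβ
    rw [Finset.mem_erase, hR, Finset.mem_Icc, ← abs_le] at hβ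
    obtain ⟨hβ0, hβ⟩ := hβ
    have h1 : ∑ γ ∈ R, F β γ ≤ ∑ γ ∈ R, (1 + (if a * β - 6 * γ = 0 then (4 * N : ℝ) else 0) +
        if a * β - 6 * γ ≠ 0 then 32 * N * ((Int.gcd β (a * β - 6 * γ) : ℝ) /
          |((a * β - 6 * γ : ℤ) : ℝ)|) else 0) := by
      refine Finset.sum_le_sum fun γ _ => ?_
      simp only [hF]
      split_ifs <;> simp_all
    refine h1.trans ?_
    rw [Finset.sum_add_distrib, Finset.sum_add_distrib]
    have h2 : ∑ γ ∈ R, (1 : ℝ) = 4 * N + 1 := by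
      rw [Finset.sum_const, hR, Int.card_Icc, nsmul_eq_mul, mul_one]
      have : (((2 * N : ℕ) : ℤ) + 1 - -((2 * N : ℕ) : ℤ)).toNat = 4 * N + 1 := by omega
      rw [this]; push_cast; ring
    have h3 : ∑ γ ∈ R, (if a * β - 6 * γ = 0 then (4 * N : ℝ) else 0) ≤ 4 * N := by
      rw [← Finset.sum_filter, Finset.sum_const, nsmul_eq_mul]
      have : (R.filter fun γ => a * β - 6 * γ = 0).card ≤ 1 := by
        refine Finset.card_le_one.2 fun x hx y hy => ?_
        have := (Finset.mem_filter.1 hx).2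
        have := (Finset.mem_filter.1 hy).2
        omega
      have : ((R.filter fun γ => a * β - 6 * γ = 0).card : ℝ) ≤ 1 := by exact_mod_cast this
      nlinarith
    have h4 : ∑ γ ∈ R, (if a * β - 6 * γ ≠ 0 then 32 * N * ((Int.gcd β (a * β - 6 * γ) : ℝ) /
          |((a * β - 6 * γ : ℤ) : ℝ)|) else 0) ≤ 32 * N * (2 * (M * M)) := by
      rw [← Finset.sum_filter, ← Finset.mul_sum]
      gcongr
      calc _ = ∑ n ∈ (R.filter fun γ => a * β - 6 * γ ≠ 0).image (fun γ => a * β - 6 * γ),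
            ((Int.gcd β n : ℝ) / |(n : ℝ)|) := by
            rw [Finset.sum_image]
            intro x _ y _ h
            simp only at h
            omega
        _ ≤ ∑ n ∈ (Finset.Icc (-((14 * N ^ 2 : ℕ) : ℤ)) ((14 * N ^ 2 : ℕ) : ℤ)).erase 0,
            ((Int.gcd β n : ℝ) / |(n : ℝ)|) := by
            refine Finset.sum_le_sum_of_subset_of_nonneg ?_ (fun _ _ _ => by positivity)
            intro n hn
            obtain ⟨γ, hγ, rfl⟩ := Finset.mem_image.1 hn
            obtain ⟨hγ, hne⟩ := Finset.mem_filter.1 hγ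
            rw [hR, Finset.mem_Icc, ← abs_le] at hγ
            rw [Finset.mem_erase, Finset.mem_Icc, ← abs_le]
            refine ⟨hne, ?_⟩
            push_cast at hγ hβ ⊢
            calc |a * β - 6 * γ| ≤ |a * β| + |6 * γ| := abs_sub _ _
              _ = |a| * |β| + 6 * |γ| := by rw [abs_mul, abs_mul]; norm_num
              _ ≤ N * (2 * N) + 6 * (2 * N) := by gcongr
              _ ≤ 14 * N ^ 2 := by
                have : (1 : ℤ) ≤ N := by exact_mod_cast hN
                nlinarith
        _ ≤ _ := sum_int_gcd_div_le hβ0 _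
        _ ≤ _ := by
            gcongr
            refine hd _ (by omega) (by rw [abs_le] at hβ; omega)
    rw [h2]
    have : (1 : ℝ) ≤ M ^ 2 := one_le_pow₀ hM1
    nlinarith
  have hmain := card_le_sum_of_fibers P (fun p => (p.2.1 - p.1.1, p.2.2.1 - p.1.2.1))
    (R.erase 0 ×ˢ R) (by
      intro p hp
      obtain ⟨h1, h2, -⟩ := hP1 p hp
      obtain ⟨h3, h4, -⟩ := hP2 p hp
      have := hb p hp
      simp only [Finset.mem_product, Finset.mem_erase, hR, Finset.mem_Icc]
      rw [abs_le] at *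
      omega) (fun x => 50 * N * (1 / (x.1.natAbs : ℝ)) * F x.1 x.2) (by
      intro x hx
      rw [Finset.mem_product] at hx
      exact hfib x.1 hx.1 x.2 hx.2)
  refine hmain.trans ?_
  rw [Finset.sum_product]
  calc _ = ∑ β ∈ R.erase 0, 50 * N * (1 / (β.natAbs : ℝ)) * ∑ γ ∈ R, F β γ := by
        refine Finset.sum_congr rfl fun β _ => ?_
        rw [Finset.mul_sum]
    _ ≤ ∑ β ∈ R.erase 0, 50 * N * (1 / (β.natAbs : ℝ)) * (74 * N * M ^ 2) := by
        refine Finset.sum_le_sum fun β hβ => ?_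
        have := hsumF β hβ
        gcongr
    _ = 3700 * N ^ 2 * M ^ 2 * ∑ β ∈ R.erase 0, (1 / (β.natAbs : ℝ)) := by
        rw [Finset.mul_sum]
        refine Finset.sum_congr rfl fun β _ => ?_
        ring
    _ ≤ 3700 * N ^ 2 * M ^ 2 * (2 * M) := by
        rw [hR, sum_int_eq_two_mul (fun n => 1 / (n : ℝ))]
        gcongr
        exact hmono _ (by nlinarith)
    _ = _ := by ring

/-- `M` bounds the number of divisors of every positive integer up to `Q`, and the corresponding
harmonic number. -/
def IsDivisorBound (Q M : ℕ) : Prop :=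
  (∀ n : ℕ, n ≠ 0 → n ≤ Q → n.divisors.card ≤ M) ∧ ∑ n ∈ Finset.Icc (1 : ℕ) Q, (1 / n : ℝ) ≤ M

theorem IsDivisorBound.mono {Q Q' M : ℕ} (h : IsDivisorBound Q M) (hQ : Q' ≤ Q) :
    IsDivisorBound Q' M :=
  ⟨fun n hn hn' => h.1 n hn (hn'.trans hQ),
    le_trans (Finset.sum_le_sum_of_subset_of_nonneg (Finset.Icc_subset_Icc_right hQ)
      (fun _ _ _ => by positivity)) h.2⟩

theorem IsDivisorBound.one_le {Q M : ℕ} (h : IsDivisorBound Q M) (hQ : 1 ≤ Q) : 1 ≤ M := by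
  simpa using h.1 1 one_ne_zero hQ

theorem abs_quarticI_le {a b c d : ℤ} {N : ℕ} (hN : 1 ≤ N) (ha : |a| ≤ N) (hb : |b| ≤ N)
    (hc : |c| ≤ N) (hd : |d| ≤ N) : |quarticI a b c d| ≤ (16 * N ^ 2 : ℕ) := by
  have hN' : (1 : ℤ) ≤ N := by exact_mod_cast hN
  have h1 : |a * c| ≤ N * N := by rw [abs_mul]; gcongr
  have h2 : |b * b| ≤ N * N := by rw [abs_mul]; gcongr
  unfold quarticI
  push_cast
  rw [abs_le] at *
  constructor <;> nlinarith

theorem card_invariants_image_le (N M : ℕ) (hN : 1 ≤ N)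
    (hM : IsDivisorBound (20000 * N ^ 6) M) (S : Finset (ℤ × ℤ × ℤ × ℤ))
    (hS : ∀ s ∈ S, |s.1| ≤ N ∧ |s.2.1| ≤ N ∧ |s.2.2.1| ≤ N ∧ |s.2.2.2| ≤ N)
    (hsq : ∀ s ∈ S, ∃ y : ℤ, 4 * quarticI s.1 s.2.1 s.2.2.1 s.2.2.2 ^ 3 =
      quarticJ s.1 s.2.1 s.2.2.1 s.2.2.2 ^ 2 + 27 * y ^ 2) :
    (S.image fun s => (quarticI s.1 s.2.1 s.2.2.1 s.2.2.2,
      quarticJ s.1 s.2.1 s.2.2.1 s.2.2.2)).card ≤ 400 * N ^ 2 * M ^ 2 := by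
  have h := card_invariants_le (16 * N ^ 2) M (fun n hn hn' => hM.1 n hn (hn'.trans (by ring_nf; omega)))
    (S.image fun s => (quarticI s.1 s.2.1 s.2.2.1 s.2.2.2,
      quarticJ s.1 s.2.1 s.2.2.1 s.2.2.2)) (by
      intro p hp
      obtain ⟨s, hs, rfl⟩ := Finset.mem_image.1 hp
      obtain ⟨ha, hb, hc, hd⟩ := hS s hs
      exact ⟨abs_quarticI_le hN ha hb hc hd, hsq s hs⟩)
  refine h.trans ?_
  have hM1 : 1 ≤ M ^ 2 := one_le_pow₀ (hM.one_le (by nlinarith [Nat.one_le_pow 6 N hN]))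
  have hN1 : 1 ≤ N ^ 2 := one_le_pow₀ hN
  nlinarith [Nat.mul_le_mul hN1 hM1]

theorem card_fixed_cubic_coeff_le (N M : ℕ) (hN : 1 ≤ N) (hM : IsDivisorBound (20000 * N ^ 6) M)
    (a : ℤ) (ha : |a| ≤ N) (S : Finset (ℤ × ℤ × ℤ))
    (hS : ∀ s ∈ S, |s.1| ≤ N ∧ |s.2.1| ≤ N ∧ |s.2.2| ≤ N)
    (hsq : ∀ s ∈ S, ∃ y : ℤ, 4 * quarticI a s.1 s.2.1 s.2.2 ^ 3 =
      quarticJ a s.1 s.2.1 s.2.2 ^ 2 + 27 * y ^ 2) :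
    (S.card : ℝ) ≤ 8200 * N ^ 2 * M ^ 3 := by
  have hN6 : N ^ 2 ≤ N ^ 6 := Nat.pow_le_pow_right hN (by norm_num)
  have hN62 : N ≤ N ^ 6 := Nat.le_self_pow (by norm_num) _
  have hM1 : 1 ≤ M := hM.one_le (by nlinarith)
  have h := card_le_card_image_add_card_pairs S (fun s => ((quarticI a s.1 s.2.1 s.2.2,
      quarticJ a s.1 s.2.1 s.2.2), decide (0 ≤ a ^ 3 - 4 * a * s.1 + 8 * s.2.1)))
  have h1 : (S.image fun s => ((quarticI a s.1 s.2.1 s.2.2,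
      quarticJ a s.1 s.2.1 s.2.2), decide (0 ≤ a ^ 3 - 4 * a * s.1 + 8 * s.2.1))).card ≤
      400 * N ^ 2 * M ^ 2 * 2 := by
    have h2 := card_invariants_image_le N M hN hM (S.image fun s => (a, s)) (by
      intro s hs
      obtain ⟨t, ht, rfl⟩ := Finset.mem_image.1 hs
      exact ⟨ha, hS t ht⟩) (by
      intro s hs
      obtain ⟨t, ht, rfl⟩ := Finset.mem_image.1 hs
      exact hsq t ht)
    rw [Finset.image_image] at h2
    refine le_trans (Finset.card_le_card (t := ((S.image fun s => (quarticI a s.1 s.2.1 s.2.2,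
      quarticJ a s.1 s.2.1 s.2.2)) ×ˢ (Finset.univ : Finset Bool))) ?_) ?_
    · intro x hx
      obtain ⟨t, ht, rfl⟩ := Finset.mem_image.1 hx
      exact Finset.mem_product.2 ⟨Finset.mem_image_of_mem _ ht, Finset.mem_univ _⟩
    · rw [Finset.card_product]
      exact Nat.mul_le_mul h2 le_rfl
  have h2 := card_samePairs_le N hN a ha M (hM.mono (by nlinarith)).2
    (fun n hn hn' => by exact_mod_cast hM.1 n hn (by nlinarith))
    ((S ×ˢ S).filter fun p => p.1 ≠ p.2 ∧ ((quarticI a p.1.1 p.1.2.1 p.1.2.2,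
      quarticJ a p.1.1 p.1.2.1 p.1.2.2), decide (0 ≤ a ^ 3 - 4 * a * p.1.1 + 8 * p.1.2.1)) =
      ((quarticI a p.2.1 p.2.2.1 p.2.2.2,
      quarticJ a p.2.1 p.2.2.1 p.2.2.2), decide (0 ≤ a ^ 3 - 4 * a * p.2.1 + 8 * p.2.2.1)))
    (fun p hp => hS _ (Finset.mem_product.1 (Finset.mem_filter.1 hp).1).1)
    (fun p hp => hS _ (Finset.mem_product.1 (Finset.mem_filter.1 hp).1).2)
    (by
      intro p hp hb
      obtain ⟨-, hne, hl⟩ := Finset.mem_filter.1 hp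
      simp only [Prod.mk.injEq, decide_eq_decide] at hl
      obtain ⟨⟨hI, hJ⟩, hs⟩ := hl
      apply hne
      unfold quarticI at hI
      unfold quarticJ at hJ
      rw [hb] at hI hJ hs
      have hq : (a ^ 3 - 4 * a * p.2.1 + 8 * p.1.2.1) ^ 2 =
          (a ^ 3 - 4 * a * p.2.1 + 8 * p.2.2.1) ^ 2 := by
        have : 27 * (a ^ 3 - 4 * a * p.2.1 + 8 * p.1.2.1) ^ 2 =
          27 * (a ^ 3 - 4 * a * p.2.1 + 8 * p.2.2.1) ^ 2 := by
          linear_combination (-48 * (3 * a ^ 2 - 8 * p.2.1)) * hI - 64 * hJ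
        linarith
      have hc : p.1.2.1 = p.2.2.1 := by
        rcases sq_eq_sq_iff_eq_or_eq_neg.1 hq with h | h <;> omega
      rw [hc] at hI
      have hd : p.1.2.2 = p.2.2.2 := by linarith
      exact Prod.ext hb (Prod.ext hc hd))
    (fun p hp => by
      have := (Finset.mem_filter.1 hp).2.2
      simp only [Prod.mk.injEq] at this
      exact this.1.1)
    (fun p hp => by
      have := (Finset.mem_filter.1 hp).2.2
      simp only [Prod.mk.injEq] at this
      exact this.1.2)
  have h3 : (S.card : ℝ) ≤ 400 * N ^ 2 * M ^ 2 * 2 + 7400 * N ^ 2 * M ^ 3 := by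
    refine le_trans (Nat.cast_le.2 h) ?_
    rw [Nat.cast_add]
    exact add_le_add (by exact_mod_cast h1) h2
  have h4 : (M : ℝ) ^ 2 ≤ M ^ 3 := pow_le_pow_right₀ (by exact_mod_cast hM1) (by norm_num)
  nlinarith [sq_nonneg (N : ℝ)]

section

/-- The cubic form attached to the difference of two quartics with equal invariants. -/
def cubicForm (α β γ δ : ℤ) : ℤ := 9 * α * β * γ - 27 * α ^ 2 * δ - 2 * β ^ 3

/-- The linear relations between the difference `(α, β, γ, δ)` and the sum `(A, B, C, D)` of two
quartics with equal invariants. -/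
def IsDiffSum (α β γ δ A B C D : ℤ) : Prop :=
  3 * γ * A - 2 * β * B + 3 * α * C = 24 * δ ∧
    9 * ((3 * δ * A - β * C + 6 * α * D) * A - 24 * δ * B + 12 * γ * C - 16 * β * D) =
      cubicForm α β γ δ

theorem isDiffSum_of_invariants_eq {a₁ b₁ c₁ d₁ a₂ b₂ c₂ d₂ : ℤ}
    (hI : quarticI a₁ b₁ c₁ d₁ = quarticI a₂ b₂ c₂ d₂)
    (hJ : quarticJ a₁ b₁ c₁ d₁ = quarticJ a₂ b₂ c₂ d₂) :
    IsDiffSum (a₂ - a₁) (b₂ - b₁) (c₂ - c₁) (d₂ - d₁) (a₁ + a₂) (b₁ + b₂) (c₁ + c₂) (d₁ + d₂) := by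
  unfold IsDiffSum cubicForm
  unfold quarticI at hI
  unfold quarticJ at hJ
  constructor
  · linear_combination 2 * hI
  · linear_combination 6 * (b₁ + b₂) * hI + 4 * hJ

theorem resolvent_identity_of_cubicForm_eq_zero {α β γ δ A B C D x : ℚ} (hα : α ≠ 0)
    (hD : 6 * α * A - 16 * β ≠ 0)
    (h1 : 3 * γ * A - 2 * β * B + 3 * α * C = 24 * δ)
    (h2 : (3 * δ * A - β * C + 6 * α * D) * A - 24 * δ * B + 12 * γ * C - 16 * β * D = 0)
    (h3 : 9 * α * β * γ - 27 * α ^ 2 * δ - 2 * β ^ 3 = 0)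
    (hx : 9 * α ^ 2 * x = 16 * β ^ 2 - 72 * α * γ + 6 * α * β * A) :
    (x ^ 2 - 4 * (8 * D)) * (A ^ 2 - 4 * (2 * B) + 4 * x) = (A * x - 2 * (4 * C)) ^ 2 := by
  have e1 : δ = (9 * α * β * γ - 2 * β ^ 3) / (27 * α ^ 2) := by
    rw [eq_div_iff (by positivity)]; linarith
  have e2 : C = (24 * δ - 3 * γ * A + 2 * β * B) / (3 * α) := by
    rw [eq_div_iff (by positivity)]; linarith
  have e4 : x = (16 * β ^ 2 - 72 * α * γ + 6 * α * β * A) / (9 * α ^ 2) := by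
    rw [eq_div_iff (by positivity)]; linarith
  have h5 : 3 * α * (A * x - 8 * C) = 2 * β * (A ^ 2 - 8 * B + 4 * x) := by
    rw [e4, e2, e1]
    field_simp
    ring
  have h6 : 3 * α * (x ^ 2 - 32 * D) = 2 * β * (A * x - 8 * C) := by
    have h7 : 3 * α * (6 * α * A - 16 * β) * x ^ 2 -
        96 * α * (24 * δ * B - 12 * γ * C - (3 * δ * A - β * C) * A) =
        2 * β * (6 * α * A - 16 * β) * (A * x - 8 * C) := by
      rw [e4, e2, e1]
      field_simp
      ring
    apply mul_left_cancel₀ hD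
    linear_combination h7 - 96 * α * h2
  have hα' : 9 * α ^ 2 ≠ 0 := by positivity
  apply mul_left_cancel₀ hα'
  linear_combination 3 * α * (A ^ 2 - 8 * B + 4 * x) * h6 - 3 * α * (A * x - 8 * C) * h5

theorem diffSum_bounds_real {p q r s a b c d l n j : ℝ} (hp0 : 0 ≤ p) (hq0 : 0 ≤ q) (hr0 : 0 ≤ r)
    (hs0 : 0 ≤ s) (hl : 1 ≤ l) (hn : 1 ≤ n) (hpl : p ≤ l) (hql : q ≤ l) (hb0 : 0 ≤ b)
    (hc0 : 0 ≤ c) (hd0 : 0 ≤ d) (ha : 96 ≤ a)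
    (han : a ≤ 2 * n) (hbn : b ≤ 2 * n) (hcn : c ≤ 2 * n) (hdn : d ≤ 2 * n)
    (hnl : n ≤ l ^ 2) (hla : 152 * l ^ 2 ≤ a ^ 2)
    (h1 : 3 * r * a ≤ 2 * q * b + 3 * p * c + 24 * s)
    (hj : j ≤ 9 * p * q * r + 27 * p ^ 2 * s + 2 * q ^ 3)
    (h2 : 27 * s * a ^ 2 ≤ 9 * (q * c * a + 6 * p * d * a + 24 * s * b + 12 * r * c + 16 * q * d) + j) :
    s * a ≤ 6 * l * n ∧ r * a ≤ 6 * l * n := by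
  have g1 : 3 * r * a ≤ 10 * l * n + 24 * s := by
    have e1 : q * b ≤ l * (2 * n) := by gcongr
    have e2 : p * c ≤ l * (2 * n) := by gcongr
    linarith
  have gj : j ≤ 9 * l ^ 2 * r + 27 * l ^ 2 * s + 2 * l ^ 2 * l := by
    have e1 : p * q * r ≤ l * l * r := by gcongr
    have e2 : p ^ 2 * s ≤ l ^ 2 * s := by gcongr
    have e3 : q ^ 3 ≤ l ^ 3 := by gcongr
    nlinarith
  have g2 : 27 * s * a ^ 2 ≤ 126 * l * n * a + 459 * l ^ 2 * s + 225 * l ^ 2 * r + 288 * l * n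
      + 2 * l ^ 2 * l := by
    have e1 : q * c * a ≤ l * (2 * n) * a := by gcongr
    have e2 : p * d * a ≤ l * (2 * n) * a := by gcongr
    have e3 : s * b ≤ s * (2 * l ^ 2) := by gcongr; linarith
    have e4 : r * c ≤ r * (2 * l ^ 2) := by gcongr; linarith
    have e5 : q * d ≤ l * (2 * n) := by gcongr
    linarith
  have hln : 0 < l * n := by positivity
  have g3 : 27 * s * a ^ 2 * a ≤ (126 * l * n * a + 459 * l ^ 2 * s + 288 * l * n
      + 2 * l ^ 2 * l) * a + 75 * l ^ 2 * (10 * l * n + 24 * s) := by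
    calc 27 * s * a ^ 2 * a ≤ (126 * l * n * a + 459 * l ^ 2 * s + 225 * l ^ 2 * r + 288 * l * n
      + 2 * l ^ 2 * l) * a := by gcongr
      _ = (126 * l * n * a + 459 * l ^ 2 * s + 288 * l * n + 2 * l ^ 2 * l) * a +
        75 * l ^ 2 * (3 * r * a) := by ring
      _ ≤ _ := by gcongr
  have f1 : l ^ 2 * s * a ≤ a ^ 2 / 152 * s * a := by gcongr; linarith
  have f2 : l ^ 2 * s ≤ s * a ^ 2 * a / 14592 := by
    have : l ^ 2 * s * 96 ≤ l ^ 2 * s * a := by gcongr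
    nlinarith
  have f3 : l * n * a ≤ l * n * a ^ 2 / 96 := by
    have : l * n * a * 96 ≤ l * n * a * a := by gcongr
    nlinarith
  have f4 : l ^ 2 * l * a ≤ l * n * a ^ 2 / 76 := by
    have : l ^ 2 * (l * a) ≤ a ^ 2 / 152 * (l * (2 * n)) := by
      gcongr
      linarith
    nlinarith
  have f5 : l ^ 2 * (l * n) ≤ a ^ 2 / 152 * (l * n) := by gcongr; linarith
  have ha2 : 0 < a ^ 2 := by positivity
  have g4 : s * a * a ^ 2 ≤ 6 * l * n * a ^ 2 := by nlinarith
  have g5 : s * a ≤ 6 * l * n := le_of_mul_le_mul_right g4 ha2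
  refine ⟨g5, ?_⟩
  nlinarith

/-- The pair consisting of the difference and the sum of two distinct quartics of height at most
`N` whose leading coefficients are close and whose cubic coefficient is large. -/
structure IsClosePair (N L A₀ : ℕ) (p : (ℤ × ℤ × ℤ × ℤ) × (ℤ × ℤ × ℤ × ℤ)) : Prop where
  ne_zero : p.1 ≠ 0
  α_le : |p.1.1| ≤ L
  β_le : |p.1.2.1| ≤ L
  le_A : 2 * A₀ ≤ |p.2.1|
  A_le : |p.2.1| ≤ 2 * N
  B_le : |p.2.2.1| ≤ 2 * N
  C_le : |p.2.2.2.1| ≤ 2 * N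
  D_le : |p.2.2.2.2| ≤ 2 * N
  isDiffSum : IsDiffSum p.1.1 p.1.2.1 p.1.2.2.1 p.1.2.2.2 p.2.1 p.2.2.1 p.2.2.2.1 p.2.2.2.2

/-- The admissible ranges of the parameters. -/
structure IsRange (N L A₀ L₁ S : ℕ) : Prop where
  one_le : 1 ≤ L
  N_le : N ≤ L ^ 2
  le_A : 48 ≤ A₀
  L_le : 38 * L ^ 2 ≤ A₀ ^ 2
  A_le : A₀ ≤ N
  L₁_le : 3 * L * N ≤ L₁ * A₀
  S_le : 55 * L ^ 2 * L₁ ≤ S * A₀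

variable {N L A₀ L₁ S : ℕ} {p : (ℤ × ℤ × ℤ × ℤ) × (ℤ × ℤ × ℤ × ℤ)}

theorem abs_cubicForm_le (α β γ δ : ℤ) :
    |cubicForm α β γ δ| ≤ 9 * |α| * |β| * |γ| + 27 * |α| ^ 2 * |δ| + 2 * |β| ^ 3 := by
  unfold cubicForm
  calc _ ≤ |9 * α * β * γ| + |27 * α ^ 2 * δ| + |2 * β ^ 3| :=
        (abs_sub _ _).trans (add_le_add (abs_sub _ _) le_rfl)
    _ = _ := by simp only [abs_mul, abs_pow]; norm_num

theorem IsClosePair.bounds (h : IsClosePair N L A₀ p) (hR : IsRange N L A₀ L₁ S) :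
    |p.1.2.2.1| ≤ L₁ ∧ |p.1.2.2.2| ≤ L₁ := by
  obtain ⟨⟨α, β, γ, δ⟩, A, B, C, D⟩ := p
  obtain ⟨-, h1, h2, h3, h4, h5, h6, h7, h8, h9⟩ := h
  obtain ⟨r1, r2, r3, r4, r5, r6, r7⟩ := hR
  simp only at *
  have hN : 1 ≤ N := by omega
  have e1 : 3 * |γ| * |A| ≤ 2 * |β| * |B| + 3 * |α| * |C| + 24 * |δ| := by
    have : |3 * γ * A| = |2 * β * B + -(3 * α * C) + 24 * δ| := by congr 1; linarith
    have h10 := abs_add_three (2 * β * B) (-(3 * α * C)) (24 * δ)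
    rw [← this, abs_neg] at h10
    simp only [abs_mul] at h10
    norm_num at h10
    linarith
  have e2 : 27 * |δ| * |A| ^ 2 ≤ 9 * (|β| * |C| * |A| + 6 * |α| * |D| * |A| + 24 * |δ| * |B| +
      12 * |γ| * |C| + 16 * |β| * |D|) + |cubicForm α β γ δ| := by
    have : |27 * δ * A ^ 2| = |9 * (β * C * A + -(6 * α * D * A) + 24 * δ * B + -(12 * γ * C) +
      16 * β * D) + cubicForm α β γ δ| := by congr 1; linarith
    calc _ = |27 * δ * A ^ 2| := by simp only [abs_mul, abs_pow]; norm_num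
      _ = _ := this
      _ ≤ 9 * (|β * C * A| + |-(6 * α * D * A)| + |24 * δ * B| + |-(12 * γ * C)| +
          |16 * β * D|) + |cubicForm α β γ δ| := by
        refine (abs_add_le _ _).trans (add_le_add ?_ le_rfl)
        rw [abs_mul]
        have h9 : |(9 : ℤ)| = 9 := rfl
        rw [h9]
        gcongr
        exact (abs_add_le _ _).trans (add_le_add ((abs_add_le _ _).trans
          (add_le_add (abs_add_three _ _ _) le_rfl)) le_rfl)
      _ = _ := by simp only [abs_mul, abs_neg]; norm_num
  have r4' : 152 * (L : ℝ) ^ 2 ≤ (|A| : ℤ) ^ 2 := by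
    have : (2 * A₀ : ℝ) ≤ (|A| : ℤ) := by exact_mod_cast h3
    have h11 : (2 * A₀ : ℝ) ^ 2 ≤ ((|A| : ℤ) : ℝ) ^ 2 := by gcongr
    have h12 : (38 * L ^ 2 : ℝ) ≤ A₀ ^ 2 := by exact_mod_cast r4
    linarith
  have key := diffSum_bounds_real (p := (|α| : ℤ)) (q := (|β| : ℤ)) (r := (|γ| : ℤ))
    (s := (|δ| : ℤ)) (a := (|A| : ℤ)) (b := (|B| : ℤ)) (c := (|C| : ℤ)) (d := (|D| : ℤ))
    (l := L) (n := N) (j := (|cubicForm α β γ δ| : ℤ))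
    (by positivity) (by positivity) (by positivity) (by positivity) (by exact_mod_cast r1)
    (by exact_mod_cast hN) (by exact_mod_cast h1) (by exact_mod_cast h2) (by positivity)
    (by positivity) (by positivity)
    (by
      have : (96 : ℤ) ≤ |A| := by omega
      exact_mod_cast this)
    (by exact_mod_cast h4) (by exact_mod_cast h5) (by exact_mod_cast h6) (by exact_mod_cast h7)
    (by exact_mod_cast r2) r4' (by exact_mod_cast e1)
    (by exact_mod_cast abs_cubicForm_le α β γ δ) (by exact_mod_cast e2)
  have k1 : |δ| * |A| ≤ 6 * L * N := by exact_mod_cast key.1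
  have k2 : |γ| * |A| ≤ 6 * L * N := by exact_mod_cast key.2
  have hA : 0 < |A| := by omega
  have r6' : (3 * L * N : ℤ) ≤ L₁ * A₀ := by exact_mod_cast r6
  have h13 : (L₁ : ℤ) * (2 * A₀) ≤ L₁ * |A| := by gcongr
  exact ⟨le_of_mul_le_mul_right (by linarith) hA, le_of_mul_le_mul_right (by linarith) hA⟩

theorem IsRange.L_le_L₁ (hR : IsRange N L A₀ L₁ S) : L ≤ L₁ := by
  obtain ⟨r1, r2, r3, r4, r5, r6, r7⟩ := hR
  have : L * A₀ ≤ L₁ * A₀ := by nlinarith [Nat.mul_le_mul_left L r5]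
  exact Nat.le_of_mul_le_mul_right this (by omega)

theorem IsClosePair.abs_cubicForm_le (h : IsClosePair N L A₀ p) (hR : IsRange N L A₀ L₁ S) :
    |cubicForm p.1.1 p.1.2.1 p.1.2.2.1 p.1.2.2.2| ≤ 38 * L ^ 2 * L₁ := by
  obtain ⟨h1, h2⟩ := h.bounds hR
  have h3 := h.α_le
  have h4 := h.β_le
  have h5 : (L : ℤ) ≤ L₁ := by exact_mod_cast hR.L_le_L₁
  calc _ ≤ _ := _root_.abs_cubicForm_le _ _ _ _
    _ ≤ 9 * (L : ℤ) * L * L₁ + 27 * (L : ℤ) ^ 2 * L₁ + 2 * ((L : ℤ) ^ 2 * L₁) := by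
      have e : |p.1.2.1| ^ 3 ≤ (L : ℤ) ^ 2 * L₁ := by
        calc |p.1.2.1| ^ 3 = |p.1.2.1| ^ 2 * |p.1.2.1| := by ring
          _ ≤ _ := by gcongr; linarith
      gcongr
    _ = _ := by ring

theorem IsClosePair.sigma_le (h : IsClosePair N L A₀ p) (hR : IsRange N L A₀ L₁ S) :
    |3 * p.1.2.2.2 * p.2.1 - p.1.2.1 * p.2.2.2.1 + 6 * p.1.1 * p.2.2.2.2| ≤ S := by
  have hb := h.bounds hR
  have hJ := h.abs_cubicForm_le hR
  have hL := hR.L_le_L₁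
  obtain ⟨⟨α, β, γ, δ⟩, A, B, C, D⟩ := p
  obtain ⟨-, h1, h2, h3, h4, h5, h6, h7, h8, h9⟩ := h
  obtain ⟨r1, r2, r3, r4, r5, r6, r7⟩ := hR
  simp only at *
  set σ := 3 * δ * A - β * C + 6 * α * D with hσ
  obtain ⟨hγ, hδ⟩ := hb
  have e1 : 9 * (|σ| * |A|) ≤ 9 * (24 * |δ| * |B| + 12 * |γ| * |C| + 16 * |β| * |D|) +
      |cubicForm α β γ δ| := by
    calc _ = |9 * (σ * A)| := by simp only [abs_mul]; norm_num
      _ = |9 * (24 * δ * B + -(12 * γ * C) + 16 * β * D) + cubicForm α β γ δ| := by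
        congr 1; linarith
      _ ≤ 9 * (|24 * δ * B| + |-(12 * γ * C)| + |16 * β * D|) + |cubicForm α β γ δ| := by
        refine (abs_add_le _ _).trans (add_le_add ?_ le_rfl)
        rw [abs_mul]
        have h9 : |(9 : ℤ)| = 9 := rfl
        rw [h9]
        gcongr
        exact abs_add_three _ _ _
      _ = _ := by simp only [abs_mul, abs_neg]; norm_num
  have hN' : (N : ℤ) ≤ (L : ℤ) ^ 2 := by exact_mod_cast r2
  have hL' : (L : ℤ) ≤ L₁ := by exact_mod_cast hL
  have f1 : |δ| * |B| ≤ L₁ * (2 * (L : ℤ) ^ 2) := by gcongr; linarith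
  have f2 : |γ| * |C| ≤ L₁ * (2 * (L : ℤ) ^ 2) := by gcongr; linarith
  have f3 : |β| * |D| ≤ L₁ * (2 * (L : ℤ) ^ 2) := by
    have : |β| ≤ L₁ := by linarith
    gcongr
    linarith
  have r7' : (55 * L ^ 2 * L₁ : ℤ) ≤ S * A₀ := by exact_mod_cast r7
  have hA : 0 < |A| := by omega
  have h13 : (S : ℤ) * (2 * A₀) ≤ S * |A| := by gcongr
  have h14 : 0 ≤ (L₁ : ℤ) * (L : ℤ) ^ 2 := by positivity
  exact le_of_mul_le_mul_right (by linarith) hA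

theorem IsClosePair.not_degenerate (h : IsClosePair N L A₀ p) (hR : IsRange N L A₀ L₁ S) :
    p.2.1 ^ 3 - 8 * p.2.1 * p.2.2.1 + 32 * p.2.2.2.1 ≠ 0 := by
  intro h0
  obtain ⟨⟨α, β, γ, δ⟩, A, B, C, D⟩ := p
  obtain ⟨-, h1, h2, h3, h4, h5, h6, h7, h8, h9⟩ := h
  obtain ⟨r1, r2, r3, r4, r5, r6, r7⟩ := hR
  simp only at *
  have e1 : |A| ^ 3 ≤ 8 * |A| * |B| + 32 * |C| := by
    calc _ = |8 * A * B + -(32 * C)| := by rw [← abs_pow]; congr 1; linarith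
      _ ≤ _ := abs_add_le _ _
      _ = _ := by simp only [abs_mul, abs_neg]; norm_num
  have e2 : 8 * |A| * |B| + 32 * |C| ≤ 8 * |A| * (2 * N) + 32 * (2 * N) := by gcongr
  have hN' : (N : ℤ) ≤ (L : ℤ) ^ 2 := by exact_mod_cast r2
  have e3 : (2 * A₀ : ℤ) ^ 2 ≤ |A| ^ 2 := by gcongr
  have e4 : (38 * L ^ 2 : ℤ) ≤ (A₀ : ℤ) ^ 2 := by exact_mod_cast r4
  have e5 : 152 * (N : ℤ) * |A| ≤ |A| ^ 2 * |A| := by gcongr; linarith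
  have e6 : (N : ℤ) * 1 ≤ N * |A| := by gcongr; omega
  have e7 : (0 : ℤ) < N := by omega
  nlinarith

end

section

variable {N L A₀ L₁ S : ℕ} {p : (ℤ × ℤ × ℤ × ℤ) × (ℤ × ℤ × ℤ × ℤ)}

theorem IsClosePair.α_ne_zero (h : IsClosePair N L A₀ p) (hR : IsRange N L A₀ L₁ S)
    (h0 : cubicForm p.1.1 p.1.2.1 p.1.2.2.1 p.1.2.2.2 = 0) : p.1.1 ≠ 0 := by
  intro hα
  have hnd := h.not_degenerate hR
  have hAle := h.le_A
  have hA48 := hR.le_A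
  obtain ⟨h9, h10⟩ := h.isDiffSum
  have hne := h.ne_zero
  rw [h0] at h10
  unfold cubicForm at h0
  rw [hα] at h0 h9 h10
  have hβ : p.1.2.1 = 0 := by
    have : p.1.2.1 ^ 3 = 0 := by linarith
    exact pow_eq_zero_iff (by norm_num) |>.1 this
  rw [hβ] at h9 h10
  have hA : p.2.1 ≠ 0 := by
    intro hA
    rw [hA, abs_zero] at hAle
    omega
  have hδ : p.1.2.2.2 = 0 := by
    have : p.1.2.2.2 * (p.2.1 ^ 3 - 8 * p.2.1 * p.2.2.1 + 32 * p.2.2.2.1) = 0 := by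
      have : 27 * (p.1.2.2.2 * (p.2.1 ^ 3 - 8 * p.2.1 * p.2.2.1 + 32 * p.2.2.2.1)) = 0 := by
        linear_combination p.2.1 * h10 - 36 * p.2.2.2.1 * h9
      linarith
    exact (mul_eq_zero.1 this).resolve_right hnd
  rw [hδ] at h9
  have hγ : p.1.2.2.1 = 0 := by
    have : p.1.2.2.1 * p.2.1 = 0 := by linarith
    exact (mul_eq_zero.1 this).resolve_right hA
  exact hne (Prod.ext hα (Prod.ext hβ (Prod.ext hγ hδ)))

theorem IsClosePair.exists_resolvent_root (h : IsClosePair N L A₀ p) (hR : IsRange N L A₀ L₁ S)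
    (h0 : cubicForm p.1.1 p.1.2.1 p.1.2.2.1 p.1.2.2.2 = 0) :
    ∃ x : ℤ, 9 * p.1.1 ^ 2 * x =
      16 * p.1.2.1 ^ 2 - 72 * p.1.1 * p.1.2.2.1 + 6 * p.1.1 * p.1.2.1 * p.2.1 ∧
      IsResolventRoot (16 * N) (p.2.1, 2 * p.2.2.1, 4 * p.2.2.2.1, 8 * p.2.2.2.2, x) := by
  have hα := h.α_ne_zero hR h0
  obtain ⟨⟨α, β, γ, δ⟩, A, B, C, D⟩ := p
  obtain ⟨-, h1, h2, h3, h4, h5, h6, h7, h8, h9⟩ := h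
  obtain ⟨r1, r2, r3, r4, r5, r6, r7⟩ := hR
  simp only at *
  rw [h0] at h9
  unfold cubicForm at h0
  have hD : 6 * α * A - 16 * β ≠ 0 := by
    intro hD
    have e1 : |6 * α * A| = |16 * β| := by congr 1; linarith
    simp only [abs_mul] at e1
    norm_num at e1
    have e2 : 1 ≤ |α| := Int.one_le_abs hα
    have e3 : 1 * |A| ≤ |α| * |A| := by gcongr
    have e4 : (6 * L : ℤ) ≤ A₀ := by
      have : (6 * L) ^ 2 ≤ A₀ ^ 2 := by nlinarith [sq_nonneg L]
      exact_mod_cast (Nat.pow_le_pow_iff_left two_ne_zero).1 this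
    have e5 : (1 : ℤ) ≤ L := by exact_mod_cast r1
    nlinarith
  have hαq : (α : ℚ) ≠ 0 := by exact_mod_cast hα
  set x : ℚ := (16 * β ^ 2 - 72 * α * γ + 6 * α * β * A) / (9 * α ^ 2) with hx
  have hx' : 9 * (α : ℚ) ^ 2 * x = 16 * β ^ 2 - 72 * α * γ + 6 * α * β * A := by
    rw [hx]; field_simp
  have key := resolvent_identity_of_cubicForm_eq_zero (α := α) (β := β) (γ := γ) (δ := δ)
    (A := A) (B := B) (C := C) (D := D) (x := x) hαq (by exact_mod_cast hD)
    (by exact_mod_cast h8) (by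
      have : (3 * δ * A - β * C + 6 * α * D) * A - 24 * δ * B + 12 * γ * C - 16 * β * D = 0 := by
        linarith
      exact_mod_cast this) (by exact_mod_cast h0) hx'
  obtain ⟨z, hz⟩ := exists_int_of_cubic_root x (-(2 * B)) (A * (4 * C) - 4 * (8 * D))
    (-(A ^ 2 * (8 * D) - 4 * (2 * B) * (8 * D) + (4 * C) ^ 2)) (by
      push_cast; linear_combination key / 4)
  rw [← hz] at hx' key
  refine ⟨z, by exact_mod_cast hx', ?_⟩
  unfold IsResolventRoot
  simp only [abs_mul]
  push_cast
  refine ⟨by omega, ?_, ?_, ?_, by exact_mod_cast key⟩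
  · norm_num; omega
  · norm_num; omega
  · norm_num; omega

/-- Pairs of close quartics on which the cubic form vanishes come from quartics with reducible
resolvent cubic. -/
theorem card_cubicForm_eq_zero_le (hR : IsRange N L A₀ L₁ S) (M : ℝ)
    (hM : ∑ n ∈ Finset.Icc (1 : ℕ) (36 * (16 * N) ^ 2), (1 / n : ℝ) ≤ M)
    (P : Finset ((ℤ × ℤ × ℤ × ℤ) × (ℤ × ℤ × ℤ × ℤ))) (hP : ∀ p ∈ P, IsClosePair N L A₀ p)
    (h0 : ∀ p ∈ P, cubicForm p.1.1 p.1.2.1 p.1.2.2.1 p.1.2.2.2 = 0) :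
    (P.card : ℝ) ≤ (2 * L + 1) * (8704000 * N ^ 2 * M ^ 3) := by
  have hN : 1 ≤ 16 * N := by have := hR.le_A; have := hR.A_le; omega
  have hex : ∀ p ∈ P, ∃ x : ℤ, 9 * p.1.1 ^ 2 * x =
      16 * p.1.2.1 ^ 2 - 72 * p.1.1 * p.1.2.2.1 + 6 * p.1.1 * p.1.2.1 * p.2.1 ∧
      IsResolventRoot (16 * N) (p.2.1, 2 * p.2.2.1, 4 * p.2.2.2.1, 8 * p.2.2.2.2, x) :=
    fun p hp => (hP p hp).exists_resolvent_root hR (h0 p hp)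
  choose! x hx hroot using hex
  have h1 := card_le_sum_of_fibers P (fun p => p.1.1) (Finset.Icc (-(L : ℤ)) L)
    (fun p hp => Finset.mem_Icc.2 (abs_le.1 (hP p hp).α_le))
    (fun _ => 8704000 * N ^ 2 * M ^ 3) (by
      intro α hα
      have h2 := card_resolventRoot_le (16 * N) hN M hM ((P.filter fun p => p.1.1 = α).image
        fun p => (p.2.1, 2 * p.2.2.1, 4 * p.2.2.2.1, 8 * p.2.2.2.2, x p)) (by
          intro t ht
          obtain ⟨p, hp, rfl⟩ := Finset.mem_image.1 ht
          exact hroot p (Finset.mem_filter.1 hp).1)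
      rw [Finset.card_image_of_injOn] at h2
      · refine h2.trans (le_of_eq ?_)
        push_cast
        ring
      · intro p hp q hq hpq
        obtain ⟨hp, hpα⟩ := Finset.mem_filter.1 hp
        obtain ⟨hq, hqα⟩ := Finset.mem_filter.1 hq
        simp only [Prod.mk.injEq] at hpq
        obtain ⟨eA, eB, eC, eD, ex⟩ := hpq
        have eα : p.1.1 = q.1.1 := hpα.trans hqα.symm
        have eB' : p.2.2.1 = q.2.2.1 := by linarith
        have eC' : p.2.2.2.1 = q.2.2.2.1 := by linarith
        have eD' : p.2.2.2.2 = q.2.2.2.2 := by linarith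
        have hα0 := (hP p hp).α_ne_zero hR (h0 p hp)
        have hlin : ∀ r ∈ P, 3 * r.1.1 * (8 * r.2.2.2.1 - r.2.1 * x r) +
            2 * r.1.2.1 * (r.2.1 ^ 2 - 8 * r.2.2.1 + 4 * x r) = 0 := by
          intro r hr
          have hα1 := (hP r hr).α_ne_zero hR (h0 r hr)
          have e1 := h0 r hr
          have e2 := hx r hr
          have e3 := (hP r hr).isDiffSum.1
          unfold cubicForm at e1
          have : 9 * r.1.1 ^ 2 * (3 * r.1.1 * (8 * r.2.2.2.1 - r.2.1 * x r) +
            2 * r.1.2.1 * (r.2.1 ^ 2 - 8 * r.2.2.1 + 4 * x r)) = 0 := by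
            linear_combination 72 * r.1.1 ^ 2 * e3 - 64 * e1 +
              (8 * r.1.2.1 - 3 * r.1.1 * r.2.1) * e2
          exact (mul_eq_zero.1 this).resolve_left (by positivity)
        have hv : q.2.1 ^ 2 - 8 * q.2.2.1 + 4 * x q ≠ 0 := by
          intro hv
          have e1 := (hroot q hq).2.2.2.2
          simp only at e1
          have e2 : (q.2.1 * x q - 2 * (4 * q.2.2.2.1)) ^ 2 = 0 := by
            rw [← e1]; linear_combination (x q ^ 2 - 4 * (8 * q.2.2.2.2)) * hv
          have e3 := pow_eq_zero_iff (two_ne_zero) |>.1 e2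
          exact (hP q hq).not_degenerate hR (by linear_combination q.2.1 * hv - 4 * e3)
        have l1 := hlin p hp
        have l2 := hlin q hq
        rw [eα, eA, eB', eC', ex] at l1
        have eβ : p.1.2.1 = q.1.2.1 := mul_right_cancel₀ hv (by linarith)
        have x1 := hx p hp
        have x2 := hx q hq
        rw [ex, eβ, eA] at x1
        have eγ : p.1.2.2.1 = q.1.2.2.1 := by
          rw [eα] at x1 hα0
          refine mul_left_cancel₀ (mul_ne_zero (by norm_num : (72 : ℤ) ≠ 0) hα0) (by linarith)
        have d1 := (hP p hp).isDiffSum.1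
        have d2 := (hP q hq).isDiffSum.1
        rw [eα, eβ, eγ, eA, eB', eC'] at d1
        have eδ : p.1.2.2.2 = q.1.2.2.2 := by linarith
        exact Prod.ext (Prod.ext eα (Prod.ext eβ (Prod.ext eγ eδ)))
          (Prod.ext eA (Prod.ext eB' (Prod.ext eC' eD'))))
  rw [Finset.sum_const, Int.card_Icc, nsmul_eq_mul] at h1
  have h3 : ((L : ℤ) + 1 - -(L : ℤ)).toNat = 2 * L + 1 := by omega
  rw [h3] at h1
  exact_mod_cast h1

end

/-- A bound for the number of points of a box on the line `n x + m y = r`. -/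
noncomputable def lineBound (w c : ℝ) (m n : ℤ) : ℝ :=
  if n = 0 then w else 1 + c * (Int.gcd m n / |(n : ℝ)|)

theorem lineBound_nonneg {w c : ℝ} (hw : 0 ≤ w) (hc : 0 ≤ c) (m n : ℤ) :
    0 ≤ lineBound w c m n := by
  unfold lineBound
  split_ifs
  · exact hw
  · positivity

theorem card_le_lineBound {i j m n r : ℤ} (hi : i ≠ 0) (hj : j ≠ 0) (hm : m ≠ 0) {W Y : ℕ}
    (S : Finset (ℤ × ℤ))
    (hS : ∀ s ∈ S, i * n * s.1 + j * m * s.2 = r ∧ |s.1| ≤ W ∧ |s.2| ≤ Y) :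
    (S.card : ℝ) ≤ lineBound (2 * W + 1) (2 * |(j : ℝ)| * Y) m n := by
  unfold lineBound
  split_ifs with hn
  · have h1 : S.card ≤ (Finset.Icc (-(W : ℤ)) W).card := by
      refine Finset.card_le_card_of_injOn Prod.fst
        (fun s hs => Finset.mem_coe.2 (Finset.mem_Icc.2 (abs_le.1 (hS s hs).2.1))) ?_
      intro s hs t ht hst
      have e1 := (hS s hs).1
      have e2 := (hS t ht).1
      refine Prod.ext hst (mul_left_cancel₀ (mul_ne_zero hj hm) ?_)
      rw [hn] at e1 e2
      linarith
    rw [Int.card_Icc] at h1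
    have h2 : S.card ≤ 2 * W + 1 := by omega
    exact_mod_cast h2
  · refine (card_linear_le (i * n) (j * m) r (mul_ne_zero hi hn) Y (by positivity) S
      (fun s hs => ⟨(hS s hs).1, by exact_mod_cast (hS s hs).2.2⟩)).trans ?_
    have hg : Int.gcd (i * n) (j * m) ≤ i.natAbs * j.natAbs * Int.gcd m n := by
      refine Nat.le_of_dvd ?_ ?_
      · have := Int.gcd_pos_of_ne_zero_left n hm
        positivity
      · have h1 : Int.gcd (i * j * m) (i * j * n) = i.natAbs * j.natAbs * Int.gcd m n := by
          rw [Int.gcd_mul_left, Int.natAbs_mul]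
        rw [← h1]
        refine Int.dvd_gcd ?_ ?_
        · exact (Int.gcd_dvd_right _ _).trans ⟨i, by ring⟩
        · exact (Int.gcd_dvd_left _ _).trans ⟨j, by ring⟩
    have hg' : (Int.gcd (i * n) (j * m) : ℝ) ≤ |(i : ℝ)| * |(j : ℝ)| * Int.gcd m n := by
      calc (Int.gcd (i * n) (j * m) : ℝ) ≤ (i.natAbs * j.natAbs * Int.gcd m n : ℕ) := by
            exact_mod_cast hg
        _ = _ := by push_cast; simp only [Nat.cast_natAbs, Int.cast_abs]
    have hi' : 0 < |(i : ℝ)| := by positivity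
    have hn' : 0 < |(n : ℝ)| := by positivity
    push_cast
    rw [abs_mul]
    refine add_le_add le_rfl ?_
    rw [div_le_iff₀ (by positivity)]
    calc 2 * (Y : ℝ) * Int.gcd (i * n) (j * m)
        ≤ 2 * (Y : ℝ) * (|(i : ℝ)| * |(j : ℝ)| * Int.gcd m n) := by gcongr
      _ = _ := by field_simp

theorem sum_lineBound_le {Q M : ℕ} (hM : IsDivisorBound Q M) {w c : ℝ} (hc : 0 ≤ c) {m : ℤ}
    (hm : m ≠ 0) (hmQ : m.natAbs ≤ Q) {L : ℕ} (hL : L ≤ Q) :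
    ∑ n ∈ Finset.Icc (-(L : ℤ)) L, lineBound w c m n ≤ w + 2 * L + 2 * c * M ^ 2 := by
  have h0 : (0 : ℤ) ∈ Finset.Icc (-(L : ℤ)) L := by simp
  rw [← Finset.add_sum_erase _ _ h0]
  have h1 : ∑ n ∈ (Finset.Icc (-(L : ℤ)) L).erase 0, lineBound w c m n =
      ∑ n ∈ (Finset.Icc (-(L : ℤ)) L).erase 0, (1 + c * ((Int.gcd m n : ℝ) / |(n : ℝ)|)) := by
    refine Finset.sum_congr rfl fun n hn => ?_
    rw [lineBound, if_neg (Finset.mem_erase.1 hn).1]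
  rw [h1, Finset.sum_add_distrib, ← Finset.mul_sum, Finset.sum_const, Finset.card_erase_of_mem h0,
    Int.card_Icc, nsmul_eq_mul]
  have h2 : (L + 1 - -(L : ℤ)).toNat - 1 = 2 * L := by omega
  have h3 : lineBound w c m 0 = w := by rw [lineBound, if_pos rfl]
  have h4 := sum_int_gcd_div_le hm L
  have h5 : (m.natAbs.divisors.card : ℝ) ≤ M := by
    exact_mod_cast hM.1 _ (Int.natAbs_ne_zero.2 hm) hmQ
  have h6 := (hM.mono hL).2
  have h7 : (m.natAbs.divisors.card * ∑ n ∈ Finset.Icc (1 : ℕ) L, (1 / n : ℝ)) ≤ M * M := by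
    gcongr
  have h8 : ∑ n ∈ (Finset.Icc (-(L : ℤ)) L).erase 0, ((Int.gcd m n : ℝ) / |(n : ℝ)|) ≤
      2 * M ^ 2 := by linarith
  rw [h2, h3]
  push_cast
  have h9 := mul_le_mul_of_nonneg_left h8 hc
  linarith

/-- The data `(α, β, γ, δ)` of a difference together with a vector `u` in the kernel of the
associated linear relations. -/
structure IsStep (L L₁ : ℕ) (s : (ℤ × ℤ × ℤ × ℤ) × (ℤ × ℤ × ℤ × ℤ)) : Prop where
  α_le : |s.1.1| ≤ L
  β_le : |s.1.2.1| ≤ L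
  γ_le : |s.1.2.2.1| ≤ L₁
  δ_le : |s.1.2.2.2| ≤ L₁
  ne_zero : cubicForm s.1.1 s.1.2.1 s.1.2.2.1 s.1.2.2.2 ≠ 0
  pos : 0 < s.2.1
  eq_one : 2 * s.1.2.1 * s.2.2.1 = 3 * s.1.2.2.1 * s.2.1 + 3 * s.1.1 * s.2.2.2.1
  eq_two : s.1.2.1 * s.2.2.2.1 = 3 * s.1.2.2.2 * s.2.1 + 6 * s.1.1 * s.2.2.2.2
  dvd : s.2.1 ∣ 16 * cubicForm s.1.1 s.1.2.1 s.1.2.2.1 s.1.2.2.2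

/-- Count of the steps with short kernel vectors. -/
theorem card_step_small_le {L L₁ Q M U : ℕ} (hM : IsDivisorBound Q M) (hU : 1 ≤ U) (hUQ : U ≤ Q)
    (hLQ : L ≤ Q) (P : Finset ((ℤ × ℤ × ℤ × ℤ) × (ℤ × ℤ × ℤ × ℤ)))
    (hP : ∀ s ∈ P, IsStep L L₁ s ∧ |s.2.1| ≤ U ∧ |s.2.2.1| ≤ U ∧ |s.2.2.2.1| ≤ U ∧
      |s.2.2.2.2| ≤ U) :
    (P.card : ℝ) ≤ 3 * U ^ 2 * (3 * U + 2 * L + 12 * L₁ * M ^ 2) ^ 2 := by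
  set F : ℤ → ℤ → ℝ := lineBound (2 * U + 1) (6 * L₁) with hF
  have hF0 : ∀ m n, 0 ≤ F m n := fun m n =>
    lineBound_nonneg (by positivity) (by positivity) m n
  have h1 := card_le_sum_of_fibers P (fun s => ((s.2.1, s.2.2.2.1), (s.1.1, s.1.2.1)))
    ((Finset.Icc 1 (U : ℤ) ×ˢ Finset.Icc (-(U : ℤ)) U) ×ˢ
      (Finset.Icc (-(L : ℤ)) L ×ˢ Finset.Icc (-(L : ℤ)) L)) (by
        intro s hs
        obtain ⟨h, h1, h2, h3, h4⟩ := hP s hs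
        have := h.pos
        have a1 := h.α_le
        have a2 := h.β_le
        rw [abs_le] at h1 h3 a1 a2
        simp only [Finset.mem_product, Finset.mem_Icc]
        omega)
    (fun x => F x.1.1 x.2.1 * F x.1.1 x.2.2) (by
      rintro ⟨⟨u₁, u₃⟩, α, β⟩ hx
      simp only [Finset.mem_product, Finset.mem_Icc] at hx
      have hu : u₁ ≠ 0 := by omega
      set R := P.filter fun s => ((s.2.1, s.2.2.2.1), (s.1.1, s.1.2.1)) = ((u₁, u₃), α, β) with hR
      have hR' : ∀ s ∈ R, s ∈ P ∧ s.2.1 = u₁ ∧ s.2.2.2.1 = u₃ ∧ s.1.1 = α ∧ s.1.2.1 = β := by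
        intro s hs
        obtain ⟨hs1, hs2⟩ := Finset.mem_filter.1 hs
        simp only [Prod.mk.injEq] at hs2
        exact ⟨hs1, hs2.1.1, hs2.1.2, hs2.2.1, hs2.2.2⟩
      have c1 : ((R.image fun s => (s.2.2.2.2, s.1.2.2.2)).card : ℝ) ≤ F u₁ α := by
        have := card_le_lineBound (i := 6) (j := 3) (m := u₁) (n := α) (r := β * u₃)
          (by norm_num) (by norm_num) hu (W := U) (Y := L₁)
          (R.image fun s => (s.2.2.2.2, s.1.2.2.2)) (by
            intro t ht
            obtain ⟨s, hs, rfl⟩ := Finset.mem_image.1 ht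
            obtain ⟨hs, e1, e2, e3, e4⟩ := hR' s hs
            obtain ⟨h, h1, h2, h3, h4⟩ := hP s hs
            refine ⟨?_, h4, h.δ_le⟩
            rw [← e1, ← e2, ← e3, ← e4, h.eq_two]
            ring)
        norm_num at this
        exact this
      have c2 : ((R.image fun s => (s.2.2.1, s.1.2.2.1)).card : ℝ) ≤ F u₁ β := by
        have := card_le_lineBound (i := 2) (j := -3) (m := u₁) (n := β) (r := 3 * α * u₃)
          (by norm_num) (by norm_num) hu (W := U) (Y := L₁)
          (R.image fun s => (s.2.2.1, s.1.2.2.1)) (by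
            intro t ht
            obtain ⟨s, hs, rfl⟩ := Finset.mem_image.1 ht
            obtain ⟨hs, e1, e2, e3, e4⟩ := hR' s hs
            obtain ⟨h, h1, h2, h3, h4⟩ := hP s hs
            refine ⟨?_, h2, h.γ_le⟩
            rw [← e1, ← e2, ← e3, ← e4]
            simp only
            rw [h.eq_one]
            ring)
        norm_num at this
        exact this
      have c3 : R.card ≤ ((R.image fun s => (s.2.2.2.2, s.1.2.2.2)) ×ˢ
          (R.image fun s => (s.2.2.1, s.1.2.2.1))).card := by
        refine Finset.card_le_card_of_injOn
          (fun s => ((s.2.2.2.2, s.1.2.2.2), (s.2.2.1, s.1.2.2.1))) ?_ ?_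
        · intro s hs
          exact Finset.mem_coe.2 (Finset.mem_product.2
            ⟨Finset.mem_image_of_mem _ hs, Finset.mem_image_of_mem _ hs⟩)
        · intro s hs t ht hst
          obtain ⟨-, e1, e2, e3, e4⟩ := hR' s hs
          obtain ⟨-, f1, f2, f3, f4⟩ := hR' t ht
          simp only [Prod.mk.injEq] at hst
          simp only [Prod.ext_iff]
          obtain ⟨⟨g1, g2⟩, g3, g4⟩ := hst
          exact ⟨⟨by rw [e3, f3], by rw [e4, f4], g4, g2⟩, by rw [e1, f1], g3, by rw [e2, f2], g1⟩
      rw [Finset.card_product] at c3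
      calc (R.card : ℝ) ≤ ((_ * _ : ℕ) : ℝ) := Nat.cast_le.2 c3
        _ ≤ F u₁ α * F u₁ β := by
          push_cast
          exact mul_le_mul c1 c2 (by positivity) (hF0 _ _))
  refine h1.trans ?_
  rw [Finset.sum_product]
  set V : ℝ := 3 * U + 2 * L + 12 * L₁ * M ^ 2 with hV
  have hU' : (1 : ℝ) ≤ U := by exact_mod_cast hU
  have h2 : ∀ x ∈ Finset.Icc 1 (U : ℤ) ×ˢ Finset.Icc (-(U : ℤ)) U,
      ∑ y ∈ Finset.Icc (-(L : ℤ)) L ×ˢ Finset.Icc (-(L : ℤ)) L, F x.1 y.1 * F x.1 y.2 ≤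
        V ^ 2 := by
    intro x hx
    obtain ⟨hx, -⟩ := Finset.mem_product.1 hx
    rw [Finset.mem_Icc] at hx
    rw [Finset.sum_product, ← Finset.sum_mul_sum, ← pow_two]
    have h3 := sum_lineBound_le hM (w := 2 * U + 1) (c := 6 * L₁) (by positivity) (m := x.1)
      (by omega) (by omega) hLQ
    have h4 : ∑ n ∈ Finset.Icc (-(L : ℤ)) L, F x.1 n ≤ V := by
      refine h3.trans ?_
      rw [hV]
      linarith
    have h5 : 0 ≤ ∑ n ∈ Finset.Icc (-(L : ℤ)) L, F x.1 n := Finset.sum_nonneg fun n _ => hF0 _ _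
    gcongr
  refine (Finset.sum_le_sum h2).trans ?_
  rw [Finset.sum_const, Finset.card_product, Int.card_Icc, Int.card_Icc, nsmul_eq_mul]
  have h6 : ((U : ℤ) + 1 - 1).toNat = U := by omega
  have h7 : ((U : ℤ) + 1 - -(U : ℤ)).toNat = 2 * U + 1 := by omega
  rw [h6, h7]
  push_cast
  exact mul_le_mul_of_nonneg_right (by nlinarith) (by positivity)

theorem card_le_of_injOn_Icc {α : Type*} {R : Finset α} {Y : ℕ} (f : α → ℤ)
    (hf : ∀ s ∈ R, |f s| ≤ Y) (hinj : Set.InjOn f R) : (R.card : ℝ) ≤ 2 * Y + 1 := by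
  have h1 := Finset.card_le_card_of_injOn (t := Finset.Icc (-(Y : ℤ)) Y) f
    (fun s hs => Finset.mem_coe.2 (Finset.mem_Icc.2 (abs_le.1 (hf s hs)))) hinj
  rw [Int.card_Icc] at h1
  have h2 : R.card ≤ 2 * Y + 1 := by omega
  exact_mod_cast h2

theorem card_le_divisors {R : Finset ℤ} {m : ℤ} (hm : m ≠ 0) (hR : ∀ u ∈ R, 0 < u ∧ u ∣ m) :
    R.card ≤ m.natAbs.divisors.card := by
  refine Finset.card_le_card_of_injOn Int.natAbs ?_ ?_
  · intro u hu
    exact Finset.mem_coe.2 (Nat.mem_divisors.2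
      ⟨Int.natAbs_dvd_natAbs.2 (hR u hu).2, Int.natAbs_ne_zero.2 hm⟩)
  · intro u hu v hv huv
    have h1 := (hR u hu).1
    have h2 := (hR v hv).1
    omega

theorem card_kernel_le {L L₁ Y : ℕ} {α β γ δ u₁ : ℤ}
    (R : Finset ((ℤ × ℤ × ℤ × ℤ) × (ℤ × ℤ × ℤ × ℤ)))
    (hR : ∀ s ∈ R, s.1 = (α, β, γ, δ) ∧ s.2.1 = u₁ ∧ IsStep L L₁ s ∧ |s.2.2.1| ≤ Y ∧
      |s.2.2.2.1| ≤ Y ∧ |s.2.2.2.2| ≤ Y) :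
    (R.card : ℝ) ≤ if β = 0 then 2 * (Y : ℝ) + 1 else lineBound (2 * Y + 1) (4 * Y) β α := by
  have h1 : ∀ s ∈ R, 2 * β * s.2.2.1 = 3 * γ * u₁ + 3 * α * s.2.2.2.1 := by
    intro s hs
    obtain ⟨e1, e2, h, -⟩ := hR s hs
    simpa [e1, e2] using h.eq_one
  have h2 : ∀ s ∈ R, β * s.2.2.2.1 = 3 * δ * u₁ + 6 * α * s.2.2.2.2 := by
    intro s hs
    obtain ⟨e1, e2, h, -⟩ := hR s hs
    simpa [e1, e2] using h.eq_two
  have h3 : ∀ s ∈ R, ∀ t ∈ R, s.2.2.1 = t.2.2.1 → s.2.2.2.1 = t.2.2.2.1 →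
      s.2.2.2.2 = t.2.2.2.2 → s = t := by
    intro s hs t ht g1 g2 g3
    obtain ⟨e1, e2, -⟩ := hR s hs
    obtain ⟨f1, f2, -⟩ := hR t ht
    exact Prod.ext (e1.trans f1.symm) (Prod.ext (e2.trans f2.symm) (Prod.ext g1 (Prod.ext g2 g3)))
  rcases R.eq_empty_or_nonempty with rfl | ⟨r, hr⟩
  · have := lineBound_nonneg (w := 2 * (Y : ℝ) + 1) (c := 4 * Y) (by positivity) (by positivity) β α
    simp only [Finset.card_empty, Nat.cast_zero]
    split_ifs
    · positivity
    · exact this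
  have h0 : cubicForm α β γ δ ≠ 0 := by
    obtain ⟨e1, e2, h, -⟩ := hR r hr
    simpa [e1] using h.ne_zero
  split_ifs with hβ
  · have hα : α ≠ 0 := by
      rintro rfl
      exact h0 (by rw [hβ]; unfold cubicForm; ring)
    refine card_le_of_injOn_Icc (fun s => s.2.2.1) (fun s hs => (hR s hs).2.2.2.1) ?_
    intro s hs t ht hst
    have a1 := h1 s hs
    have a2 := h2 s hs
    have b1 := h1 t ht
    have b2 := h2 t ht
    rw [hβ] at a1 a2 b1 b2
    exact h3 s hs t ht hst (mul_left_cancel₀ hα (by linarith)) (mul_left_cancel₀ hα (by linarith))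
  · by_cases hα : α = 0
    · rw [lineBound, if_pos hα]
      refine card_le_of_injOn_Icc (fun s => s.2.2.2.2) (fun s hs => (hR s hs).2.2.2.2.2) ?_
      intro s hs t ht hst
      have a1 := h1 s hs
      have a2 := h2 s hs
      have b1 := h1 t ht
      have b2 := h2 t ht
      rw [hα] at a1 a2 b1 b2
      exact h3 s hs t ht (mul_left_cancel₀ hβ (by linarith)) (mul_left_cancel₀ hβ (by linarith))
        hst
    · have h4 := card_le_lineBound (i := -3) (j := 2) (m := β) (n := α) (r := 3 * γ * u₁)
        (by norm_num) (by norm_num) hβ (W := Y) (Y := Y)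
        (R.image fun s => (s.2.2.2.1, s.2.2.1)) (by
          intro t ht
          obtain ⟨s, hs, rfl⟩ := Finset.mem_image.1 ht
          refine ⟨?_, (hR s hs).2.2.2.2.1, (hR s hs).2.2.2.1⟩
          have := h1 s hs
          simp only
          linarith)
      rw [Finset.card_image_of_injOn] at h4
      · norm_num at h4
        exact h4
      · intro s hs t ht hst
        simp only [Prod.mk.injEq] at hst
        have a2 := h2 s hs
        have b2 := h2 t ht
        rw [hst.1] at a2
        exact h3 s hs t ht hst.2 hst.1 (mul_left_cancel₀ hα (by linarith))

/-- Count of the steps with arbitrary kernel vectors. -/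
theorem card_step_le {L L₁ Q M Y : ℕ} (hM : IsDivisorBound Q M) (hL : 1 ≤ L) (hLL₁ : L ≤ L₁)
    (hQ : 608 * L ^ 2 * L₁ ≤ Q) (P : Finset ((ℤ × ℤ × ℤ × ℤ) × (ℤ × ℤ × ℤ × ℤ)))
    (hP : ∀ s ∈ P, IsStep L L₁ s ∧ |s.2.2.1| ≤ Y ∧ |s.2.2.2.1| ≤ Y ∧ |s.2.2.2.2| ≤ Y) :
    (P.card : ℝ) ≤ 9 * L₁ ^ 2 * M * (9 * L ^ 2 + 26 * L * Y * M ^ 2) := by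
  set X : ℤ → ℤ → ℝ := fun α β =>
    if β = 0 then 2 * (Y : ℝ) + 1 else lineBound (2 * Y + 1) (4 * Y) β α with hX
  have hX0 : ∀ α β, 0 ≤ X α β := by
    intro α β
    simp only [hX]
    split_ifs
    · positivity
    · exact lineBound_nonneg (by positivity) (by positivity) _ _
  have hLQ : L ≤ Q := by
    have h0 : 1 ≤ L * L₁ := Nat.mul_pos hL (by omega)
    have : L * 1 ≤ L * (L * L₁) := Nat.mul_le_mul_left L h0
    nlinarith
  have hM1 : 1 ≤ M := hM.one_le (by omega)
  have h1 := card_le_sum_of_fibers P (fun s => ((s.1.2.2.1, s.1.2.2.2), (s.1.2.1, s.1.1)))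
    ((Finset.Icc (-(L₁ : ℤ)) L₁ ×ˢ Finset.Icc (-(L₁ : ℤ)) L₁) ×ˢ
      (Finset.Icc (-(L : ℤ)) L ×ˢ Finset.Icc (-(L : ℤ)) L)) (by
        intro s hs
        obtain ⟨h, -⟩ := hP s hs
        have a1 := h.α_le
        have a2 := h.β_le
        have a3 := h.γ_le
        have a4 := h.δ_le
        rw [abs_le] at a1 a2 a3 a4
        simp only [Finset.mem_product, Finset.mem_Icc]
        omega)
    (fun x => M * X x.2.2 x.2.1) (by
      rintro ⟨⟨γ, δ⟩, β, α⟩ hx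
      set R := P.filter fun s => ((s.1.2.2.1, s.1.2.2.2), (s.1.2.1, s.1.1)) = ((γ, δ), β, α)
      have hR' : ∀ s ∈ R, s ∈ P ∧ s.1 = (α, β, γ, δ) := by
        intro s hs
        obtain ⟨hs1, hs2⟩ := Finset.mem_filter.1 hs
        simp only [Prod.mk.injEq] at hs2
        exact ⟨hs1, Prod.ext hs2.2.2 (Prod.ext hs2.2.1 (Prod.ext hs2.1.1 hs2.1.2))⟩
      rcases R.eq_empty_or_nonempty with hRe | ⟨r, hr⟩
      · rw [hRe]
        have := hX0 α β
        simp only [Finset.card_empty, Nat.cast_zero]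
        positivity
      refine card_le_mul_of_fibers R (fun s => s.2.1) M (X α β) (hX0 _ _) ?_ ?_
      · have hm : 16 * cubicForm α β γ δ ≠ 0 := by
          have := (hP r (hR' r hr).1).1.ne_zero
          rw [(hR' r hr).2] at this
          simpa using this
        have h2 := card_le_divisors (R := R.image fun s => s.2.1) hm (by
          intro u hu
          obtain ⟨s, hs, rfl⟩ := Finset.mem_image.1 hu
          have h := (hP s (hR' s hs).1).1
          refine ⟨h.pos, ?_⟩
          have := h.dvd
          rw [(hR' s hs).2] at this
          exact this)
        have h3 : |cubicForm α β γ δ| ≤ 38 * L ^ 2 * L₁ := by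
          have h := (hP r (hR' r hr).1).1
          have h5 := h.α_le
          have h6 := h.β_le
          have h7 := h.γ_le
          have h8 := h.δ_le
          rw [(hR' r hr).2] at h5 h6 h7 h8
          simp only at h5 h6 h7 h8
          have h9 : (L : ℤ) ≤ L₁ := by exact_mod_cast hLL₁
          calc _ ≤ _ := abs_cubicForm_le _ _ _ _
            _ ≤ 9 * (L : ℤ) * L * L₁ + 27 * (L : ℤ) ^ 2 * L₁ + 2 * ((L : ℤ) ^ 2 * L₁) := by
              have e : |β| ^ 3 ≤ (L : ℤ) ^ 2 * L₁ := by
                calc |β| ^ 3 = |β| ^ 2 * |β| := by ring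
                  _ ≤ _ := by gcongr; linarith
              gcongr
            _ = _ := by ring
        have h4 : (16 * cubicForm α β γ δ).natAbs ≤ Q := by
          zify
          rw [abs_mul]
          have : (608 * L ^ 2 * L₁ : ℤ) ≤ Q := by exact_mod_cast hQ
          norm_num
          linarith
        exact_mod_cast h2.trans (hM.1 _ (Int.natAbs_ne_zero.2 hm) h4)
      · intro u hu
        refine card_kernel_le (L := L) (L₁ := L₁) (γ := γ) (δ := δ) (u₁ := u) _ ?_
        intro s hs
        obtain ⟨hs, hsu⟩ := Finset.mem_filter.1 hs
        exact ⟨(hR' s hs).2, hsu, hP s (hR' s hs).1⟩)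
  refine h1.trans ?_
  have hL' : (1 : ℝ) ≤ L := by exact_mod_cast hL
  have hM' : (1 : ℝ) ≤ M := by exact_mod_cast hM1
  have hL₁' : (1 : ℝ) ≤ L₁ := by exact_mod_cast hL.trans hLL₁
  have h2 : ∑ y ∈ Finset.Icc (-(L : ℤ)) L ×ˢ Finset.Icc (-(L : ℤ)) L, (M : ℝ) * X y.2 y.1 ≤
      M * (9 * L ^ 2 + 26 * L * Y * M ^ 2) := by
    rw [← Finset.mul_sum, Finset.sum_product]
    refine mul_le_mul_of_nonneg_left ?_ (by positivity)
    have h0 : (0 : ℤ) ∈ Finset.Icc (-(L : ℤ)) L := by simp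
    rw [← Finset.add_sum_erase _ _ h0]
    have h3 : ∑ α ∈ Finset.Icc (-(L : ℤ)) L, X α 0 = (2 * L + 1) * (2 * Y + 1) := by
      simp only [hX, if_true]
      rw [Finset.sum_const, Int.card_Icc, nsmul_eq_mul]
      have : (L + 1 - -(L : ℤ)).toNat = 2 * L + 1 := by omega
      rw [this]
      push_cast
      ring
    have h4 : ∑ β ∈ (Finset.Icc (-(L : ℤ)) L).erase 0, ∑ α ∈ Finset.Icc (-(L : ℤ)) L, X α β ≤
        2 * L * (2 * Y + 1 + 2 * L + 8 * Y * M ^ 2) := by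
      have h5 : ∀ β ∈ (Finset.Icc (-(L : ℤ)) L).erase 0, ∑ α ∈ Finset.Icc (-(L : ℤ)) L, X α β ≤
          2 * Y + 1 + 2 * L + 8 * Y * M ^ 2 := by
        intro β hβ
        obtain ⟨hβ0, hβ⟩ := Finset.mem_erase.1 hβ
        rw [Finset.mem_Icc] at hβ
        simp only [hX, if_neg hβ0]
        refine (sum_lineBound_le hM (by positivity) hβ0 (by omega) hLQ).trans (le_of_eq ?_)
        ring
      refine (Finset.sum_le_sum h5).trans (le_of_eq ?_)
      rw [Finset.sum_const, Finset.card_erase_of_mem h0, Int.card_Icc, nsmul_eq_mul]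
      have : (L + 1 - -(L : ℤ)).toNat - 1 = 2 * L := by omega
      rw [this]
      push_cast
      ring
    rw [h3]
    have hY : (0 : ℝ) ≤ Y := by positivity
    have e1 : (Y : ℝ) * 1 ≤ Y * L := by gcongr
    have e2 : (L : ℝ) * Y * 1 ≤ L * Y * M ^ 2 := by
      gcongr
      exact one_le_pow₀ hM'
    nlinarith
  rw [Finset.sum_product]
  dsimp only
  rw [Finset.sum_const, Finset.card_product, Int.card_Icc, nsmul_eq_mul]
  have h3 : (L₁ + 1 - -(L₁ : ℤ)).toNat = 2 * L₁ + 1 := by omega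
  rw [h3]
  push_cast
  have h4 : 0 ≤ (M : ℝ) * (9 * L ^ 2 + 26 * L * Y * M ^ 2) := by positivity
  calc _ ≤ ((2 * (L₁ : ℝ) + 1) * (2 * L₁ + 1)) * (M * (9 * L ^ 2 + 26 * L * Y * M ^ 2)) := by
        gcongr
    _ ≤ (9 * L₁ ^ 2) * (M * (9 * L ^ 2 + 26 * L * Y * M ^ 2)) :=
        mul_le_mul_of_nonneg_right (by nlinarith) h4
    _ = _ := by ring

theorem dvd_mul_gcd {x c a b : ℤ} (ha : x ∣ c * a) (hb : x ∣ c * b) : x ∣ c * Int.gcd a b := by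
  rw [Int.gcd_eq_gcd_ab, mul_add, ← mul_assoc, ← mul_assoc]
  exact dvd_add (ha.mul_right _) (hb.mul_right _)

/-- The data `(α, β, γ, δ)` of a difference together with a vector `t` in the kernel of the
associated linear relations, not required to be primitive. -/
structure IsKernelVector (N L L₁ : ℕ) (s : (ℤ × ℤ × ℤ × ℤ) × (ℤ × ℤ × ℤ × ℤ)) : Prop where
  α_le : |s.1.1| ≤ L
  β_le : |s.1.2.1| ≤ L
  γ_le : |s.1.2.2.1| ≤ L₁
  δ_le : |s.1.2.2.2| ≤ L₁
  ne_zero : cubicForm s.1.1 s.1.2.1 s.1.2.2.1 s.1.2.2.2 ≠ 0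
  pos : 0 < s.2.1
  le₁ : |s.2.1| ≤ 4 * N
  le₂ : |s.2.2.1| ≤ 4 * N
  le₃ : |s.2.2.2.1| ≤ 4 * N
  le₄ : |s.2.2.2.2| ≤ 4 * N
  eq_one : 2 * s.1.2.1 * s.2.2.1 = 3 * s.1.2.2.1 * s.2.1 + 3 * s.1.1 * s.2.2.2.1
  eq_two : s.1.2.1 * s.2.2.2.1 = 3 * s.1.2.2.2 * s.2.1 + 6 * s.1.1 * s.2.2.2.2
  dvd₂ : s.2.1 ∣ 16 * cubicForm s.1.1 s.1.2.1 s.1.2.2.1 s.1.2.2.2 * s.2.2.1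
  dvd₃ : s.2.1 ∣ 16 * cubicForm s.1.1 s.1.2.1 s.1.2.2.1 s.1.2.2.2 * s.2.2.2.1
  dvd₄ : s.2.1 ∣ 16 * cubicForm s.1.1 s.1.2.1 s.1.2.2.1 s.1.2.2.2 * s.2.2.2.2

/-- The greatest common divisor of the coordinates of a vector. -/
def contentFour (t : ℤ × ℤ × ℤ × ℤ) : ℕ :=
  Int.gcd t.1 (Int.gcd t.2.1 (Int.gcd t.2.2.1 t.2.2.2))

theorem contentFour_dvd (t : ℤ × ℤ × ℤ × ℤ) : (contentFour t : ℤ) ∣ t.1 ∧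
    (contentFour t : ℤ) ∣ t.2.1 ∧ (contentFour t : ℤ) ∣ t.2.2.1 ∧ (contentFour t : ℤ) ∣ t.2.2.2 := by
  unfold contentFour
  have h1 := Int.gcd_dvd_right t.1 (Int.gcd t.2.1 (Int.gcd t.2.2.1 t.2.2.2))
  have h2 := h1.trans (Int.gcd_dvd_right _ _)
  exact ⟨Int.gcd_dvd_left _ _, h1.trans (Int.gcd_dvd_left _ _), h2.trans (Int.gcd_dvd_left _ _),
    h2.trans (Int.gcd_dvd_right _ _)⟩

/-- Division of a vector by a scalar. -/
def divFour (k : ℕ) (t : ℤ × ℤ × ℤ × ℤ) : ℤ × ℤ × ℤ × ℤ :=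
  (t.1 / k, t.2.1 / k, t.2.2.1 / k, t.2.2.2 / k)

theorem eq_contentFour_mul (t : ℤ × ℤ × ℤ × ℤ) :
    t.1 = contentFour t * (divFour (contentFour t) t).1 ∧
    t.2.1 = contentFour t * (divFour (contentFour t) t).2.1 ∧
    t.2.2.1 = contentFour t * (divFour (contentFour t) t).2.2.1 ∧
    t.2.2.2 = contentFour t * (divFour (contentFour t) t).2.2.2 := by
  obtain ⟨h1, h2, h3, h4⟩ := contentFour_dvd t
  exact ⟨(Int.mul_ediv_cancel' h1).symm, (Int.mul_ediv_cancel' h2).symm,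
    (Int.mul_ediv_cancel' h3).symm, (Int.mul_ediv_cancel' h4).symm⟩

section

variable {N L A₀ L₁ S : ℕ}

theorem IsKernelVector.contentFour_pos {s : (ℤ × ℤ × ℤ × ℤ) × (ℤ × ℤ × ℤ × ℤ)}
    (h : IsKernelVector N L L₁ s) : 0 < contentFour s.2 :=
  Int.gcd_pos_of_ne_zero_left _ h.pos.ne'

theorem IsKernelVector.contentFour_le {s : (ℤ × ℤ × ℤ × ℤ) × (ℤ × ℤ × ℤ × ℤ)}
    (h : IsKernelVector N L L₁ s) : contentFour s.2 ≤ 4 * N := by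
  have h1 := Int.le_of_dvd h.pos (contentFour_dvd s.2).1
  have h2 := le_of_abs_le h.le₁
  omega

theorem IsKernelVector.isStep {s : (ℤ × ℤ × ℤ × ℤ) × (ℤ × ℤ × ℤ × ℤ)}
    (h : IsKernelVector N L L₁ s) : IsStep L L₁ (s.1, divFour (contentFour s.2) s.2) := by
  have hk : (0 : ℤ) < contentFour s.2 := by exact_mod_cast h.contentFour_pos
  obtain ⟨e1, e2, e3, e4⟩ := eq_contentFour_mul s.2
  set u := divFour (contentFour s.2) s.2
  refine ⟨h.α_le, h.β_le, h.γ_le, h.δ_le, h.ne_zero, ?_, ?_, ?_, ?_⟩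
  · have := h.pos
    rw [e1] at this
    exact pos_of_mul_pos_right this hk.le
  · have := h.eq_one
    rw [e1, e2, e3] at this
    exact mul_left_cancel₀ hk.ne' (by linarith)
  · have := h.eq_two
    rw [e1, e3, e4] at this
    exact mul_left_cancel₀ hk.ne' (by linarith)
  · have h1 : s.2.1 ∣ 16 * cubicForm s.1.1 s.1.2.1 s.1.2.2.1 s.1.2.2.2 * contentFour s.2 :=
      dvd_mul_gcd (Dvd.intro_left _ rfl) (dvd_mul_gcd h.dvd₂ (dvd_mul_gcd h.dvd₃ h.dvd₄))
    rw [e1, mul_comm _ (contentFour s.2 : ℤ)] at h1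
    exact Int.dvd_of_mul_dvd_mul_left hk.ne' h1

theorem IsKernelVector.divFour_le {s : (ℤ × ℤ × ℤ × ℤ) × (ℤ × ℤ × ℤ × ℤ)}
    (h : IsKernelVector N L L₁ s) :
    |(divFour (contentFour s.2) s.2).1| ≤ (4 * N / contentFour s.2 : ℕ) ∧
    |(divFour (contentFour s.2) s.2).2.1| ≤ (4 * N / contentFour s.2 : ℕ) ∧
    |(divFour (contentFour s.2) s.2).2.2.1| ≤ (4 * N / contentFour s.2 : ℕ) ∧
    |(divFour (contentFour s.2) s.2).2.2.2| ≤ (4 * N / contentFour s.2 : ℕ) := by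
  have hk := h.contentFour_pos
  obtain ⟨e1, e2, e3, e4⟩ := eq_contentFour_mul s.2
  have key : ∀ x y : ℤ, x = contentFour s.2 * y → |x| ≤ 4 * N →
      |y| ≤ (4 * N / contentFour s.2 : ℕ) := by
    intro x y hxy hx
    push_cast
    rw [Int.le_ediv_iff_mul_le (by exact_mod_cast hk)]
    rw [hxy, abs_mul, Nat.abs_cast] at hx
    linarith
  exact ⟨key _ _ e1 h.le₁, key _ _ e2 h.le₂, key _ _ e3 h.le₃, key _ _ e4 h.le₄⟩

theorem card_isKernelVector_le {Q M U : ℕ} (hM : IsDivisorBound Q M) (hN : 1 ≤ N) (hL : 1 ≤ L)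
    (hLL₁ : L ≤ L₁) (hQ : 608 * L ^ 2 * L₁ ≤ Q) (hNQ : 4 * N ≤ Q) (hU : 1 ≤ U) (hUQ : U ≤ Q)
    (P : Finset ((ℤ × ℤ × ℤ × ℤ) × (ℤ × ℤ × ℤ × ℤ))) (hP : ∀ s ∈ P, IsKernelVector N L L₁ s) :
    (P.card : ℝ) ≤ 9 * L₁ ^ 2 * M * (36 * L ^ 2 * N / U + 104 * N * L * M ^ 3) +
      12 * N * U ^ 2 * (3 * U + 2 * L + 12 * L₁ * M ^ 2) ^ 2 := by
  have hLQ : L ≤ Q := by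
    have h0 : 1 ≤ L * L₁ := Nat.mul_pos hL (by omega)
    have : L * 1 ≤ L * (L * L₁) := Nat.mul_le_mul_left L h0
    nlinarith
  have h1 := card_le_sum_of_fibers P (fun s => contentFour s.2) (Finset.Icc 1 (4 * N))
    (fun s hs => Finset.mem_Icc.2 ⟨(hP s hs).contentFour_pos, (hP s hs).contentFour_le⟩)
    (fun k => if k * U < 4 * N then
      9 * L₁ ^ 2 * M * (9 * L ^ 2 + 104 * L * N * M ^ 2 * (1 / k : ℝ)) else
      3 * U ^ 2 * (3 * U + 2 * L + 12 * L₁ * M ^ 2) ^ 2) (by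
      intro k hk
      rw [Finset.mem_Icc] at hk
      set R := P.filter fun s => contentFour s.2 = k
      have hR : ∀ s ∈ R, IsKernelVector N L L₁ s ∧ contentFour s.2 = k := fun s hs =>
        ⟨hP s (Finset.mem_filter.1 hs).1, (Finset.mem_filter.1 hs).2⟩
      have hcard : (R.image fun s => (s.1, divFour k s.2)).card = R.card := by
        refine Finset.card_image_of_injOn ?_
        intro s hs t ht hst
        obtain ⟨hs, hsk⟩ := hR s hs
        obtain ⟨ht, htk⟩ := hR t ht
        obtain ⟨e1, e2, e3, e4⟩ := eq_contentFour_mul s.2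
        obtain ⟨f1, f2, f3, f4⟩ := eq_contentFour_mul t.2
        obtain ⟨h1, h2⟩ := Prod.ext_iff.1 hst
        simp only at h1 h2
        rw [hsk, h2] at e1 e2 e3 e4
        rw [htk] at f1 f2 f3 f4
        exact Prod.ext h1 (Prod.ext (e1.trans f1.symm) (Prod.ext (e2.trans f2.symm)
          (Prod.ext (e3.trans f3.symm) (e4.trans f4.symm))))
      rw [← hcard]
      have hk0 : (0 : ℝ) < k := by exact_mod_cast hk.1
      split_ifs with hkU
      · refine (card_step_le hM hL hLL₁ hQ (Y := 4 * N / k) _ ?_).trans ?_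
        · intro t ht
          obtain ⟨s, hs, rfl⟩ := Finset.mem_image.1 ht
          obtain ⟨h, hsk⟩ := hR s hs
          rw [← hsk]
          exact ⟨h.isStep, h.divFour_le.2⟩
        · have : ((4 * N / k : ℕ) : ℝ) ≤ 4 * N / k := by
            have := Nat.cast_div_le (α := ℝ) (m := 4 * N) (n := k)
            push_cast at this
            exact this
          have h2 : 26 * (L : ℝ) * ((4 * N / k : ℕ) : ℝ) * M ^ 2 ≤
              26 * (L : ℝ) * (4 * N / k) * M ^ 2 := by gcongr
          have h3 : 26 * (L : ℝ) * (4 * N / k) * M ^ 2 = 104 * L * N * M ^ 2 * (1 / k) := by ring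
          rw [h3] at h2
          gcongr
      · refine card_step_small_le hM hU hUQ hLQ _ ?_
        intro t ht
        obtain ⟨s, hs, rfl⟩ := Finset.mem_image.1 ht
        obtain ⟨h, hsk⟩ := hR s hs
        rw [← hsk] at hkU ⊢
        have hle : ((4 * N / contentFour s.2 : ℕ) : ℤ) ≤ U := by
          have : 4 * N / contentFour s.2 ≤ U :=
            Nat.div_le_of_le_mul (by linarith)
          exact_mod_cast this
        obtain ⟨g1, g2, g3, g4⟩ := h.divFour_le
        exact ⟨h.isStep, g1.trans hle, g2.trans hle, g3.trans hle, g4.trans hle⟩)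
  refine h1.trans ?_
  rw [Finset.sum_ite, Finset.sum_const, nsmul_eq_mul, ← Finset.mul_sum, Finset.sum_add_distrib,
    Finset.sum_const, nsmul_eq_mul, ← Finset.mul_sum]
  have hU' : (0 : ℝ) < U := by exact_mod_cast hU
  have h2 : (((Finset.Icc 1 (4 * N)).filter fun k => k * U < 4 * N).card : ℝ) ≤ 4 * N / U := by
    have h3 : ((Finset.Icc 1 (4 * N)).filter fun k => k * U < 4 * N) ⊆
        Finset.Icc 1 (4 * N / U) := by
      intro k hk
      obtain ⟨hk, hkU⟩ := Finset.mem_filter.1 hk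
      rw [Finset.mem_Icc] at hk ⊢
      exact ⟨hk.1, (Nat.le_div_iff_mul_le hU).2 hkU.le⟩
    have h4 := Finset.card_le_card h3
    rw [Nat.card_Icc, Nat.add_sub_cancel] at h4
    have h5 := Nat.cast_div_le (α := ℝ) (m := 4 * N) (n := U)
    push_cast at h5
    exact (Nat.cast_le.2 h4).trans h5
  have h3 : (((Finset.Icc 1 (4 * N)).filter fun k => ¬ k * U < 4 * N).card : ℝ) ≤ 4 * N := by
    have := Finset.card_filter_le (Finset.Icc 1 (4 * N)) fun k => ¬ k * U < 4 * N
    rw [Nat.card_Icc, Nat.add_sub_cancel] at this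
    exact_mod_cast this
  have h4 : ∑ k ∈ (Finset.Icc 1 (4 * N)).filter (fun k => k * U < 4 * N), (1 / k : ℝ) ≤ M :=
    (Finset.sum_le_sum_of_subset_of_nonneg (Finset.filter_subset _ _)
      (fun k _ _ => by positivity)).trans (hM.mono hNQ).2
  calc _ ≤ 9 * L₁ ^ 2 * M * (4 * N / U * (9 * L ^ 2) + 104 * L * N * M ^ 2 * M) +
        4 * N * (3 * U ^ 2 * (3 * U + 2 * L + 12 * L₁ * M ^ 2) ^ 2 : ℝ) := by gcongr
    _ = _ := by ring

theorem isKernelVector_sub {p q : (ℤ × ℤ × ℤ × ℤ) × (ℤ × ℤ × ℤ × ℤ)}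
    (hR : IsRange N L A₀ L₁ S) (hp : IsClosePair N L A₀ p) (hq : IsClosePair N L A₀ q)
    (h0 : cubicForm p.1.1 p.1.2.1 p.1.2.2.1 p.1.2.2.2 ≠ 0) (h1 : p.1 = q.1)
    (hσ : 3 * p.1.2.2.2 * p.2.1 - p.1.2.1 * p.2.2.2.1 + 6 * p.1.1 * p.2.2.2.2 =
      3 * q.1.2.2.2 * q.2.1 - q.1.2.1 * q.2.2.2.1 + 6 * q.1.1 * q.2.2.2.2)
    (hle : q.2.1 ≤ p.2.1) (hne : p ≠ q) : IsKernelVector N L L₁ (p.1, p.2 - q.2) := by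
  have hb := hp.bounds hR
  obtain ⟨⟨α, β, γ, δ⟩, A, B, C, D⟩ := p
  obtain ⟨τ, A', B', C', D'⟩ := q
  subst h1
  obtain ⟨-, a1, a2, a3, a4, a5, a6, a7, a8, a9⟩ := hp
  obtain ⟨-, b1, b2, b3, b4, b5, b6, b7, b8, b9⟩ := hq
  simp only at *
  set σ := 3 * δ * A - β * C + 6 * α * D with hσd
  have e1 : 2 * β * (B - B') = 3 * γ * (A - A') + 3 * α * (C - C') := by linear_combination b8 - a8
  have e2 : β * (C - C') = 3 * δ * (A - A') + 6 * α * (D - D') := by linear_combination -hσ + hσd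
  have e3 : 24 * δ * (B - B') - 12 * γ * (C - C') + 16 * β * (D - D') = σ * (A - A') := by
    rw [← hσ] at b9
    linarith
  have c2 : 16 * cubicForm α β γ δ * (B - B') = (A - A') *
      -((16 * β ^ 2 - 72 * α * γ) * (3 * γ) + 48 * α * β * (3 * δ) + 18 * α ^ 2 * σ) := by
    unfold cubicForm
    linear_combination -(16 * β ^ 2 - 72 * α * γ) * e1 - 48 * α * β * e2 - 18 * α ^ 2 * e3
  have c3 : 16 * cubicForm α β γ δ * (C - C') = (A - A') *
      -(-(144 * α * δ) * (3 * γ) + 32 * β ^ 2 * (3 * δ) + 12 * α * β * σ) := by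
    unfold cubicForm
    linear_combination (144 * α * δ) * e1 - 32 * β ^ 2 * e2 - 12 * α * β * e3
  have c4 : 16 * cubicForm α β γ δ * (D - D') = (A - A') *
      -(-(24 * β * δ) * (3 * γ) + (24 * β * γ - 72 * α * δ) * (3 * δ) + 2 * β ^ 2 * σ) := by
    unfold cubicForm
    linear_combination (24 * β * δ) * e1 - (24 * β * γ - 72 * α * δ) * e2 - 2 * β ^ 2 * e3
  refine ⟨a1, a2, hb.1, hb.2, h0, ?_, ?_, ?_, ?_, ?_, e1, e2, ⟨_, c2⟩, ⟨_, c3⟩, ⟨_, c4⟩⟩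
  · rcases hle.lt_or_eq with h | h
    · exact sub_pos.2 h
    · exfalso
      have h16 : 16 * cubicForm α β γ δ ≠ 0 := mul_ne_zero (by norm_num) h0
      rw [h, sub_self, zero_mul] at c2 c3 c4
      have g2 := sub_eq_zero.1 ((mul_eq_zero.1 c2).resolve_left h16)
      have g3 := sub_eq_zero.1 ((mul_eq_zero.1 c3).resolve_left h16)
      have g4 := sub_eq_zero.1 ((mul_eq_zero.1 c4).resolve_left h16)
      exact hne (by rw [h, g2, g3, g4])
  · exact (abs_sub _ _).trans (by linarith)
  · exact (abs_sub _ _).trans (by linarith)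
  · exact (abs_sub _ _).trans (by linarith)
  · exact (abs_sub _ _).trans (by linarith)

/-- Count of the pairs of close quartics on which the cubic form does not vanish. -/
theorem card_cubicForm_ne_zero_le (hR : IsRange N L A₀ L₁ S) {Q M U : ℕ} (hM : IsDivisorBound Q M)
    (hQ : 608 * L ^ 2 * L₁ ≤ Q) (hNQ : 4 * N ≤ Q) (hU : 1 ≤ U) (hUQ : U ≤ Q)
    (P : Finset ((ℤ × ℤ × ℤ × ℤ) × (ℤ × ℤ × ℤ × ℤ))) (hP : ∀ p ∈ P, IsClosePair N L A₀ p)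
    (h0 : ∀ p ∈ P, cubicForm p.1.1 p.1.2.1 p.1.2.2.1 p.1.2.2.2 ≠ 0) :
    (P.card : ℝ) ≤ (2 * L + 1) ^ 2 * (2 * L₁ + 1) ^ 2 * (2 * S + 1) +
      (9 * L₁ ^ 2 * M * (36 * L ^ 2 * N / U + 104 * N * L * M ^ 3) +
      12 * N * U ^ 2 * (3 * U + 2 * L + 12 * L₁ * M ^ 2) ^ 2) := by
  set w : (ℤ × ℤ × ℤ × ℤ) × (ℤ × ℤ × ℤ × ℤ) → ((ℤ × ℤ) × (ℤ × ℤ)) × ℤ := fun p =>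
    (((p.1.1, p.1.2.1), (p.1.2.2.1, p.1.2.2.2)),
      3 * p.1.2.2.2 * p.2.1 - p.1.2.1 * p.2.2.2.1 + 6 * p.1.1 * p.2.2.2.2) with hw
  have hwp : ∀ p q, w p = w q → p.1 = q.1 ∧
      3 * p.1.2.2.2 * p.2.1 - p.1.2.1 * p.2.2.2.1 + 6 * p.1.1 * p.2.2.2.2 =
      3 * q.1.2.2.2 * q.2.1 - q.1.2.1 * q.2.2.2.1 + 6 * q.1.1 * q.2.2.2.2 := by
    intro p q h
    simp only [hw, Prod.mk.injEq] at h
    exact ⟨Prod.ext h.1.1.1 (Prod.ext h.1.1.2 (Prod.ext h.1.2.1 h.1.2.2)), h.2⟩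
  have hex : ∀ y ∈ P.image w, ∃ p, p ∈ P ∧ w p = y ∧ ∀ q ∈ P, w q = y → p.2.1 ≤ q.2.1 := by
    intro y hy
    obtain ⟨p, hp, rfl⟩ := Finset.mem_image.1 hy
    obtain ⟨r, hr, hmin⟩ := (P.filter fun q => w q = w p).exists_min_image (fun q => q.2.1)
      ⟨p, Finset.mem_filter.2 ⟨hp, rfl⟩⟩
    exact ⟨r, (Finset.mem_filter.1 hr).1, (Finset.mem_filter.1 hr).2,
      fun q hq hqp => hmin q (Finset.mem_filter.2 ⟨hq, hqp⟩)⟩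
  rcases P.eq_empty_or_nonempty with rfl | ⟨p0, hp0⟩
  · simp only [Finset.card_empty, Nat.cast_zero]
    positivity
  have : Nonempty ((ℤ × ℤ × ℤ × ℤ) × (ℤ × ℤ × ℤ × ℤ)) := ⟨p0⟩
  choose! g hg hwg hmin using hex
  have h1 : (P.filter fun p => g (w p) = p).card ≤ (P.image w).card :=
    Finset.card_le_card_of_injOn w
      (fun s hs => Finset.mem_image_of_mem w (Finset.mem_filter.1 hs).1)
      (fun s hs t ht h => by
        rw [← (Finset.mem_filter.1 hs).2, ← (Finset.mem_filter.1 ht).2, h])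
  have h2 : (P.image w).card ≤ (2 * L + 1) ^ 2 * (2 * L₁ + 1) ^ 2 * (2 * S + 1) := by
    have h3 : P.image w ⊆ ((Finset.Icc (-(L : ℤ)) L ×ˢ Finset.Icc (-(L : ℤ)) L) ×ˢ
        (Finset.Icc (-(L₁ : ℤ)) L₁ ×ˢ Finset.Icc (-(L₁ : ℤ)) L₁)) ×ˢ Finset.Icc (-(S : ℤ)) S := by
      intro y hy
      obtain ⟨p, hp, rfl⟩ := Finset.mem_image.1 hy
      have b1 := (hP p hp).α_le
      have b2 := (hP p hp).β_le
      obtain ⟨b3, b4⟩ := (hP p hp).bounds hR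
      have b5 := (hP p hp).sigma_le hR
      simp only [Finset.mem_product, Finset.mem_Icc, hw]
      exact ⟨⟨⟨abs_le.1 b1, abs_le.1 b2⟩, abs_le.1 b3, abs_le.1 b4⟩, abs_le.1 b5⟩
    have h4 := Finset.card_le_card h3
    simp only [Finset.card_product, Int.card_Icc] at h4
    have k : ∀ n : ℕ, ((n : ℤ) + 1 - -(n : ℤ)).toNat = 2 * n + 1 := by intro n; omega
    rw [k, k, k] at h4
    calc _ ≤ _ := h4
      _ = _ := by ring
  set R := P.filter fun p => ¬ g (w p) = p with hRdef
  have h3 : (P.filter fun p => g (w p) = p).card + R.card = P.card :=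
    P.card_filter_add_card_filter_not _
  have hRm : ∀ p ∈ R, p ∈ P ∧ g (w p) ≠ p ∧ g (w p) ∈ P ∧ w (g (w p)) = w p ∧
      (g (w p)).2.1 ≤ p.2.1 := by
    intro p hp
    obtain ⟨hp, hne⟩ := Finset.mem_filter.1 hp
    have hm := Finset.mem_image_of_mem w hp
    exact ⟨hp, hne, hg _ hm, hwg _ hm, hmin _ hm p hp rfl⟩
  have hker : ∀ p ∈ R, IsKernelVector N L L₁ (p.1, p.2 - (g (w p)).2) := by
    intro p hp
    obtain ⟨hp, hne, hgP, hwp', hle⟩ := hRm p hp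
    obtain ⟨e1, e2⟩ := hwp _ _ hwp'
    exact isKernelVector_sub hR (hP p hp) (hP _ hgP) (h0 p hp) e1.symm e2.symm hle hne.symm
  have h4 := card_isKernelVector_le hM (by have := hR.le_A; have := hR.A_le; omega) hR.one_le
    hR.L_le_L₁ hQ hNQ hU hUQ (R.image fun p => (p.1, p.2 - (g (w p)).2)) (by
      intro s hs
      obtain ⟨p, hp, rfl⟩ := Finset.mem_image.1 hs
      exact hker p hp)
  rw [Finset.card_image_of_injOn] at h4
  · have h5 : (P.card : ℝ) ≤ ((P.image w).card : ℝ) + R.card := by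
      have : P.card ≤ (P.image w).card + R.card := by omega
      exact_mod_cast this
    have h6 : ((P.image w).card : ℝ) ≤ (2 * L + 1) ^ 2 * (2 * L₁ + 1) ^ 2 * (2 * S + 1) := by
      exact_mod_cast h2
    linarith
  · intro p hp q hq hpq
    obtain ⟨hpP, -, hgp, hwp', -⟩ := hRm p hp
    obtain ⟨hqP, -, hgq, hwq', -⟩ := hRm q hq
    obtain ⟨e1, e2⟩ := Prod.ext_iff.1 hpq
    simp only at e1 e2
    have hpos : (p.2 - (g (w p)).2).1 ≠ 0 := (hker p hp).pos.ne'
    have hJ : ∀ r ∈ R, (3 * r.1.2.2.2 * r.2.1 - r.1.2.1 * r.2.2.2.1 + 6 * r.1.1 * r.2.2.2.2) *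
        (r.2 - (g (w r)).2).1 = 24 * r.1.2.2.2 * (r.2 - (g (w r)).2).2.1 -
          12 * r.1.2.2.1 * (r.2 - (g (w r)).2).2.2.1 +
          16 * r.1.2.1 * (r.2 - (g (w r)).2).2.2.2 := by
      intro r hr
      obtain ⟨hrP, -, hgr, hwr, -⟩ := hRm r hr
      have d1 := (hP r hrP).isDiffSum.2
      have d2 := (hP _ hgr).isDiffSum.2
      obtain ⟨f1, f2⟩ := hwp _ _ hwr
      rw [f2, f1] at d2
      simp only [Prod.fst_sub, Prod.snd_sub]
      linarith
    have j1 := hJ p hp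
    have j2 := hJ q hq
    rw [e2] at j1 hpos
    have hσ : 3 * p.1.2.2.2 * p.2.1 - p.1.2.1 * p.2.2.2.1 + 6 * p.1.1 * p.2.2.2.2 =
        3 * q.1.2.2.2 * q.2.1 - q.1.2.1 * q.2.2.2.1 + 6 * q.1.1 * q.2.2.2.2 := by
      refine mul_right_cancel₀ hpos ?_
      rw [j1, j2, e1]
    have hww : w p = w q := by
      simp only [hw]
      rw [hσ, e1]
    rw [hww] at e2
    exact Prod.ext e1 (sub_left_injective e2)

end

section

variable {N L A₀ L₁ S : ℕ}

theorem abs_sub_lt_of_ediv_eq {x y : ℤ} {k : ℕ} (hk : 1 ≤ k) (h : x / k = y / k) :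
    |y - x| ≤ k := by
  have hk' : (0 : ℤ) < k := by exact_mod_cast hk
  have h1 := Int.mul_ediv_add_emod x k
  have h2 := Int.mul_ediv_add_emod y k
  have h3 := Int.emod_nonneg x hk'.ne'
  have h4 := Int.emod_nonneg y hk'.ne'
  have h5 := Int.emod_lt_of_pos x hk'
  have h6 := Int.emod_lt_of_pos y hk'
  rw [h] at h1
  rw [abs_le]
  constructor <;> linarith

theorem card_image_ediv_le {α : Type*} (T : Finset α) (f : α → ℤ) {k A : ℕ} (hk : 1 ≤ k)
    (hkA : k ≤ A) (hf : ∀ s ∈ T, |f s| ≤ A) :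
    ((T.image fun s => f s / k).card : ℝ) ≤ 4 * A / k := by
  have h1 : (T.image fun s => f s / k) ⊆ Finset.Icc (-((A / k : ℕ) : ℤ) - 1) (A / k : ℕ) := by
    intro y hy
    obtain ⟨s, hs, rfl⟩ := Finset.mem_image.1 hy
    have hk' : (0 : ℤ) < k := by exact_mod_cast hk
    have h2 := abs_le.1 (hf s hs)
    rw [Finset.mem_Icc]
    push_cast
    refine ⟨?_, Int.ediv_le_ediv hk' h2.2⟩
    rw [Int.le_ediv_iff_mul_le hk']
    have h3 := Int.mul_ediv_add_emod A k
    have h4 := Int.emod_lt_of_pos A hk'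
    linarith
  have h2 := Finset.card_le_card h1
  rw [Int.card_Icc] at h2
  have h3 : (T.image fun s => f s / k).card ≤ 2 * (A / k) + 2 := by omega
  have h4 := Nat.cast_div_le (α := ℝ) (m := A) (n := k)
  have h5 : (1 : ℝ) ≤ A / k := by
    rw [le_div_iff₀ (by exact_mod_cast hk)]
    simpa using hkA
  calc ((T.image fun s => f s / k).card : ℝ) ≤ 2 * ((A / k : ℕ) : ℝ) + 2 := by exact_mod_cast h3
    _ ≤ 4 * (A / k) := by linarith
    _ = _ := by ring

theorem isClosePair_of_invariants_eq (hR : IsRange N L A₀ L₁ S) {s t : ℤ × ℤ × ℤ × ℤ}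
    (hs : A₀ ≤ |s.1| ∧ |s.1| ≤ N ∧ |s.2.1| ≤ N ∧ |s.2.2.1| ≤ N ∧ |s.2.2.2| ≤ N)
    (ht : A₀ ≤ |t.1| ∧ |t.1| ≤ N ∧ |t.2.1| ≤ N ∧ |t.2.2.1| ≤ N ∧ |t.2.2.2| ≤ N)
    (hI : quarticI s.1 s.2.1 s.2.2.1 s.2.2.2 = quarticI t.1 t.2.1 t.2.2.1 t.2.2.2)
    (hJ : quarticJ s.1 s.2.1 s.2.2.1 s.2.2.2 = quarticJ t.1 t.2.1 t.2.2.1 t.2.2.2)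
    (ha : s.1 / L = t.1 / L) (hb : s.2.1 / L = t.2.1 / L) (hne : s ≠ t) :
    IsClosePair N L A₀ (t - s, s + t) := by
  have h1 := abs_sub_lt_of_ediv_eq hR.one_le ha
  have h2 := abs_sub_lt_of_ediv_eq hR.one_le hb
  have hL : L < A₀ := by
    have h3 := hR.L_le
    have h4 := hR.one_le
    have h5 : L ^ 2 < A₀ ^ 2 := by
      have : 0 < L ^ 2 := by positivity
      omega
    exact lt_of_pow_lt_pow_left₀ 2 (by positivity) h5
  obtain ⟨a1, a2, a3, a4, a5⟩ := hs
  obtain ⟨b1, b2, b3, b4, b5⟩ := ht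
  refine ⟨sub_ne_zero.2 hne.symm, h1, h2, ?_, ?_, ?_, ?_, ?_, isDiffSum_of_invariants_eq hI hJ⟩
  · simp only [Prod.fst_add]
    rw [abs_le] at h1
    rw [le_abs] at a1 b1 ⊢
    omega
  all_goals
    simp only [Prod.fst_add, Prod.snd_add]
    exact (abs_add_le _ _).trans (by linarith)

theorem IsRange.one_le_S (hR : IsRange N L A₀ L₁ S) : 1 ≤ S := by
  have h1 := hR.S_le
  have h2 := hR.one_le
  have h3 : 0 < L ^ 2 * L₁ := by
    have := hR.L_le_L₁
    exact Nat.mul_pos (pow_pos (by omega) 2) (by omega)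
  rcases Nat.eq_zero_or_pos S with h | h
  · rw [h] at h1
    nlinarith
  · exact h

theorem pair_bounds_le {l k n s u m a : ℝ} (hm : 1 ≤ m) (hl : 1 ≤ l) (hlk : l ≤ k) (hul : u ≤ l)
    (hu : 1 ≤ u) (hs : 1 ≤ s) (hn : 0 ≤ n) (ha : 0 ≤ a) :
    6400 * m ^ 2 * (n ^ 3 * a / l ^ 2) + ((2 * l + 1) * (8704000 * n ^ 2 * m ^ 3) +
      ((2 * l + 1) ^ 2 * (2 * k + 1) ^ 2 * (2 * s + 1) +
      (9 * k ^ 2 * m * (36 * l ^ 2 * n / u + 104 * n * l * m ^ 3) +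
        12 * n * u ^ 2 * (3 * u + 2 * l + 12 * k * m ^ 2) ^ 2))) ≤
    30000000 * m ^ 4 * (n ^ 3 * a / l ^ 2 + l * n ^ 2 + l ^ 2 * k ^ 2 * s +
      l ^ 2 * k ^ 2 * n / u + n * u ^ 2 * k ^ 2) := by
  have hm0 : 0 ≤ m := by linarith
  have hl0 : 0 ≤ l := by linarith
  have hk0 : 0 ≤ k := by linarith
  have hs0 : 0 ≤ s := by linarith
  have hu0 : 0 ≤ u := by linarith
  have m24 : m ^ 2 ≤ m ^ 4 := pow_le_pow_right₀ hm (by norm_num)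
  have m34 : m ^ 3 ≤ m ^ 4 := pow_le_pow_right₀ hm (by norm_num)
  have m14 : m ≤ m ^ 4 := le_self_pow₀ hm (by norm_num)
  have m04 : 1 ≤ m ^ 4 := one_le_pow₀ hm
  have m12 : 1 ≤ m ^ 2 := one_le_pow₀ hm
  have k1 : 6400 * m ^ 2 * (n ^ 3 * a / l ^ 2) ≤ 30000000 * m ^ 4 * (n ^ 3 * a / l ^ 2) := by
    gcongr
    norm_num
  have k2 : (2 * l + 1) * (8704000 * n ^ 2 * m ^ 3) ≤ 30000000 * m ^ 4 * (l * n ^ 2) := by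
    calc (2 * l + 1) * (8704000 * n ^ 2 * m ^ 3)
        ≤ (3 * l) * (8704000 * n ^ 2 * m ^ 4) := by gcongr; linarith
      _ = 26112000 * (m ^ 4 * (l * n ^ 2)) := by ring
      _ ≤ 30000000 * (m ^ 4 * (l * n ^ 2)) := by gcongr; norm_num
      _ = _ := by ring
  have k3 : (2 * l + 1) ^ 2 * (2 * k + 1) ^ 2 * (2 * s + 1) ≤
      30000000 * m ^ 4 * (l ^ 2 * k ^ 2 * s) := by
    calc (2 * l + 1) ^ 2 * (2 * k + 1) ^ 2 * (2 * s + 1)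
        ≤ (3 * l) ^ 2 * (3 * k) ^ 2 * (3 * s) := by gcongr <;> linarith
      _ = 243 * 1 * (l ^ 2 * k ^ 2 * s) := by ring
      _ ≤ 30000000 * m ^ 4 * (l ^ 2 * k ^ 2 * s) := by gcongr; norm_num
  have k4 : 9 * k ^ 2 * m * (36 * l ^ 2 * n / u + 104 * n * l * m ^ 3) ≤
      30000000 * m ^ 4 * (l ^ 2 * k ^ 2 * n / u) := by
    have e1 : l ≤ l ^ 2 / u := by
      rw [le_div_iff₀ (by linarith), pow_two]
      gcongr
    calc 9 * k ^ 2 * m * (36 * l ^ 2 * n / u + 104 * n * l * m ^ 3)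
        = 324 * (m * (l ^ 2 * k ^ 2 * n / u)) + 936 * m ^ 4 * (k ^ 2 * n * l) := by ring
      _ ≤ 324 * (m ^ 4 * (l ^ 2 * k ^ 2 * n / u)) +
          936 * m ^ 4 * (k ^ 2 * n * (l ^ 2 / u)) := by gcongr
      _ = 1260 * (m ^ 4 * (l ^ 2 * k ^ 2 * n / u)) := by ring
      _ ≤ 30000000 * (m ^ 4 * (l ^ 2 * k ^ 2 * n / u)) := by gcongr; norm_num
      _ = _ := by ring
  have k5 : 12 * n * u ^ 2 * (3 * u + 2 * l + 12 * k * m ^ 2) ^ 2 ≤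
      30000000 * m ^ 4 * (n * u ^ 2 * k ^ 2) := by
    have e1 : k * 1 ≤ k * m ^ 2 := by gcongr
    calc 12 * n * u ^ 2 * (3 * u + 2 * l + 12 * k * m ^ 2) ^ 2
        ≤ 12 * n * u ^ 2 * (17 * (k * m ^ 2)) ^ 2 := by gcongr; linarith
      _ = 3468 * (m ^ 4 * (n * u ^ 2 * k ^ 2)) := by ring
      _ ≤ 30000000 * (m ^ 4 * (n * u ^ 2 * k ^ 2)) := by gcongr; norm_num
      _ = _ := by ring
  linarith

/-- Quartics with square discriminant whose cubic coefficient lies in a given large range. -/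
theorem card_square_disc_large_le (hR : IsRange N L A₀ L₁ S) {M U A₁ : ℕ}
    (hM : IsDivisorBound (20000 * N ^ 6) M) (hL₁ : L₁ ≤ 4 * N) (hU : 1 ≤ U) (hUN : U ≤ N)
    (hUL : U ≤ L) (hA : A₀ ≤ A₁) (T : Finset (ℤ × ℤ × ℤ × ℤ))
    (hT : ∀ s ∈ T, A₀ ≤ |s.1| ∧ |s.1| ≤ N ∧ |s.2.1| ≤ N ∧ |s.2.2.1| ≤ N ∧ |s.2.2.2| ≤ N)
    (hTA : ∀ s ∈ T, |s.1| ≤ A₁)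
    (hsq : ∀ s ∈ T, ∃ y : ℤ, 4 * quarticI s.1 s.2.1 s.2.2.1 s.2.2.2 ^ 3 =
      quarticJ s.1 s.2.1 s.2.2.1 s.2.2.2 ^ 2 + 27 * y ^ 2) :
    (T.card : ℝ) ≤ 30000000 * M ^ 4 * (N ^ 3 * A₁ / L ^ 2 + L * N ^ 2 + L ^ 2 * L₁ ^ 2 * S +
      L ^ 2 * L₁ ^ 2 * N / U + N * U ^ 2 * L₁ ^ 2) := by
  have hL1 := hR.one_le
  have hLL₁ := hR.L_le_L₁
  have hS := hR.one_le_S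
  have hA48 := hR.le_A
  have hAN := hR.A_le
  have hL : L ≤ A₀ := by
    have h3 := hR.L_le
    have h5 : L ^ 2 ≤ A₀ ^ 2 := by omega
    exact (Nat.pow_le_pow_iff_left two_ne_zero).1 h5
  have hN : 1 ≤ N := by omega
  have hNQ : N ≤ N ^ 6 := Nat.le_self_pow (by norm_num) N
  have hN2Q : N ^ 2 ≤ N ^ 6 := Nat.pow_le_pow_right hN (by norm_num)
  have hN3Q : N ^ 3 ≤ N ^ 6 := Nat.pow_le_pow_right hN (by norm_num)
  set f : ℤ × ℤ × ℤ × ℤ → (ℤ × ℤ) × (ℤ × ℤ) := fun s =>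
    ((quarticI s.1 s.2.1 s.2.2.1 s.2.2.2, quarticJ s.1 s.2.1 s.2.2.1 s.2.2.2),
      (s.1 / L, s.2.1 / L)) with hf
  have h1 := card_le_card_image_add_card_pairs T f
  have h2 : ((T.image f).card : ℝ) ≤ 6400 * M ^ 2 * (N ^ 3 * A₁ / L ^ 2) := by
    have h3 : T.image f ⊆ (T.image fun s : ℤ × ℤ × ℤ × ℤ => (quarticI s.1 s.2.1 s.2.2.1 s.2.2.2,
        quarticJ s.1 s.2.1 s.2.2.1 s.2.2.2)) ×ˢ
        ((T.image fun s : ℤ × ℤ × ℤ × ℤ => s.1 / (L : ℤ)) ×ˢ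
          (T.image fun s : ℤ × ℤ × ℤ × ℤ => s.2.1 / (L : ℤ))) := by
      intro y hy
      obtain ⟨s, hs, rfl⟩ := Finset.mem_image.1 hy
      exact Finset.mem_product.2 ⟨Finset.mem_image.2 ⟨s, hs, rfl⟩, Finset.mem_product.2
        ⟨Finset.mem_image.2 ⟨s, hs, rfl⟩, Finset.mem_image.2 ⟨s, hs, rfl⟩⟩⟩
    have h4 := Finset.card_le_card h3
    rw [Finset.card_product, Finset.card_product] at h4
    have h5 := card_invariants_image_le N M hN hM T (fun s hs => (hT s hs).2) hsq
    have h6 := card_image_ediv_le T (fun s => s.1) hL1 (hL.trans hA) hTA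
    have h7 := card_image_ediv_le T (fun s => s.2.1) hL1 (hL.trans hAN)
      (fun s hs => (hT s hs).2.2.1)
    have h5' : ((T.image fun s => (quarticI s.1 s.2.1 s.2.2.1 s.2.2.2,
        quarticJ s.1 s.2.1 s.2.2.1 s.2.2.2)).card : ℝ) ≤ 400 * N ^ 2 * M ^ 2 := by
      exact_mod_cast h5
    calc ((T.image f).card : ℝ) ≤ ((_ * (_ * _) : ℕ) : ℝ) := Nat.cast_le.2 h4
      _ ≤ (400 * N ^ 2 * M ^ 2) * ((4 * A₁ / L) * (4 * N / L)) := by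
        push_cast
        gcongr
      _ = _ := by ring
  set R := (T ×ˢ T).filter fun p => p.1 ≠ p.2 ∧ f p.1 = f p.2 with hRdef
  set P := R.image fun p => (p.2 - p.1, p.1 + p.2) with hPdef
  have hPR : P.card = R.card := by
    refine Finset.card_image_of_injOn ?_
    rintro ⟨s, t⟩ - ⟨s', t'⟩ - h
    simp only [Prod.mk.injEq] at h
    obtain ⟨e1, e2⟩ := h
    simp only [Prod.ext_iff, Prod.fst_sub, Prod.snd_sub, Prod.fst_add, Prod.snd_add] at e1 e2 ⊢
    omega
  have hP : ∀ p ∈ P, IsClosePair N L A₀ p := by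
    intro p hp
    obtain ⟨⟨s, t⟩, hst, rfl⟩ := Finset.mem_image.1 hp
    obtain ⟨hst, hne, hfe⟩ := Finset.mem_filter.1 hst
    obtain ⟨hs, ht⟩ := Finset.mem_product.1 hst
    simp only [hf, Prod.mk.injEq] at hfe
    exact isClosePair_of_invariants_eq hR (hT s hs) (hT t ht) hfe.1.1 hfe.1.2 hfe.2.1 hfe.2.2 hne
  have h3 := card_cubicForm_eq_zero_le hR M
    ((hM.mono (by nlinarith : 36 * (16 * N) ^ 2 ≤ 20000 * N ^ 6)).2)
    (P.filter fun p => cubicForm p.1.1 p.1.2.1 p.1.2.2.1 p.1.2.2.2 = 0)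
    (fun p hp => hP p (Finset.mem_filter.1 hp).1) (fun p hp => (Finset.mem_filter.1 hp).2)
  have hQ : 608 * L ^ 2 * L₁ ≤ 20000 * N ^ 6 := by
    have h4 : L ^ 2 * L₁ ≤ N ^ 2 * (4 * N) := by
      have := hL.trans hAN
      gcongr
    nlinarith
  have h4 := card_cubicForm_ne_zero_le hR hM hQ (by omega) hU (by omega)
    (P.filter fun p => ¬ cubicForm p.1.1 p.1.2.1 p.1.2.2.1 p.1.2.2.2 = 0)
    (fun p hp => hP p (Finset.mem_filter.1 hp).1) (fun p hp => (Finset.mem_filter.1 hp).2)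
  have h5 := P.card_filter_add_card_filter_not
    (fun p => cubicForm p.1.1 p.1.2.1 p.1.2.2.1 p.1.2.2.2 = 0)
  have h6 : (T.card : ℝ) ≤ (T.image f).card + (((P.filter fun p =>
      cubicForm p.1.1 p.1.2.1 p.1.2.2.1 p.1.2.2.2 = 0).card : ℝ) + (P.filter fun p =>
      ¬ cubicForm p.1.1 p.1.2.1 p.1.2.2.1 p.1.2.2.2 = 0).card) := by
    rw [← hPR] at h1
    rw [← h5] at h1
    exact_mod_cast h1
  have cM : (1 : ℝ) ≤ M := by exact_mod_cast hM.one_le (by omega)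
  have cL : (1 : ℝ) ≤ L := by exact_mod_cast hL1
  have cLL : (L : ℝ) ≤ L₁ := by exact_mod_cast hLL₁
  have cUL : (U : ℝ) ≤ L := by exact_mod_cast hUL
  have cU : (1 : ℝ) ≤ U := by exact_mod_cast hU
  have cS : (1 : ℝ) ≤ S := by exact_mod_cast hS
  have hk := pair_bounds_le (n := N) (a := A₁) cM cL cLL cUL cU cS (by positivity) (by positivity)
  linarith

end

theorem natCeil_le_two_mul {y : ℝ} (hy : 1 ≤ y) : (⌈y⌉₊ : ℝ) ≤ 2 * y := by
  have := (Nat.ceil_lt_add_one (by linarith : 0 ≤ y)).le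
  linarith

theorem isRange_natCeil {N : ℕ} {l g : ℝ} (hl : 1 ≤ l) (hg : 152 ≤ g) (hl2 : N ≤ l ^ 2)
    (hlg : l * g ≤ N) :
    IsRange N ⌈l⌉₊ ⌈l * g⌉₊ ⌈6 * N / g⌉₊ ⌈2640 * l * N / g ^ 2⌉₊ := by
  have hg0 : 0 < g := by linarith
  have hNg : g ≤ N := by nlinarith
  have h1 : (⌈l⌉₊ : ℝ) ≤ 2 * l := natCeil_le_two_mul hl
  have h2 : (⌈6 * N / g⌉₊ : ℝ) ≤ 2 * (6 * N / g) := by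
    refine natCeil_le_two_mul ?_
    rw [le_div_iff₀ hg0]
    linarith
  have h3 : l ≤ ⌈l⌉₊ := Nat.le_ceil _
  have h4 : l * g ≤ ⌈l * g⌉₊ := Nat.le_ceil _
  have h5 : 6 * N / g ≤ ⌈6 * N / g⌉₊ := Nat.le_ceil _
  have h6 : 2640 * l * N / g ^ 2 ≤ ⌈2640 * l * N / g ^ 2⌉₊ := Nat.le_ceil _
  refine ⟨?_, ?_, ?_, ?_, ?_, ?_, ?_⟩
  · exact_mod_cast hl.trans h3
  · have : (N : ℝ) ≤ (⌈l⌉₊ : ℝ) ^ 2 := hl2.trans (by gcongr)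
    exact_mod_cast this
  · have : (48 : ℝ) ≤ ⌈l * g⌉₊ := le_trans (by nlinarith) h4
    exact_mod_cast this
  · have : 38 * (⌈l⌉₊ : ℝ) ^ 2 ≤ (⌈l * g⌉₊ : ℝ) ^ 2 :=
      calc 38 * (⌈l⌉₊ : ℝ) ^ 2 ≤ 38 * (2 * l) ^ 2 := by gcongr
        _ = l ^ 2 * 152 := by ring
        _ ≤ l ^ 2 * g ^ 2 := by
          gcongr
          nlinarith
        _ = (l * g) ^ 2 := by ring
        _ ≤ _ := by gcongr
    exact_mod_cast this
  · exact Nat.ceil_le.2 hlg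
  · have : 3 * (⌈l⌉₊ : ℝ) * N ≤ (⌈6 * N / g⌉₊ : ℝ) * ⌈l * g⌉₊ :=
      calc 3 * (⌈l⌉₊ : ℝ) * N ≤ 3 * (2 * l) * N := by gcongr
        _ = (6 * N / g) * (l * g) := by
          field_simp
          ring
        _ ≤ _ := by gcongr
    exact_mod_cast this
  · have : 55 * (⌈l⌉₊ : ℝ) ^ 2 * ⌈6 * N / g⌉₊ ≤ (⌈2640 * l * N / g ^ 2⌉₊ : ℝ) * ⌈l * g⌉₊ :=
      calc 55 * (⌈l⌉₊ : ℝ) ^ 2 * ⌈6 * N / g⌉₊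
          ≤ 55 * (2 * l) ^ 2 * (2 * (6 * N / g)) := by gcongr
        _ = (2640 * l * N / g ^ 2) * (l * g) := by
          field_simp
          ring
        _ ≤ _ := by gcongr
    exact_mod_cast this

theorem card_square_disc_scaled_le {N M : ℕ} {l g u α : ℝ} (hl : 1 ≤ l) (hg : 152 ≤ g)
    (hl2 : N ≤ l ^ 2) (hlg : l * g ≤ N) (hu : 1 ≤ u) (hul : u ≤ l) (hα : l * g ≤ α)
    (hM : IsDivisorBound (20000 * N ^ 6) M) (T : Finset (ℤ × ℤ × ℤ × ℤ))
    (hT : ∀ s ∈ T, |s.1| ≤ N ∧ |s.2.1| ≤ N ∧ |s.2.2.1| ≤ N ∧ |s.2.2.2| ≤ N)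
    (hT₁ : ∀ s ∈ T, l * g ≤ |(s.1 : ℝ)| ∧ |(s.1 : ℝ)| ≤ α)
    (hsq : ∀ s ∈ T, ∃ y : ℤ, 4 * quarticI s.1 s.2.1 s.2.2.1 s.2.2.2 ^ 3 =
      quarticJ s.1 s.2.1 s.2.2.1 s.2.2.2 ^ 2 + 27 * y ^ 2) :
    (T.card : ℝ) ≤ 100000000000000 * M ^ 4 * (N ^ 3 * α / l ^ 2 + l * N ^ 2 +
      l ^ 3 * N ^ 3 / g ^ 4 + l ^ 2 * N ^ 3 / (g ^ 2 * u) + N ^ 3 * u ^ 2 / g ^ 2) := by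
  have hg0 : 0 < g := by linarith
  have hl0 : 0 < l := by linarith
  have hu0 : 0 < u := by linarith
  have hgN : g ≤ N := by nlinarith
  have hlN : l ≤ N := by nlinarith
  have hN0 : (0 : ℝ) < N := by linarith
  have hα1 : 1 ≤ α := by nlinarith
  have hR := isRange_natCeil hl hg hl2 hlg
  have hlNg : l ≤ N / g := by rwa [le_div_iff₀ hg0]
  have b1 : (⌈6 * N / g⌉₊ : ℝ) ≤ 12 * (N / g) := by
    refine (natCeil_le_two_mul ?_).trans_eq (by ring)
    rw [le_div_iff₀ hg0]
    linarith
  have b2 : (⌈2640 * l * N / g ^ 2⌉₊ : ℝ) ≤ 5280 * (l * N / g ^ 2) := by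
    refine (natCeil_le_two_mul ?_).trans_eq (by ring)
    rw [le_div_iff₀ (by positivity)]
    nlinarith
  have b3 : (⌈l⌉₊ : ℝ) ≤ 2 * l := natCeil_le_two_mul hl
  have b4 : (⌈u⌉₊ : ℝ) ≤ 2 * u := natCeil_le_two_mul hu
  have b5 : (⌈α⌉₊ : ℝ) ≤ 2 * α := natCeil_le_two_mul hα1
  have b6 : l ≤ ⌈l⌉₊ := Nat.le_ceil _
  have b7 : u ≤ ⌈u⌉₊ := Nat.le_ceil _
  have h1 : ⌈6 * N / g⌉₊ ≤ 4 * N := by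
    have : (⌈6 * N / g⌉₊ : ℝ) ≤ 4 * N := by
      refine b1.trans ?_
      rw [← mul_div_assoc, div_le_iff₀ hg0]
      nlinarith
    exact_mod_cast this
  have h2 : 1 ≤ ⌈u⌉₊ := Nat.one_le_ceil_iff.2 hu0
  have h3 := card_square_disc_large_le hR hM h1 h2 (Nat.ceil_le.2 (hul.trans hlN))
    (Nat.ceil_mono hul) (Nat.ceil_mono hα) T ?_ ?_ hsq
  · refine h3.trans ?_
    have hM0 : (0 : ℝ) ≤ M := by positivity
    have t1 : (N : ℝ) ^ 3 * ⌈α⌉₊ / (⌈l⌉₊ : ℝ) ^ 2 ≤ 2 * (N ^ 3 * α / l ^ 2) := by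
      calc (N : ℝ) ^ 3 * ⌈α⌉₊ / (⌈l⌉₊ : ℝ) ^ 2 ≤ N ^ 3 * (2 * α) / l ^ 2 := by gcongr
        _ = _ := by ring
    have t2 : (⌈l⌉₊ : ℝ) * N ^ 2 ≤ 2 * (l * N ^ 2) := by
      calc (⌈l⌉₊ : ℝ) * N ^ 2 ≤ 2 * l * N ^ 2 := by gcongr
        _ = _ := by ring
    have t3 : (⌈l⌉₊ : ℝ) ^ 2 * (⌈6 * N / g⌉₊ : ℝ) ^ 2 * ⌈2640 * l * N / g ^ 2⌉₊ ≤
        3041280 * (l ^ 3 * N ^ 3 / g ^ 4) := by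
      calc (⌈l⌉₊ : ℝ) ^ 2 * (⌈6 * N / g⌉₊ : ℝ) ^ 2 * ⌈2640 * l * N / g ^ 2⌉₊
          ≤ (2 * l) ^ 2 * (12 * (N / g)) ^ 2 * (5280 * (l * N / g ^ 2)) := by gcongr
        _ = _ := by
          field_simp
          norm_num
    have t4 : (⌈l⌉₊ : ℝ) ^ 2 * (⌈6 * N / g⌉₊ : ℝ) ^ 2 * N / ⌈u⌉₊ ≤
        576 * (l ^ 2 * N ^ 3 / (g ^ 2 * u)) := by
      calc (⌈l⌉₊ : ℝ) ^ 2 * (⌈6 * N / g⌉₊ : ℝ) ^ 2 * N / ⌈u⌉₊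
          ≤ (2 * l) ^ 2 * (12 * (N / g)) ^ 2 * N / u := by gcongr
        _ = _ := by
          field_simp
          norm_num
    have t5 : (N : ℝ) * (⌈u⌉₊ : ℝ) ^ 2 * (⌈6 * N / g⌉₊ : ℝ) ^ 2 ≤
        576 * (N ^ 3 * u ^ 2 / g ^ 2) := by
      calc (N : ℝ) * (⌈u⌉₊ : ℝ) ^ 2 * (⌈6 * N / g⌉₊ : ℝ) ^ 2
          ≤ (N : ℝ) * (2 * u) ^ 2 * (12 * (N / g)) ^ 2 := by gcongr
        _ = _ := by
          field_simp
          norm_num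
    have p1 : 0 ≤ (N : ℝ) ^ 3 * α / l ^ 2 := by positivity
    have p2 : 0 ≤ l * (N : ℝ) ^ 2 := by positivity
    have p4 : 0 ≤ l ^ 2 * (N : ℝ) ^ 3 / (g ^ 2 * u) := by positivity
    have p5 : 0 ≤ (N : ℝ) ^ 3 * u ^ 2 / g ^ 2 := by positivity
    have p3 : 0 ≤ l ^ 3 * (N : ℝ) ^ 3 / g ^ 4 := by positivity
    calc _ ≤ 30000000 * (M : ℝ) ^ 4 * (3041280 * (N ^ 3 * α / l ^ 2 + l * N ^ 2 +
        l ^ 3 * N ^ 3 / g ^ 4 + l ^ 2 * N ^ 3 / (g ^ 2 * u) + N ^ 3 * u ^ 2 / g ^ 2)) := by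
          gcongr
          linarith
      _ = 91238400000000 * ((M : ℝ) ^ 4 * (N ^ 3 * α / l ^ 2 + l * N ^ 2 +
        l ^ 3 * N ^ 3 / g ^ 4 + l ^ 2 * N ^ 3 / (g ^ 2 * u) + N ^ 3 * u ^ 2 / g ^ 2)) := by ring
      _ ≤ 100000000000000 * ((M : ℝ) ^ 4 * (N ^ 3 * α / l ^ 2 + l * N ^ 2 +
        l ^ 3 * N ^ 3 / g ^ 4 + l ^ 2 * N ^ 3 / (g ^ 2 * u) + N ^ 3 * u ^ 2 / g ^ 2)) := by
          gcongr
          norm_num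
      _ = _ := by ring
  · intro s hs
    refine ⟨?_, hT s hs⟩
    have h := (hT₁ s hs).1
    have : ((⌈l * g⌉₊ : ℕ) : ℤ) ≤ (|s.1|.toNat : ℕ) := by
      rw [Nat.cast_le, Nat.ceil_le]
      have e : ((|s.1|.toNat : ℕ) : ℤ) = |s.1| := Int.toNat_of_nonneg (abs_nonneg _)
      have e' : ((|s.1|.toNat : ℕ) : ℝ) = |(s.1 : ℝ)| := by
        exact_mod_cast congrArg (Int.cast (R := ℝ)) e
      rwa [e']
    rwa [Int.toNat_of_nonneg (abs_nonneg _)] at this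
  · intro s hs
    have h : |(s.1 : ℝ)| ≤ (⌈α⌉₊ : ℝ) := (hT₁ s hs).2.trans (Nat.le_ceil _)
    exact_mod_cast h

/-- Quartics with square discriminant and cubic coefficient of size about `N ^ σ`. -/
theorem card_square_disc_rpow_le {N M : ℕ} {σ : ℝ} (hN : 152 ≤ (N : ℝ) ^ (2 / 5 : ℝ))
    (hσ : 113 / 125 ≤ σ) (hσ1 : σ ≤ 1)
    (hM : IsDivisorBound (20000 * N ^ 6) M) (T : Finset (ℤ × ℤ × ℤ × ℤ))
    (hT : ∀ s ∈ T, |s.1| ≤ N ∧ |s.2.1| ≤ N ∧ |s.2.2.1| ≤ N ∧ |s.2.2.2| ≤ N)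
    (hT₁ : ∀ s ∈ T, (N : ℝ) ^ σ ≤ |(s.1 : ℝ)| ∧ |(s.1 : ℝ)| ≤ (N : ℝ) ^ (σ + 3 / 500))
    (hsq : ∀ s ∈ T, ∃ y : ℤ, 4 * quarticI s.1 s.2.1 s.2.2.1 s.2.2.2 ^ 3 =
      quarticJ s.1 s.2.1 s.2.2.1 s.2.2.2 ^ 2 + 27 * y ^ 2) :
    (T.card : ℝ) ≤ 500000000000000 * M ^ 4 * (N : ℝ) ^ (581 / 200 : ℝ) := by
  have hN1 : (1 : ℝ) ≤ N := by
    rcases Nat.eq_zero_or_pos N with rfl | h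
    · norm_num at hN
    · exact_mod_cast h
  have hN0 : (0 : ℝ) < N := by linarith
  set ρ := (σ + 51 / 500) / 2 with hρ
  set τ := (σ - 51 / 500) / 2 with hτ
  have hmul : (N : ℝ) ^ ρ * (N : ℝ) ^ τ = (N : ℝ) ^ σ := by
    rw [← Real.rpow_add hN0]
    congr 1
    rw [hρ, hτ]
    ring
  have hmono : ∀ {a b : ℝ}, a ≤ b → (N : ℝ) ^ a ≤ (N : ℝ) ^ b :=
    fun h => Real.rpow_le_rpow_of_exponent_le hN1 h
  have h := card_square_disc_scaled_le (N := N) (M := M) (l := (N : ℝ) ^ ρ) (g := (N : ℝ) ^ τ)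
    (u := (N : ℝ) ^ (33 / 100 : ℝ)) (α := (N : ℝ) ^ (σ + 3 / 500))
    (Real.one_le_rpow hN1 (by linarith)) (hN.trans (hmono (by linarith))) ?_ ?_
    (Real.one_le_rpow hN1 (by norm_num)) (hmono (by linarith)) ?_ hM T hT ?_ hsq
  · refine h.trans ?_
    have c3 : (N : ℝ) ^ 3 = (N : ℝ) ^ (3 : ℝ) := by norm_cast
    have c2 : (N : ℝ) ^ 2 = (N : ℝ) ^ (2 : ℝ) := by norm_cast
    have e1 : (N : ℝ) ^ 3 * (N : ℝ) ^ (σ + 3 / 500) / ((N : ℝ) ^ ρ) ^ 2 ≤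
        (N : ℝ) ^ (581 / 200 : ℝ) := by
      rw [c3, ← Real.rpow_mul_natCast hN0.le, ← Real.rpow_add hN0, ← Real.rpow_sub hN0]
      apply hmono
      push_cast
      linarith
    have e2 : (N : ℝ) ^ ρ * (N : ℝ) ^ 2 ≤ (N : ℝ) ^ (581 / 200 : ℝ) := by
      rw [c2, ← Real.rpow_add hN0]
      apply hmono
      linarith
    have e3 : ((N : ℝ) ^ ρ) ^ 3 * (N : ℝ) ^ 3 / ((N : ℝ) ^ τ) ^ 4 ≤
        (N : ℝ) ^ (581 / 200 : ℝ) := by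
      rw [c3, ← Real.rpow_mul_natCast hN0.le, ← Real.rpow_mul_natCast hN0.le,
        ← Real.rpow_add hN0, ← Real.rpow_sub hN0]
      apply hmono
      push_cast
      linarith
    have e4 : ((N : ℝ) ^ ρ) ^ 2 * (N : ℝ) ^ 3 /
        (((N : ℝ) ^ τ) ^ 2 * (N : ℝ) ^ (33 / 100 : ℝ)) ≤ (N : ℝ) ^ (581 / 200 : ℝ) := by
      rw [c3, ← Real.rpow_mul_natCast hN0.le, ← Real.rpow_mul_natCast hN0.le,
        ← Real.rpow_add hN0, ← Real.rpow_add hN0, ← Real.rpow_sub hN0]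
      apply hmono
      push_cast
      linarith
    have e5 : (N : ℝ) ^ 3 * ((N : ℝ) ^ (33 / 100 : ℝ)) ^ 2 / ((N : ℝ) ^ τ) ^ 2 ≤
        (N : ℝ) ^ (581 / 200 : ℝ) := by
      rw [c3, ← Real.rpow_mul_natCast hN0.le, ← Real.rpow_mul_natCast hN0.le,
        ← Real.rpow_add hN0, ← Real.rpow_sub hN0]
      apply hmono
      push_cast
      linarith
    calc _ ≤ 100000000000000 * (M : ℝ) ^ 4 * (5 * (N : ℝ) ^ (581 / 200 : ℝ)) := by
          gcongr
          linarith
      _ = _ := by ring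
  · rw [← Real.rpow_mul_natCast hN0.le]
    calc (N : ℝ) = (N : ℝ) ^ (1 : ℝ) := (Real.rpow_one _).symm
      _ ≤ _ := hmono (by push_cast; linarith)
  · rw [hmul]
    calc (N : ℝ) ^ σ ≤ (N : ℝ) ^ (1 : ℝ) := hmono hσ1
      _ = N := Real.rpow_one _
  · rw [hmul]
    exact hmono (by linarith)
  · rwa [hmul]

theorem exists_isDivisorBound {η : ℝ} (hη : 0 < η) :
    ∃ K : ℝ, 1 ≤ K ∧ ∀ Q : ℕ, 1 ≤ Q → ∃ M : ℕ, IsDivisorBound Q M ∧ (M : ℝ) ≤ K * (Q : ℝ) ^ η := by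
  obtain ⟨K, hK, hd⟩ := exists_card_divisors_le_rpow hη
  have hη' : 0 < 1 / η := by positivity
  refine ⟨2 * (K + 1 + 1 / η), by linarith, fun Q hQ => ?_⟩
  have hQ1 : (1 : ℝ) ≤ Q := by exact_mod_cast hQ
  have hQη : 1 ≤ (Q : ℝ) ^ η := Real.one_le_rpow hQ1 hη.le
  refine ⟨⌈(K + 1 + 1 / η) * (Q : ℝ) ^ η⌉₊, ⟨fun n hn hnQ => ?_, ?_⟩, ?_⟩
  · have h : (n.divisors.card : ℝ) ≤ (K + 1 + 1 / η) * (Q : ℝ) ^ η := by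
      refine (hd n hn).trans ?_
      gcongr
      linarith
    exact_mod_cast h.trans (Nat.le_ceil _)
  · refine le_trans ?_ (Nat.le_ceil _)
    have h1 := harmonic_le_one_add_log Q
    have h2 := Real.log_le_rpow_div (x := (Q : ℝ)) (by linarith) hη
    have h3 : ((harmonic Q : ℚ) : ℝ) = ∑ n ∈ Finset.Icc (1 : ℕ) Q, (1 / n : ℝ) := by
      rw [harmonic_eq_sum_Icc]
      push_cast
      exact Finset.sum_congr rfl fun n _ => (one_div _).symm
    rw [← h3]
    calc ((harmonic Q : ℚ) : ℝ) ≤ 1 + (Q : ℝ) ^ η / η := by linarith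
      _ = 1 + (1 / η) * (Q : ℝ) ^ η := by ring
      _ ≤ (K + 1 + 1 / η) * (Q : ℝ) ^ η := by nlinarith
  · have h : 1 ≤ (K + 1 + 1 / η) * (Q : ℝ) ^ η := one_le_mul_of_one_le_of_one_le (by linarith) hQη
    exact (natCeil_le_two_mul h).trans_eq (by ring)

theorem card_resolvent_quartics_le {N M : ℕ} (hN : 1 ≤ N) (hM : IsDivisorBound (20000 * N ^ 6) M)
    (T : Finset (ℤ × ℤ × ℤ × ℤ))
    (hT : ∀ s ∈ T, |s.1| ≤ N ∧ |s.2.1| ≤ N ∧ |s.2.2.1| ≤ N ∧ |s.2.2.2| ≤ N)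
    (hx : ∀ s ∈ T, ∃ x : ℤ, (x ^ 2 - 4 * s.2.2.2) * (s.1 ^ 2 - 4 * s.2.1 + 4 * x) =
      (s.1 * x - 2 * s.2.2.1) ^ 2) :
    (T.card : ℝ) ≤ 34000 * N ^ 2 * M ^ 3 := by
  choose! r hr using hx
  have hQ : 36 * N ^ 2 ≤ 20000 * N ^ 6 := by
    have : N ^ 2 ≤ N ^ 6 := Nat.pow_le_pow_right hN (by norm_num)
    omega
  have h := card_resolventRoot_le N hN M (hM.mono hQ).2
    (T.image fun s : ℤ × ℤ × ℤ × ℤ => (s.1, s.2.1, s.2.2.1, s.2.2.2, r s)) ?_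
  · rwa [Finset.card_image_of_injOn] at h
    rintro ⟨a, b, c, d⟩ - ⟨a', b', c', d'⟩ - h
    simp only [Prod.mk.injEq] at h ⊢
    tauto
  · intro t ht
    obtain ⟨s, hs, rfl⟩ := Finset.mem_image.1 ht
    obtain ⟨h1, h2, h3, h4⟩ := hT s hs
    exact ⟨h1, h2, h3, h4, hr s hs⟩

theorem card_square_disc_small_le {N M : ℕ} {x : ℝ} (hN : 1 ≤ N) (hx : 1 ≤ x)
    (hM : IsDivisorBound (20000 * N ^ 6) M) (T : Finset (ℤ × ℤ × ℤ × ℤ))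
    (hT : ∀ s ∈ T, |s.1| ≤ N ∧ |s.2.1| ≤ N ∧ |s.2.2.1| ≤ N ∧ |s.2.2.2| ≤ N)
    (hTx : ∀ s ∈ T, |(s.1 : ℝ)| ≤ x)
    (hsq : ∀ s ∈ T, ∃ y : ℤ, 4 * quarticI s.1 s.2.1 s.2.2.1 s.2.2.2 ^ 3 =
      quarticJ s.1 s.2.1 s.2.2.1 s.2.2.2 ^ 2 + 27 * y ^ 2) :
    (T.card : ℝ) ≤ 3 * x * (8200 * N ^ 2 * M ^ 3) := by
  refine card_le_mul_of_fibers T (fun s => s.1) _ _ (by positivity) ?_ ?_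
  · have h1 : (T.image fun s => s.1) ⊆ Finset.Icc (-⌊x⌋) ⌊x⌋ := by
      intro y hy
      obtain ⟨s, hs, rfl⟩ := Finset.mem_image.1 hy
      have h := abs_le.1 (hTx s hs)
      rw [Finset.mem_Icc, neg_le, Int.le_floor, Int.le_floor]
      push_cast
      constructor <;> linarith
    have h2 := Finset.card_le_card h1
    rw [Int.card_Icc] at h2
    have h3 : 0 ≤ ⌊x⌋ := Int.floor_nonneg.2 (by linarith)
    have h4 : ((T.image fun s => s.1).card : ℤ) ≤ 2 * ⌊x⌋ + 1 := by omega
    have h5 : ((T.image fun s => s.1).card : ℝ) ≤ 2 * (⌊x⌋ : ℝ) + 1 := by exact_mod_cast h4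
    have h6 := Int.floor_le x
    linarith
  · intro a ha
    obtain ⟨s, hs, rfl⟩ := Finset.mem_image.1 ha
    have h := card_fixed_cubic_coeff_le N M hN hM s.1 (hT s hs).1
      ((T.filter fun t => t.1 = s.1).image Prod.snd) ?_ ?_
    · rwa [Finset.card_image_of_injOn] at h
      intro t ht t' ht' e
      simp only [Finset.coe_filter, Set.mem_ofPred_eq] at ht ht'
      exact Prod.ext (ht.2.trans ht'.2.symm) e
    · intro t ht
      obtain ⟨t', ht', rfl⟩ := Finset.mem_image.1 ht
      exact (hT t' (Finset.mem_filter.1 ht').1).2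
    · intro t ht
      obtain ⟨t', ht', rfl⟩ := Finset.mem_image.1 ht
      obtain ⟨h1, h2⟩ := Finset.mem_filter.1 ht'
      rw [← h2]
      exact hsq t' h1

theorem card_square_disc_le {N M : ℕ} (hN : 152 ≤ (N : ℝ) ^ (2 / 5 : ℝ))
    (hM : IsDivisorBound (20000 * N ^ 6) M) (T : Finset (ℤ × ℤ × ℤ × ℤ))
    (hT : ∀ s ∈ T, |s.1| ≤ N ∧ |s.2.1| ≤ N ∧ |s.2.2.1| ≤ N ∧ |s.2.2.2| ≤ N)
    (hsq : ∀ s ∈ T, ∃ y : ℤ, 4 * quarticI s.1 s.2.1 s.2.2.1 s.2.2.2 ^ 3 =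
      quarticJ s.1 s.2.1 s.2.2.1 s.2.2.2 ^ 2 + 27 * y ^ 2) :
    (T.card : ℝ) ≤ 10000000000000000 * M ^ 4 * (N : ℝ) ^ (581 / 200 : ℝ) := by
  have hN1 : 1 ≤ N := by
    rcases Nat.eq_zero_or_pos N with rfl | h
    · norm_num at hN
    · exact h
  have hN1' : (1 : ℝ) ≤ N := by exact_mod_cast hN1
  have hM1 : (1 : ℝ) ≤ M := by
    have : 1 ≤ N ^ 6 := Nat.one_le_pow _ _ hN1
    exact_mod_cast hM.one_le (by omega)
  have key : ∀ k : ℕ, k ≤ 16 →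
      ((T.filter fun s => |(s.1 : ℝ)| ≤ (N : ℝ) ^ (113 / 125 + k * (3 / 500) : ℝ)).card : ℝ) ≤
        (24600 + k * 500000000000000) * M ^ 4 * (N : ℝ) ^ (581 / 200 : ℝ) := by
    intro k
    induction k with
    | zero =>
      intro _
      have h := card_square_disc_small_le hN1
        (x := (N : ℝ) ^ (113 / 125 + (0 : ℕ) * (3 / 500) : ℝ))
        (Real.one_le_rpow hN1' (by norm_num)) hM
        (T.filter fun s => |(s.1 : ℝ)| ≤ (N : ℝ) ^ (113 / 125 + (0 : ℕ) * (3 / 500) : ℝ))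
        (fun s hs => hT s (Finset.mem_filter.1 hs).1) (fun s hs => (Finset.mem_filter.1 hs).2)
        (fun s hs => hsq s (Finset.mem_filter.1 hs).1)
      refine h.trans ?_
      have e : (N : ℝ) ^ (113 / 125 + (0 : ℕ) * (3 / 500) : ℝ) * (N : ℝ) ^ 2 ≤
          (N : ℝ) ^ (581 / 200 : ℝ) := by
        rw [← Real.rpow_add_natCast (by linarith)]
        exact Real.rpow_le_rpow_of_exponent_le hN1' (by norm_num)
      have e' : (M : ℝ) ^ 3 ≤ M ^ 4 := pow_le_pow_right₀ hM1 (by norm_num)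
      calc _ = 24600 * (M : ℝ) ^ 3 *
            ((N : ℝ) ^ (113 / 125 + (0 : ℕ) * (3 / 500) : ℝ) * (N : ℝ) ^ 2) := by ring
        _ ≤ 24600 * (M : ℝ) ^ 4 * (N : ℝ) ^ (581 / 200 : ℝ) := by gcongr
        _ = _ := by simp
    | succ k ih =>
      intro hk
      have h1 := ih (by omega)
      have hk' : (k : ℝ) ≤ 15 := by exact_mod_cast (by omega : k ≤ 15)
      have hk0 : (0 : ℝ) ≤ k := by positivity
      set σ : ℝ := 113 / 125 + k * (3 / 500) with hσ
      have hσ' : (113 / 125 + (k + 1 : ℕ) * (3 / 500) : ℝ) = σ + 3 / 500 := by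
        push_cast
        ring
      rw [hσ']
      have h2 := card_square_disc_rpow_le (σ := σ) hN (by linarith) (by linarith) hM
        (T.filter fun s => (N : ℝ) ^ σ ≤ |(s.1 : ℝ)| ∧ |(s.1 : ℝ)| ≤ (N : ℝ) ^ (σ + 3 / 500))
        (fun s hs => hT s (Finset.mem_filter.1 hs).1) (fun s hs => (Finset.mem_filter.1 hs).2)
        (fun s hs => hsq s (Finset.mem_filter.1 hs).1)
      have h3 : (T.filter fun s => |(s.1 : ℝ)| ≤ (N : ℝ) ^ (σ + 3 / 500)) ⊆
          (T.filter fun s => |(s.1 : ℝ)| ≤ (N : ℝ) ^ σ) ∪ (T.filter fun s =>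
            (N : ℝ) ^ σ ≤ |(s.1 : ℝ)| ∧ |(s.1 : ℝ)| ≤ (N : ℝ) ^ (σ + 3 / 500)) := by
        intro s hs
        obtain ⟨h4, h5⟩ := Finset.mem_filter.1 hs
        rcases le_total |(s.1 : ℝ)| ((N : ℝ) ^ σ) with h6 | h6
        · exact Finset.mem_union_left _ (Finset.mem_filter.2 ⟨h4, h6⟩)
        · exact Finset.mem_union_right _ (Finset.mem_filter.2 ⟨h4, h6, h5⟩)
      have h4 := (Finset.card_le_card h3).trans (Finset.card_union_le _ _)
      have h5 := (Nat.cast_le (α := ℝ)).2 h4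
      push_cast at h5 ⊢
      linarith
  have h := key 16 le_rfl
  rw [Finset.filter_true_of_mem] at h
  · refine h.trans ?_
    gcongr
    norm_num
  · intro s hs
    norm_num
    exact_mod_cast (hT s hs).1

theorem card_box_le (N : ℕ) (T : Finset (ℤ × ℤ × ℤ × ℤ))
    (hT : ∀ s ∈ T, |s.1| ≤ N ∧ |s.2.1| ≤ N ∧ |s.2.2.1| ≤ N ∧ |s.2.2.2| ≤ N) :
    T.card ≤ (2 * N + 1) ^ 4 := by
  have h : T ⊆ Finset.Icc (-(N : ℤ)) N ×ˢ Finset.Icc (-(N : ℤ)) N ×ˢ Finset.Icc (-(N : ℤ)) N ×ˢ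
      Finset.Icc (-(N : ℤ)) N := by
    intro s hs
    simp only [Finset.mem_product, Finset.mem_Icc, ← abs_le]
    exact hT s hs
  refine (Finset.card_le_card h).trans_eq ?_
  simp only [Finset.card_product, Int.card_Icc]
  rw [show ((N : ℤ) + 1 - -N).toNat = 2 * N + 1 by omega]
  ring

theorem exponent_le : (1454 / 500 : ℝ) ≤ 5 / 2 + 1 / √6 := by
  have h1 : √6 ≤ 49 / 20 := Real.sqrt_le_iff.2 ⟨by norm_num, by norm_num⟩
  have h2 : (1 : ℝ) / (49 / 20) ≤ 1 / √6 := one_div_le_one_div_of_le (by positivity) h1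
  linarith

/-- Quartics in a box having square discriminant or a rational root of the cubic resolvent. -/
theorem exists_card_exceptional_le :
    ∃ K : ℝ, 0 < K ∧ ∀ N : ℕ, 1 ≤ N → ∀ T : Finset (ℤ × ℤ × ℤ × ℤ),
      (∀ s ∈ T, |s.1| ≤ N ∧ |s.2.1| ≤ N ∧ |s.2.2.1| ≤ N ∧ |s.2.2.2| ≤ N) →
      (∀ s ∈ T, (∃ y : ℤ, 4 * quarticI s.1 s.2.1 s.2.2.1 s.2.2.2 ^ 3 =
          quarticJ s.1 s.2.1 s.2.2.1 s.2.2.2 ^ 2 + 27 * y ^ 2) ∨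
        ∃ x : ℤ, (x ^ 2 - 4 * s.2.2.2) * (s.1 ^ 2 - 4 * s.2.1 + 4 * x) =
          (s.1 * x - 2 * s.2.2.1) ^ 2) →
      (T.card : ℝ) ≤ K * (N : ℝ) ^ (1454 / 500 : ℝ) := by
  classical
  obtain ⟨K, hK, hKM⟩ := exists_isDivisorBound (η := 1 / 10000) (by norm_num)
  set κ : ℝ := K * (20000 : ℝ) ^ (1 / 10000 : ℝ) with hκ
  have hκ0 : 0 < κ := by positivity
  refine ⟨(2 * 152 ^ 3 + 1) ^ 4 + 20000000000000000 * κ ^ 4, by positivity, ?_⟩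
  intro N hN T hT hTx
  have hN1 : (1 : ℝ) ≤ N := by exact_mod_cast hN
  have hN0 : (0 : ℝ) < N := by linarith
  have hNθ : 1 ≤ (N : ℝ) ^ (1454 / 500 : ℝ) := Real.one_le_rpow hN1 (by norm_num)
  rcases lt_or_ge ((N : ℝ) ^ (2 / 5 : ℝ)) 152 with hsmall | hlarge
  · have h1 : (N : ℝ) ≤ 152 ^ 3 := by
      calc (N : ℝ) = (N : ℝ) ^ (1 : ℝ) := (Real.rpow_one _).symm
        _ ≤ (N : ℝ) ^ (2 / 5 * (3 : ℕ) : ℝ) :=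
          Real.rpow_le_rpow_of_exponent_le hN1 (by norm_num)
        _ = ((N : ℝ) ^ (2 / 5 : ℝ)) ^ 3 := Real.rpow_mul_natCast hN0.le _ _
        _ ≤ 152 ^ 3 := by gcongr
    have h2 : (T.card : ℝ) ≤ (2 * N + 1) ^ 4 := by exact_mod_cast card_box_le N T hT
    calc (T.card : ℝ) ≤ (2 * N + 1) ^ 4 := h2
      _ ≤ (2 * 152 ^ 3 + 1) ^ 4 * 1 := by
        rw [mul_one]
        gcongr
      _ ≤ ((2 * 152 ^ 3 + 1) ^ 4 + 20000000000000000 * κ ^ 4) * (N : ℝ) ^ (1454 / 500 : ℝ) := by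
        gcongr
        linarith [pow_pos hκ0 4]
  · have hN6 : 1 ≤ N ^ 6 := Nat.one_le_pow _ _ hN
    obtain ⟨M, hM, hMK⟩ := hKM (20000 * N ^ 6) (by omega)
    have hM1 : (1 : ℝ) ≤ M := by exact_mod_cast hM.one_le (by omega)
    have hMκ : (M : ℝ) ≤ κ * (N : ℝ) ^ (6 / 10000 : ℝ) := by
      refine hMK.trans_eq ?_
      push_cast
      rw [Real.mul_rpow (by norm_num) (by positivity), ← Real.rpow_natCast_mul hN0.le, hκ]
      norm_num
      ring
    have hM4 : (M : ℝ) ^ 4 ≤ κ ^ 4 * (N : ℝ) ^ (24 / 10000 : ℝ) := by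
      calc (M : ℝ) ^ 4 ≤ (κ * (N : ℝ) ^ (6 / 10000 : ℝ)) ^ 4 := by gcongr
        _ = κ ^ 4 * (N : ℝ) ^ (24 / 10000 : ℝ) := by
          rw [mul_pow, ← Real.rpow_mul_natCast hN0.le]
          norm_num
    have h1 := card_square_disc_le hlarge hM (T.filter fun s => ∃ y : ℤ,
        4 * quarticI s.1 s.2.1 s.2.2.1 s.2.2.2 ^ 3 =
          quarticJ s.1 s.2.1 s.2.2.1 s.2.2.2 ^ 2 + 27 * y ^ 2)
      (fun s hs => hT s (Finset.mem_filter.1 hs).1) (fun s hs => (Finset.mem_filter.1 hs).2)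
    have h2 := card_resolvent_quartics_le hN hM (T.filter fun s => ¬ ∃ y : ℤ,
        4 * quarticI s.1 s.2.1 s.2.2.1 s.2.2.2 ^ 3 =
          quarticJ s.1 s.2.1 s.2.2.1 s.2.2.2 ^ 2 + 27 * y ^ 2)
      (fun s hs => hT s (Finset.mem_filter.1 hs).1)
      (fun s hs => (hTx s (Finset.mem_filter.1 hs).1).resolve_left (Finset.mem_filter.1 hs).2)
    have h3 := T.card_filter_add_card_filter_not (fun s => ∃ y : ℤ,
        4 * quarticI s.1 s.2.1 s.2.2.1 s.2.2.2 ^ 3 =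
          quarticJ s.1 s.2.1 s.2.2.1 s.2.2.2 ^ 2 + 27 * y ^ 2)
    have h4 : (34000 : ℝ) * N ^ 2 * M ^ 3 ≤
        10000000000000000 * M ^ 4 * (N : ℝ) ^ (581 / 200 : ℝ) := by
      have e1 : (M : ℝ) ^ 3 ≤ M ^ 4 := pow_le_pow_right₀ hM1 (by norm_num)
      have e2 : (N : ℝ) ^ 2 ≤ (N : ℝ) ^ (581 / 200 : ℝ) := by
        rw [← Real.rpow_natCast]
        exact Real.rpow_le_rpow_of_exponent_le hN1 (by norm_num)
      calc (34000 : ℝ) * N ^ 2 * M ^ 3 ≤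
          10000000000000000 * (N : ℝ) ^ (581 / 200 : ℝ) * M ^ 4 := by
            gcongr
            norm_num
        _ = _ := by ring
    have h5 : (N : ℝ) ^ (24 / 10000 : ℝ) * (N : ℝ) ^ (581 / 200 : ℝ) ≤
        (N : ℝ) ^ (1454 / 500 : ℝ) := by
      rw [← Real.rpow_add hN0]
      exact Real.rpow_le_rpow_of_exponent_le hN1 (by norm_num)
    calc (T.card : ℝ) ≤ 20000000000000000 * (M ^ 4 * (N : ℝ) ^ (581 / 200 : ℝ)) := by
          rw [← h3]
          push_cast
          linarith
      _ ≤ 20000000000000000 *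
          (κ ^ 4 * (N : ℝ) ^ (24 / 10000 : ℝ) * (N : ℝ) ^ (581 / 200 : ℝ)) := by gcongr
      _ = 20000000000000000 * κ ^ 4 *
          ((N : ℝ) ^ (24 / 10000 : ℝ) * (N : ℝ) ^ (581 / 200 : ℝ)) := by ring
      _ ≤ 20000000000000000 * κ ^ 4 * (N : ℝ) ^ (1454 / 500 : ℝ) := by gcongr
      _ ≤ _ := by
        gcongr
        norm_num

/-- The number of monic, irreducible, non-`S₄` quartic polynomials with integer
coefficients bounded by `H` is `O_ε(H^{5/2 + 1/√6 + ε})`. -/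
theorem quartic_nonS4_count :
    ∀ ε : ℝ, 0 < ε → ∃ K : ℝ, 0 < K ∧ ∀ H : ℝ, 2 ≤ H →
      (Set.ncard {p : ℤ × ℤ × ℤ × ℤ |
          |(p.1 : ℝ)| ≤ H ∧ |(p.2.1 : ℝ)| ≤ H ∧ |(p.2.2.1 : ℝ)| ≤ H ∧ |(p.2.2.2 : ℝ)| ≤ H ∧
          Irreducible (X ^ 4 + C (p.1 : ℚ) * X ^ 3 + C (p.2.1 : ℚ) * X ^ 2 + C (p.2.2.1 : ℚ) * X
              + C (p.2.2.2 : ℚ)) ∧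
          ¬ Nonempty
            ((X ^ 4 + C (p.1 : ℚ) * X ^ 3 + C (p.2.1 : ℚ) * X ^ 2 + C (p.2.2.1 : ℚ) * X
                + C (p.2.2.2 : ℚ)).Gal
              ≃* Equiv.Perm (Fin 4))} : ℝ)
        ≤ K * H ^ ((5 : ℝ) / 2 + 1 / Real.sqrt 6 + ε) := by
  intro ε hε
  obtain ⟨K, hK, hcard⟩ := exists_card_exceptional_le
  refine ⟨K, hK, fun H hH => ?_⟩
  have hfloor : ∀ a : ℤ, |(a : ℝ)| ≤ H → |a| ≤ (⌊H⌋₊ : ℤ) := by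
    intro a ha
    rw [Int.natCast_floor_eq_floor (by linarith), Int.le_floor]
    exact_mod_cast ha
  generalize hE : {p : ℤ × ℤ × ℤ × ℤ | _} = E
  have hbox : ∀ p ∈ E, |p.1| ≤ (⌊H⌋₊ : ℤ) ∧ |p.2.1| ≤ (⌊H⌋₊ : ℤ) ∧ |p.2.2.1| ≤ (⌊H⌋₊ : ℤ) ∧
      |p.2.2.2| ≤ (⌊H⌋₊ : ℤ) := by
    intro p hp
    rw [← hE] at hp
    obtain ⟨h1, h2, h3, h4, -⟩ := hp
    exact ⟨hfloor _ h1, hfloor _ h2, hfloor _ h3, hfloor _ h4⟩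
  have hfin : E.Finite := by
    refine Set.Finite.subset (Finset.finite_toSet (Finset.Icc (-(⌊H⌋₊ : ℤ)) ⌊H⌋₊ ×ˢ
      Finset.Icc (-(⌊H⌋₊ : ℤ)) ⌊H⌋₊ ×ˢ Finset.Icc (-(⌊H⌋₊ : ℤ)) ⌊H⌋₊ ×ˢ
      Finset.Icc (-(⌊H⌋₊ : ℤ)) ⌊H⌋₊)) ?_
    intro p hp
    simp only [Finset.mem_coe, Finset.mem_product, Finset.mem_Icc, ← abs_le]
    exact hbox p hp
  have hH1 : 1 ≤ ⌊H⌋₊ := Nat.le_floor (by norm_num; linarith)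
  rw [Set.ncard_eq_toFinset_card E hfin]
  refine (hcard ⌊H⌋₊ hH1 hfin.toFinset (fun p hp => hbox p (hfin.mem_toFinset.1 hp)) ?_).trans ?_
  · intro p hp
    rw [Set.Finite.mem_toFinset, ← hE] at hp
    obtain ⟨-, -, -, -, hirr, hG⟩ := hp
    exact square_disc_or_resolvent_root_int _ _ _ _ _ rfl hirr hG
  · have h1 : (⌊H⌋₊ : ℝ) ≤ H := Nat.floor_le (by linarith)
    have h2 := exponent_le
    gcongr K * ?_
    calc (⌊H⌋₊ : ℝ) ^ (1454 / 500 : ℝ) ≤ H ^ (1454 / 500 : ℝ) := by gcongr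
      _ ≤ H ^ ((5 : ℝ) / 2 + 1 / Real.sqrt 6 + ε) :=
        Real.rpow_le_rpow_of_exponent_le (by linarith) (by linarith)
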